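/- Let q = (q_n : n ∈ ℤ), q' = (q'_n : n ∈ ℤ) ∈ (0,1)^ℤ. If there exists ε > 0 such that for every n ∈ ℤ one has κ_□(q_n, q'_n) = q_n + q'_n − 1 = 0 and q_n, q'_n ≥ ε, then the highly inhomogeneous measure P^□_{q,q'} on the diagonally oriented square lattice has the box-crossing property. -/

import Mathlib

open MeasureTheory Set

set_option linter.unusedVariables false

namespace Perc

/-- Points of the plane. -/
abbrev Pt := ℝ × ℝ

/-- A lattice embedded in the plane, with edges indexed by `E`;
each edge is embedded as the segment between the two endpoints given by `ends`. -/
structure LatticeOn (E : Type) where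
  ends : E → Pt × Pt

/-- Bond configurations. -/
abbrev Config (E : Type) := E → Bool

/-- `P` is the Bernoulli bond-percolation product measure in which edge `e`
is open with probability `p e`, independently over edges. -/
def IsBernoulliProduct {E : Type} (p : E → ℝ) (P : Measure (Config E)) : Prop :=
  IsProbabilityMeasure P ∧
    ∀ (s : Finset E) (f : E → Bool),
      P {ω | ∀ e ∈ s, ω e = f e} =
        ∏ e ∈ s, ENNReal.ofReal (if f e then p e else 1 - p e)

/-- The union of the closed segments of the open edges. -/
def openEdgeSet {E : Type} (L : LatticeOn E) (ω : Config E) : Set Pt :=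
  ⋃ e ∈ {e : E | ω e = true}, segment ℝ (L.ends e).1 (L.ends e).2

/-- There is an arc, contained in `S` and in the union of the open edges,
with one endpoint in `A` and the other in `B`. -/
def CrossingIn {E : Type} (L : LatticeOn E) (ω : Config E) (S A B : Set Pt) : Prop :=
  ∃ γ : ℝ → Pt, ContinuousOn γ (Icc 0 1) ∧ γ 0 ∈ A ∧ γ 1 ∈ B ∧
    ∀ t ∈ Icc (0:ℝ) 1, γ t ∈ S ∩ openEdgeSet L ω

/-- Rotation of the plane by angle `θ`. -/
noncomputable def rot (θ : ℝ) (z : Pt) : Pt :=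
  (Real.cos θ * z.1 - Real.sin θ * z.2, Real.sin θ * z.1 + Real.cos θ * z.2)

/-- `f` comprises a rotation and a translation. -/
def IsRotTrans (f : Pt → Pt) : Prop := ∃ θ : ℝ, ∃ t : Pt, f = fun z => rot θ z + t

def stdRect (h l : ℝ) : Set Pt := {z | 0 ≤ z.1 ∧ z.1 ≤ h ∧ 0 ≤ z.2 ∧ z.2 ≤ l}
def leftSide (h l : ℝ) : Set Pt := {z | z.1 = 0 ∧ 0 ≤ z.2 ∧ z.2 ≤ l}
def rightSide (h l : ℝ) : Set Pt := {z | z.1 = h ∧ 0 ≤ z.2 ∧ z.2 ≤ l}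
def bottomSide (h l : ℝ) : Set Pt := {z | z.2 = 0 ∧ 0 ≤ z.1 ∧ z.1 ≤ h}
def topSide (h l : ℝ) : Set Pt := {z | z.2 = l ∧ 0 ≤ z.1 ∧ z.1 ≤ h}

/-- The box `f(stdRect h l)` (where `f` is a rotation plus translation) possesses
open crossings in both directions. -/
def HasBoxCrossings {E : Type} (L : LatticeOn E) (ω : Config E) (h l : ℝ) (f : Pt → Pt) : Prop :=
  CrossingIn L ω (f '' stdRect h l) (f '' leftSide h l) (f '' rightSide h l) ∧
  CrossingIn L ω (f '' stdRect h l) (f '' bottomSide h l) (f '' topSide h l)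

/-- The box-crossing property: for every `α > 0` there is `δ > 0` such that every box
of size `αN × N` (any position and orientation) possesses open crossings with
probability at least `δ`, for all large `N`. -/
def BoxCrossingProperty {E : Type} (L : LatticeOn E) (P : Measure (Config E)) : Prop :=
  ∀ α : ℝ, 0 < α → ∃ δ : ℝ, 0 < δ ∧ ∃ N₀ : ℕ, ∀ N : ℕ, N₀ ≤ N →
    ∀ f : Pt → Pt, IsRotTrans f →
      ENNReal.ofReal δ ≤ P {ω | HasBoxCrossings L ω (α * N) N f}

/-- Horizontal-crossing event of the box `[-m,m] × [0,n]`. -/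
def Ch {E : Type} (L : LatticeOn E) (m n : ℝ) (ω : Config E) : Prop :=
  CrossingIn L ω {z | -m ≤ z.1 ∧ z.1 ≤ m ∧ 0 ≤ z.2 ∧ z.2 ≤ n}
    {z | z.1 = -m ∧ 0 ≤ z.2 ∧ z.2 ≤ n} {z | z.1 = m ∧ 0 ≤ z.2 ∧ z.2 ≤ n}

/-- Vertical-crossing event of the box `[-m,m] × [0,n]`. -/
def Cv {E : Type} (L : LatticeOn E) (m n : ℝ) (ω : Config E) : Prop :=
  CrossingIn L ω {z | -m ≤ z.1 ∧ z.1 ≤ m ∧ 0 ≤ z.2 ∧ z.2 ≤ n}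
    {z | z.2 = 0 ∧ -m ≤ z.1 ∧ z.1 ≤ m} {z | z.2 = n ∧ -m ≤ z.1 ∧ z.1 ≤ m}

/-- `u` and `v` are the endpoints of some open edge. -/
def openAdj {E : Type} (L : LatticeOn E) (ω : Config E) (u v : Pt) : Prop :=
  ∃ e, ω e = true ∧ (L.ends e = (u, v) ∨ L.ends e = (v, u))

/-- `u` and `v` are joined by a path of open edges. -/
def openConn {E : Type} (L : LatticeOn E) (ω : Config E) : Pt → Pt → Prop :=
  Relation.ReflTransGen (openAdj L ω)

/-- The open cluster at `v`. -/
def cluster {E : Type} (L : LatticeOn E) (ω : Config E) (v : Pt) : Set Pt :=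
  {u | openConn L ω v u}

/-- The vertex set of the lattice. -/
def vertexSet {E : Type} (L : LatticeOn E) : Set Pt :=
  ⋃ e : E, {(L.ends e).1, (L.ends e).2}

/-- `v` is the endpoint of an infinite open self-avoiding path. -/
def ConnToInfinity {E : Type} (L : LatticeOn E) (ω : Config E) (v : Pt) : Prop :=
  ∃ γ : ℕ → Pt, γ 0 = v ∧ Function.Injective γ ∧ ∀ n, openAdj L ω (γ n) (γ (n + 1))

/-- Euclidean distance on the plane. -/
noncomputable def edist2 (u v : Pt) : ℝ := Real.sqrt ((u.1 - v.1) ^ 2 + (u.2 - v.2) ^ 2)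

/-- `rad (C_v) ≥ r`, where `rad (C_v)` is the supremum of all `x` such that `C_v`
meets the complement of the open Euclidean ball `v + S_x`. -/
def RadiusGE {E : Type} (L : LatticeOn E) (ω : Config E) (v : Pt) (r : ℝ) : Prop :=
  ∀ x : ℝ, x < r → ∃ u ∈ cluster L ω v, x ≤ edist2 v u

/-- `κ_□`. -/
def kappaS (a b : ℝ) : ℝ := a + b - 1
/-- `κ_△`. -/
def kappaT (a b c : ℝ) : ℝ := a + b + c - a * b * c - 1
/-- `κ_⬡`. -/
def kappaH (a b c : ℝ) : ℝ := -kappaT (1 - a) (1 - b) (1 - c)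

/-- Edges of a square-type lattice: `(a, b, true)` is the `horizontal`-class edge
at `(a,b)` and `(a, b, false)` the `vertical`-class edge at `(a,b)`. -/
abbrev SqE := ℤ × ℤ × Bool
/-- Edges of the triangular lattice (also indexing the dual hexagonal edges):
`(a, b, i)` with `i = 0` horizontal, `i = 1` the right edge of an upwards pointing
triangle, `i = 2` the left edge of an upwards pointing triangle, in row `b`. -/
abbrev TriE := ℤ × ℤ × Fin 3

/-- The unit square lattice, with vertex set `ℤ²`. -/
noncomputable def sqLattice : LatticeOn SqE :=
  ⟨fun e =>
    if e.2.2 then (((e.1 : ℝ), (e.2.1 : ℝ)), ((e.1 : ℝ) + 1, (e.2.1 : ℝ)))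
    else (((e.1 : ℝ), (e.2.1 : ℝ)), ((e.1 : ℝ), (e.2.1 : ℝ) + 1))⟩

/-- The dual of the unit square lattice (shifted by `(1/2, 1/2)`), with each dual edge
indexed by the primal edge it crosses. -/
noncomputable def sqDualLattice : LatticeOn SqE :=
  ⟨fun e =>
    if e.2.2 then
      (((e.1 : ℝ) + 1 / 2, (e.2.1 : ℝ) - 1 / 2), ((e.1 : ℝ) + 1 / 2, (e.2.1 : ℝ) + 1 / 2))
    else
      (((e.1 : ℝ) - 1 / 2, (e.2.1 : ℝ) + 1 / 2), ((e.1 : ℝ) + 1 / 2, (e.2.1 : ℝ) + 1 / 2))⟩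

/-- Vertices of the triangular lattice (equilateral triangles of side `√3`,
one family of edges horizontal). -/
noncomputable def tv (a b : ℤ) : Pt :=
  (Real.sqrt 3 * ((a : ℝ) + (b : ℝ) / 2), 3 / 2 * (b : ℝ))

/-- The triangular lattice. -/
noncomputable def triLattice : LatticeOn TriE :=
  ⟨fun e =>
    if e.2.2 = 0 then (tv e.1 e.2.1, tv (e.1 + 1) e.2.1)
    else if e.2.2 = 1 then (tv (e.1 + 1) e.2.1, tv e.1 (e.2.1 + 1))
    else (tv e.1 e.2.1, tv e.1 (e.2.1 + 1))⟩

/-- Circumcentre of the upwards pointing triangle with base vertex `tv a b`. -/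
noncomputable def hup (a b : ℤ) : Pt :=
  (Real.sqrt 3 * ((a : ℝ) + ((b : ℝ) + 1) / 2), 3 / 2 * (b : ℝ) + 1 / 2)

/-- Circumcentre of the downwards pointing triangle below the edge `tv a b – tv (a+1) b`. -/
noncomputable def hdown (a b : ℤ) : Pt :=
  (Real.sqrt 3 * ((a : ℝ) + ((b : ℝ) + 1) / 2), 3 / 2 * (b : ℝ) - 1 / 2)

/-- The hexagonal lattice, the planar dual of `triLattice`, with vertices at the
circumcentres of the triangles; each hexagonal edge is indexed by the triangular
edge it crosses. -/
noncomputable def hexLattice : LatticeOn TriE :=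
  ⟨fun e =>
    if e.2.2 = 0 then (hdown e.1 e.2.1, hup e.1 e.2.1)
    else if e.2.2 = 1 then (hup e.1 e.2.1, hdown e.1 (e.2.1 + 1))
    else (hup e.1 e.2.1, hdown (e.1 - 1) (e.2.1 + 1))⟩

/-- The square lattice with horizontal edges of length `√3` and vertical edges of
length `1` (as in the mixed lattices). -/
noncomputable def sqStretch : LatticeOn SqE :=
  ⟨fun e =>
    if e.2.2 then
      ((Real.sqrt 3 * (e.1 : ℝ), (e.2.1 : ℝ)), (Real.sqrt 3 * ((e.1 : ℝ) + 1), (e.2.1 : ℝ)))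
    else ((Real.sqrt 3 * (e.1 : ℝ), (e.2.1 : ℝ)), (Real.sqrt 3 * (e.1 : ℝ), (e.2.1 : ℝ) + 1))⟩

/-- Vertices of the square lattice rotated by `π/4`. -/
noncomputable def rv (a b : ℤ) : Pt :=
  (((a : ℝ) - (b : ℝ)) / Real.sqrt 2, ((a : ℝ) + (b : ℝ)) / Real.sqrt 2)

/-- The square lattice rotated by `π/4`: edges `(a,b,true)` are inclined at angle `π/4`
and edges `(a,b,false)` at angle `3π/4`; the row (height) of such an edge is `a + b`. -/
noncomputable def rsqLattice : LatticeOn SqE :=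
  ⟨fun e =>
    if e.2.2 then (rv e.1 e.2.1, rv (e.1 + 1) e.2.1)
    else (rv e.1 e.2.1, rv e.1 (e.2.1 + 1))⟩

/-- Inhomogeneous intensities on the square lattice: `ph` on horizontal edges,
`pv` on vertical ones. -/
def sqInt (ph pv : ℝ) : SqE → ℝ := fun e => if e.2.2 then ph else pv

/-- Inhomogeneous intensities on the triangular (or hexagonal) lattice:
`p0` on class-0 edges, `p1` on class-1, `p2` on class-2. -/
def triInt (p0 p1 p2 : ℝ) : TriE → ℝ := fun e => ![p0, p1, p2] e.2.2

/-- Highly inhomogeneous intensities on the triangular (or hexagonal) lattice: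
`p` on horizontal-class edges, `q n` on right edges of upwards pointing triangles at
height `n`, `q' n` on left edges of upwards pointing triangles at height `n`. -/
def triHI (p : ℝ) (q q' : ℤ → ℝ) : TriE → ℝ := fun e =>
  if e.2.2 = 0 then p else if e.2.2 = 1 then q e.2.1 else q' e.2.1

/-- Highly inhomogeneous intensities on the rotated square lattice: `q n` on edges
inclined at `π/4` at height `n`, `q' n` on edges inclined at `3π/4` at height `n`. -/
def rsqHI (q q' : ℤ → ℝ) : SqE → ℝ := fun e =>
  if e.2.2 then q (e.1 + e.2.1) else q' (e.1 + e.2.1)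

section Expectation

variable {ι κ : Type} [DecidableEq ι] [DecidableEq κ]

/-- Average of `f` over the state of the coordinate `x`. -/
def st (p : ι → ℝ) (x : ι) (f : (ι → Bool) → ℝ) (ω : ι → Bool) : ℝ :=
  p x * f (Function.update ω x true) + (1 - p x) * f (Function.update ω x false)

/-- Average of `f` over the states of the coordinates in a list. -/
def ex (p : ι → ℝ) : List ι → ((ι → Bool) → ℝ) → (ι → Bool) → ℝ
  | [], f => f
  | x :: l, f => st p x (ex p l f)

theorem ex_append (p : ι → ℝ) (l₁ l₂ : List ι) (f : (ι → Bool) → ℝ) :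
    ex p (l₁ ++ l₂) f = ex p l₁ (ex p l₂ f) := by
  induction l₁ with
  | nil => rfl
  | cons x l ih => simp [ex, ih]

theorem DependsOn.update_eq {β : Type*} {f : (ι → Bool) → β} {S : Set ι} (hf : DependsOn f S)
    {x : ι} (hx : x ∉ S) (ω : ι → Bool) (b : Bool) : f (Function.update ω x b) = f ω := by
  apply hf
  intro i hi
  rw [Function.update_of_ne]
  rintro rfl
  exact hx hi

theorem st_of_notMem (p : ι → ℝ) {x : ι} {f : (ι → Bool) → ℝ} {S : Set ι} (hf : DependsOn f S)
    (hx : x ∉ S) : st p x f = f := by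
  funext ω
  simp only [st, DependsOn.update_eq hf hx]
  ring

theorem dependsOn_st (p : ι → ℝ) (x : ι) {f : (ι → Bool) → ℝ} {S : Set ι} (hf : DependsOn f S) :
    DependsOn (st p x f) (S \ {x}) := by
  intro ω ω' h
  have : ∀ b, f (Function.update ω x b) = f (Function.update ω' x b) := by
    intro b
    apply hf
    intro i hi
    by_cases hix : i = x
    · subst hix; simp
    · rw [Function.update_of_ne hix, Function.update_of_ne hix]
      exact h i ⟨hi, hix⟩
  simp only [st, this]

theorem dependsOn_ex (p : ι → ℝ) (l : List ι) {f : (ι → Bool) → ℝ} {S : Set ι}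
    (hf : DependsOn f S) : DependsOn (ex p l f) (S \ {x | x ∈ l}) := by
  induction l with
  | nil => simpa [ex] using hf
  | cons x l ih =>
    have := dependsOn_st p x ih
    refine DependsOn.mono ?_ this
    rintro y ⟨⟨hy, h1⟩, h2⟩
    refine ⟨hy, ?_⟩
    simp only [mem_ofPred_eq, List.mem_cons, not_or] at *
    exact ⟨h2, h1⟩

theorem ex_of_disjoint (p : ι → ℝ) {l : List ι} {f : (ι → Bool) → ℝ} {S : Set ι}
    (hf : DependsOn f S) (h : ∀ x ∈ l, x ∉ S) : ex p l f = f := by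
  induction l with
  | nil => rfl
  | cons x l ih =>
    simp only [ex]
    rw [ih fun y hy => h y (by simp [hy]), st_of_notMem p hf (h x (by simp))]

theorem st_comm (p : ι → ℝ) (x y : ι) (f : (ι → Bool) → ℝ) :
    st p x (st p y f) = st p y (st p x f) := by
  by_cases hxy : x = y
  · rw [hxy]
  funext ω
  simp only [st, Function.update_comm hxy]
  ring

theorem ex_st_comm (p : ι → ℝ) (x : ι) (l : List ι) (f : (ι → Bool) → ℝ) :
    ex p l (st p x f) = st p x (ex p l f) := by
  induction l with
  | nil => rfl
  | cons y l ih => simp only [ex]; rw [ih, st_comm]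

theorem ex_comm (p : ι → ℝ) (l₁ l₂ : List ι) (f : (ι → Bool) → ℝ) :
    ex p l₁ (ex p l₂ f) = ex p l₂ (ex p l₁ f) := by
  induction l₁ with
  | nil => rfl
  | cons x l ih => simp only [ex]; rw [ih, ex_st_comm]

theorem ex_const_of_subset (p : ι → ℝ) {l : List ι} {f : (ι → Bool) → ℝ} {S : Set ι}
    (hf : DependsOn f S) (hS : ∀ x ∈ S, x ∈ l) (ω ω' : ι → Bool) : ex p l f ω = ex p l f ω' := by
  apply dependsOn_ex p l hf
  rintro x ⟨h1, h2⟩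
  exact absurd (hS x h1) h2

theorem ex_eq_ex (p : ι → ℝ) {l l' : List ι} {f : (ι → Bool) → ℝ} {S S' : Set ι}
    (hf : DependsOn f S) (hf' : DependsOn f S') (hS : ∀ x ∈ S, x ∈ l) (hS' : ∀ x ∈ S', x ∈ l')
    (ω ω' : ι → Bool) : ex p l f ω = ex p l' f ω' := by
  have h1 : ex p l' (ex p l f) = ex p l f := by
    apply ex_of_disjoint p (dependsOn_ex p l hf)
    rintro x _ ⟨h1, h2⟩
    exact h2 (hS x h1)
  have h2 : ex p l (ex p l' f) = ex p l' f := by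
    apply ex_of_disjoint p (dependsOn_ex p l' hf')
    rintro x _ ⟨h1, h2⟩
    exact h2 (hS' x h1)
  rw [← h1, ex_comm, h2]
  exact ex_const_of_subset p hf' hS' ω ω'

theorem ex_add (p : ι → ℝ) (l : List ι) (f g : (ι → Bool) → ℝ) :
    ex p l (fun ω => f ω + g ω) = fun ω => ex p l f ω + ex p l g ω := by
  induction l with
  | nil => rfl
  | cons x l ih => simp only [ex, ih]; funext ω; simp only [st]; ring

theorem ex_const (p : ι → ℝ) (l : List ι) (c : ℝ) : ex p l (fun _ => c) = fun _ => c := by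
  induction l with
  | nil => rfl
  | cons x l ih => simp only [ex, ih]; funext ω; simp only [st]; ring

theorem ex_const_mul (p : ι → ℝ) (l : List ι) (c : ℝ) (f : (ι → Bool) → ℝ) :
    ex p l (fun ω => c * f ω) = fun ω => c * ex p l f ω := by
  induction l with
  | nil => rfl
  | cons x l ih => simp only [ex, ih]; funext ω; simp only [st]; ring

theorem ex_mul_of_disjoint (p : ι → ℝ) {l : List ι} {f : (ι → Bool) → ℝ} {S : Set ι}
    (hf : DependsOn f S) (h : ∀ x ∈ l, x ∉ S) (g : (ι → Bool) → ℝ) :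
    ex p l (fun ω => f ω * g ω) = fun ω => f ω * ex p l g ω := by
  induction l with
  | nil => rfl
  | cons x l ih =>
    simp only [ex]
    rw [ih fun y hy => h y (by simp [hy])]
    funext ω
    simp only [st, DependsOn.update_eq hf (h x (by simp))]
    ring

theorem ex_congr_prob {p p' : ι → ℝ} {l : List ι} (h : ∀ x ∈ l, p x = p' x)
    (f : (ι → Bool) → ℝ) : ex p l f = ex p' l f := by
  induction l with
  | nil => rfl
  | cons x l ih =>
    simp only [ex]
    rw [ih fun y hy => h y (by simp [hy])]
    funext ω
    simp only [st, h x (by simp)]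

/-- A probability vector. -/
def IsProb (p : ι → ℝ) : Prop := ∀ x, 0 ≤ p x ∧ p x ≤ 1

theorem ex_mono {p : ι → ℝ} (hp : IsProb p) (l : List ι) {f g : (ι → Bool) → ℝ}
    (h : ∀ ω, f ω ≤ g ω) (ω : ι → Bool) : ex p l f ω ≤ ex p l g ω := by
  induction l generalizing ω with
  | nil => exact h ω
  | cons x l ih =>
    simp only [ex, st]
    have := hp x
    have h1 := mul_le_mul_of_nonneg_left (ih (Function.update ω x true)) this.1
    have h2 := mul_le_mul_of_nonneg_left (ih (Function.update ω x false)) (sub_nonneg.2 this.2)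
    linarith

/-- `f` is increasing with respect to the order in which `o x` is the larger state at `x`. -/
def Inc (o : ι → Bool) (f : (ι → Bool) → ℝ) : Prop :=
  ∀ ω ω', (∀ x, ω x = o x → ω' x = o x) → f ω ≤ f ω'

theorem Inc.ex {p : ι → ℝ} (hp : IsProb p) {o : ι → Bool} {f : (ι → Bool) → ℝ} (hf : Inc o f)
    (l : List ι) : Inc o (ex p l f) := by
  induction l with
  | nil => exact hf
  | cons x l ih =>
    intro ω ω' h
    simp only [Perc.ex, st]
    have := hp x
    have key : ∀ b, Perc.ex p l f (Function.update ω x b) ≤ Perc.ex p l f (Function.update ω' x b) := by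
      intro b
      apply ih
      intro y
      by_cases hy : y = x
      · subst hy; simp
      · simp only [Function.update_of_ne hy]; exact h y
    have h1 := mul_le_mul_of_nonneg_left (key true) this.1
    have h2 := mul_le_mul_of_nonneg_left (key false) (sub_nonneg.2 this.2)
    linarith

theorem ex_harris {p : ι → ℝ} (hp : IsProb p) {o : ι → Bool} {f g : (ι → Bool) → ℝ}
    (hf : Inc o f) (hg : Inc o g) (l : List ι) (ω : ι → Bool) :
    ex p l f ω * ex p l g ω ≤ ex p l (fun ω => f ω * g ω) ω := by
  induction l generalizing ω with
  | nil => exact le_rfl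
  | cons x l ih =>
    simp only [ex, st]
    have := hp x
    have h1 := mul_le_mul_of_nonneg_left (ih (Function.update ω x true)) this.1
    have h2 := mul_le_mul_of_nonneg_left (ih (Function.update ω x false)) (sub_nonneg.2 this.2)
    have key : 0 ≤ (ex p l f (Function.update ω x true) - ex p l f (Function.update ω x false)) *
        (ex p l g (Function.update ω x true) - ex p l g (Function.update ω x false)) := by
      have hle : ∀ {F : (ι → Bool) → ℝ}, Inc o F →
          F (Function.update ω x (!(o x))) ≤ F (Function.update ω x (o x)) := by
        intro F hF
        apply hF
        intro y
        by_cases hy : y = x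
        · subst hy; simp
        · simp only [Function.update_of_ne hy]; exact id
      have a := hle (hf.ex hp l)
      have b := hle (hg.ex hp l)
      cases ho : o x <;> simp only [ho, Bool.not_true, Bool.not_false] at a b
      · exact mul_nonneg_of_nonpos_of_nonpos (by linarith) (by linarith)
      · exact mul_nonneg (by linarith) (by linarith)
    have k2 : 0 ≤ p x * (1 - p x) := mul_nonneg this.1 (sub_nonneg.2 this.2)
    have k3 := mul_nonneg k2 key
    nlinarith

/-- `f` depends on finitely many coordinates. -/
def Loc {β : Type*} (f : (ι → Bool) → β) : Prop := ∃ S : Set ι, S.Finite ∧ DependsOn f S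

open Classical in
/-- Expectation of a local function. -/
noncomputable def E (p : ι → ℝ) (f : (ι → Bool) → ℝ) : ℝ :=
  if h : Loc f then ex p h.choose_spec.1.toFinset.toList f (fun _ => false) else 0

theorem E_eq (p : ι → ℝ) {f : (ι → Bool) → ℝ} {S : Set ι} {l : List ι} (hf : DependsOn f S)
    (hl : ∀ x ∈ S, x ∈ l) (ω : ι → Bool) : E p f = ex p l f ω := by
  have h : Loc f := ⟨S, (List.finite_toSet l).subset hl, hf⟩
  rw [E, dif_pos h]
  exact ex_eq_ex p h.choose_spec.2 hf (fun x hx => by simpa using hx) hl _ _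

theorem Loc.list {ι : Type} {β : Type*} {f : (ι → Bool) → β} (h : Loc f) :
    ∃ l : List ι, DependsOn f {x | x ∈ l} := by
  obtain ⟨S, hS, hf⟩ := h
  exact ⟨hS.toFinset.toList, by simpa using hf⟩

theorem Loc.comp₂ {ι : Type} {α β γ : Type*} {f : (ι → Bool) → α} {g : (ι → Bool) → β} (hf : Loc f)
    (hg : Loc g) (m : α → β → γ) : Loc (fun ω => m (f ω) (g ω)) := by
  obtain ⟨S, hS, hf⟩ := hf
  obtain ⟨T, hT, hg⟩ := hg
  refine ⟨S ∪ T, hS.union hT, fun ω ω' h => ?_⟩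
  simp only
  rw [hf fun x hx => h x (Or.inl hx), hg fun x hx => h x (Or.inr hx)]

theorem Loc.comp {ι : Type} {α β : Type*} {f : (ι → Bool) → α} (hf : Loc f) (m : α → β) :
    Loc (fun ω => m (f ω)) := hf.comp₂ hf (fun a _ => m a)

theorem Loc.const {ι : Type} {α : Type*} (a : α) : Loc (fun _ : ι → Bool => a) :=
  ⟨∅, finite_empty, fun _ _ _ => rfl⟩

theorem Loc.common {ι : Type} {f g : (ι → Bool) → ℝ} (hf : Loc f) (hg : Loc g) :
    ∃ l : List ι, DependsOn f {x | x ∈ l} ∧ DependsOn g {x | x ∈ l} := by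
  obtain ⟨l, hl⟩ := hf.list
  obtain ⟨l', hl'⟩ := hg.list
  refine ⟨l ++ l', DependsOn.mono ?_ hl, DependsOn.mono ?_ hl'⟩ <;> intro x <;> simp +contextual

theorem E_mono {p : ι → ℝ} (hp : IsProb p) {f g : (ι → Bool) → ℝ} (hf : Loc f) (hg : Loc g)
    (h : ∀ ω, f ω ≤ g ω) : E p f ≤ E p g := by
  obtain ⟨l, h1, h2⟩ := hf.common hg
  rw [E_eq p h1 (fun x hx => hx) (fun _ => false), E_eq p h2 (fun x hx => hx) (fun _ => false)]
  exact ex_mono hp l h _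

theorem E_add (p : ι → ℝ) {f g : (ι → Bool) → ℝ} (hf : Loc f) (hg : Loc g) :
    E p (fun ω => f ω + g ω) = E p f + E p g := by
  obtain ⟨l, h1, h2⟩ := hf.common hg
  have h3 : DependsOn (fun ω => f ω + g ω) {x | x ∈ l} := by
    intro ω ω' h; simp only [h1 h, h2 h]
  rw [E_eq p h1 (fun x hx => hx) (fun _ => false), E_eq p h2 (fun x hx => hx) (fun _ => false),
    E_eq p h3 (fun x hx => hx) (fun _ => false), ex_add]

theorem E_const (p : ι → ℝ) (c : ℝ) : E p (fun _ => c) = c := by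
  have h3 : DependsOn (fun _ : ι → Bool => c) (∅ : Set ι) := fun _ _ _ => rfl
  rw [E_eq p (l := []) h3 (by simp) (fun _ => false)]
  rfl

theorem E_harris {p : ι → ℝ} (hp : IsProb p) {o : ι → Bool} {f g : (ι → Bool) → ℝ}
    (hf : Inc o f) (hg : Inc o g) (lf : Loc f) (lg : Loc g) :
    E p f * E p g ≤ E p (fun ω => f ω * g ω) := by
  obtain ⟨l, h1, h2⟩ := lf.common lg
  have h3 : DependsOn (fun ω => f ω * g ω) {x | x ∈ l} := by
    intro ω ω' h; simp only [h1 h, h2 h]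
  rw [E_eq p h1 (fun x hx => hx) (fun _ => false), E_eq p h2 (fun x hx => hx) (fun _ => false),
    E_eq p h3 (fun x hx => hx) (fun _ => false)]
  exact ex_harris hp hf hg l _

theorem E_indep (p : ι → ℝ) {f g : (ι → Bool) → ℝ} {S T : Set ι} (hS : S.Finite)
    (hT : T.Finite) (hf : DependsOn f S) (hg : DependsOn g T) (hST : Disjoint S T) :
    E p (fun ω => f ω * g ω) = E p f * E p g := by
  have h3 : DependsOn (fun ω => f ω * g ω) (S ∪ T) := by
    intro ω ω' h
    simp only [hf fun x hx => h x (Or.inl hx), hg fun x hx => h x (Or.inr hx)]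
  rw [E_eq p (l := hS.toFinset.toList) hf (by simp) (fun _ => false),
    E_eq p (l := hS.toFinset.toList ++ hT.toFinset.toList) h3 (by simp) (fun _ => false),
    ex_append, ex_mul_of_disjoint p hf]
  · have h4 : (fun ω => f ω * ex p hT.toFinset.toList g ω) = fun ω => E p g * f ω := by
      funext ω
      rw [← E_eq p (l := hT.toFinset.toList) hg (by simp), mul_comm]
    rw [h4, ex_const_mul, mul_comm]
  · intro x hx hxS
    exact disjoint_left.1 hST hxS (by simpa using hx)

theorem E_congr_prob {p p' : ι → ℝ} {f : (ι → Bool) → ℝ} {S : Set ι} (hS : S.Finite)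
    (hf : DependsOn f S) (h : ∀ x ∈ S, p x = p' x) : E p f = E p' f := by
  rw [E_eq p (l := hS.toFinset.toList) hf (by simp) (fun _ => false),
    E_eq p' (l := hS.toFinset.toList) hf (by simp) (fun _ => false),
    ex_congr_prob (by simpa using h)]

theorem ex_reindex (p : ι → ℝ) (σ : κ ≃ ι) (φ : κ → Bool) (l : List κ) (f : (κ → Bool) → ℝ)
    (ω : ι → Bool) :
    ex p (l.map σ) (fun ω => f fun x => xor (ω (σ x)) (φ x)) ω =
      ex (fun x => if φ x then 1 - p (σ x) else p (σ x)) l f (fun x => xor (ω (σ x)) (φ x)) := by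
  induction l generalizing ω with
  | nil => rfl
  | cons y l ih =>
    simp only [List.map_cons, ex, st, ih]
    have key : ∀ b, (fun x => xor (Function.update ω (σ y) b (σ x)) (φ x)) =
        Function.update (fun x => xor (ω (σ x)) (φ x)) y (xor b (φ y)) := by
      intro b
      funext x
      by_cases hx : x = y
      · subst hx; simp
      · rw [Function.update_of_ne hx, Function.update_of_ne]
        exact fun h => hx (σ.injective h)
    rw [key, key]
    cases φ y <;> simp
    ring

theorem E_reindex (p : ι → ℝ) (σ : κ ≃ ι) (φ : κ → Bool) {f : (κ → Bool) → ℝ} (hf : Loc f) :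
    E p (fun ω => f fun x => xor (ω (σ x)) (φ x)) =
      E (fun x => if φ x then 1 - p (σ x) else p (σ x)) f := by
  obtain ⟨l, hl⟩ := hf.list
  rw [E_eq _ hl (fun _ h => h) (fun x => xor false (φ x)),
    E_eq p (S := {x | x ∈ l.map σ}) (l := l.map σ) _ (fun _ h => h) (fun _ => false), ex_reindex]
  intro ω ω' h
  apply hl
  intro x hx
  simp only
  rw [h (σ x) (by simpa using hx)]

/-! ### Probabilities of events -/

open Classical in
/-- Indicator function of an event. -/
noncomputable def ind (A : (ι → Bool) → Prop) (ω : ι → Bool) : ℝ := if A ω then 1 else 0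

/-- Probability of a local event. -/
noncomputable def Pr (p : ι → ℝ) (A : (ι → Bool) → Prop) : ℝ := E p (ind A)

/-- An event that is increasing with respect to the orientation `o`. -/
def IncE (o : ι → Bool) (A : (ι → Bool) → Prop) : Prop :=
  ∀ ω ω', (∀ x, ω x = o x → ω' x = o x) → A ω → A ω'

theorem ind_nonneg {ι : Type} (A : (ι → Bool) → Prop) (ω : ι → Bool) : 0 ≤ ind A ω := by
  unfold ind; split <;> norm_num

theorem ind_le_ind {ι : Type} {A B : (ι → Bool) → Prop} {ω ω' : ι → Bool} (h : A ω → B ω') :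
    ind A ω ≤ ind B ω' := by
  unfold ind
  by_cases hA : A ω
  · simp [hA, h hA]
  · simp only [hA, if_false]; split <;> norm_num

theorem ind_and {ι : Type} (A B : (ι → Bool) → Prop) : ind (fun ω => A ω ∧ B ω) = fun ω => ind A ω * ind B ω := by
  funext ω
  unfold ind
  by_cases hA : A ω <;> by_cases hB : B ω <;> simp [hA, hB]

theorem ind_not {ι : Type} (A : (ι → Bool) → Prop) (ω : ι → Bool) : ind (fun ω => ¬ A ω) ω = 1 - ind A ω := by
  unfold ind
  by_cases hA : A ω <;> simp [hA]

theorem Inc.ind {ι : Type} {o : ι → Bool} {A : (ι → Bool) → Prop} (h : IncE o A) : Inc o (ind A) :=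
  fun _ _ hh => ind_le_ind (h _ _ hh)

theorem DependsOn.ind {ι : Type} {A : (ι → Bool) → Prop} {S : Set ι} (h : DependsOn A S) :
    DependsOn (ind A) S := by
  intro ω ω' hh
  exact le_antisymm (ind_le_ind fun hA => (h hh).mp hA) (ind_le_ind fun hA => (h hh).mpr hA)

theorem Loc.ind {ι : Type} {A : (ι → Bool) → Prop} (h : Loc A) : Loc (ind A) := by
  obtain ⟨S, hS, h⟩ := h
  exact ⟨S, hS, DependsOn.ind h⟩

theorem Loc.and {ι : Type} {A B : (ι → Bool) → Prop} (hA : Loc A) (hB : Loc B) : Loc fun ω => A ω ∧ B ω :=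
  hA.comp₂ hB And

theorem Loc.or {ι : Type} {A B : (ι → Bool) → Prop} (hA : Loc A) (hB : Loc B) : Loc fun ω => A ω ∨ B ω :=
  hA.comp₂ hB Or

theorem Loc.not {ι : Type} {A : (ι → Bool) → Prop} (hA : Loc A) : Loc fun ω => ¬ A ω :=
  hA.comp Not

theorem Pr_mono {p : ι → ℝ} (hp : IsProb p) {A B : (ι → Bool) → Prop} (hA : Loc A) (hB : Loc B)
    (h : ∀ ω, A ω → B ω) : Pr p A ≤ Pr p B :=
  E_mono hp hA.ind hB.ind fun ω => ind_le_ind (h ω)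

theorem Pr_nonneg {p : ι → ℝ} (hp : IsProb p) {A : (ι → Bool) → Prop} (hA : Loc A) :
    0 ≤ Pr p A := by
  have := E_mono hp (Loc.const (0 : ℝ)) hA.ind (ind_nonneg A)
  rwa [E_const] at this

theorem Pr_not (p : ι → ℝ) {A : (ι → Bool) → Prop} (hA : Loc A) :
    Pr p (fun ω => ¬ A ω) = 1 - Pr p A := by
  have h := E_add p hA.ind hA.not.ind
  have h2 : (fun ω => ind A ω + ind (fun ω => ¬ A ω) ω) = fun _ => (1 : ℝ) := by
    funext ω; rw [ind_not]; ring
  rw [h2, E_const] at h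
  simp only [Pr]
  linarith

theorem Pr_or_le {p : ι → ℝ} (hp : IsProb p) {A B : (ι → Bool) → Prop} (hA : Loc A)
    (hB : Loc B) : Pr p (fun ω => A ω ∨ B ω) ≤ Pr p A + Pr p B := by
  simp only [Pr]
  rw [← E_add p hA.ind hB.ind]
  apply E_mono hp (hA.or hB).ind (hA.ind.comp₂ hB.ind _)
  intro ω
  unfold ind
  by_cases h1 : A ω <;> by_cases h2 : B ω <;> simp [h1, h2]

theorem Pr_or_of_disjoint (p : ι → ℝ) {A B : (ι → Bool) → Prop} (hA : Loc A)
    (hB : Loc B) (h : ∀ ω, A ω → ¬ B ω) : Pr p (fun ω => A ω ∨ B ω) = Pr p A + Pr p B := by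
  simp only [Pr]
  rw [← E_add p hA.ind hB.ind]
  congr 1
  funext ω
  unfold ind
  by_cases h1 : A ω
  · simp [h1, h ω h1]
  · by_cases h2 : B ω <;> simp [h1, h2]

theorem Pr_harris {p : ι → ℝ} (hp : IsProb p) {o : ι → Bool} {A B : (ι → Bool) → Prop}
    (iA : IncE o A) (iB : IncE o B) (hA : Loc A) (hB : Loc B) :
    Pr p A * Pr p B ≤ Pr p (fun ω => A ω ∧ B ω) := by
  have := E_harris hp (Inc.ind iA) (Inc.ind iB) hA.ind hB.ind
  simpa only [Pr, ind_and] using this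

theorem Pr_indep (p : ι → ℝ) {A B : (ι → Bool) → Prop} {S T : Set ι} (hS : S.Finite)
    (hT : T.Finite) (hA : DependsOn A S) (hB : DependsOn B T) (hST : Disjoint S T) :
    Pr p (fun ω => A ω ∧ B ω) = Pr p A * Pr p B := by
  have := E_indep p hS hT (DependsOn.ind hA) (DependsOn.ind hB) hST
  simpa only [Pr, ind_and] using this

theorem Pr_congr_prob {p p' : ι → ℝ} {A : (ι → Bool) → Prop} {S : Set ι} (hS : S.Finite)
    (hA : DependsOn A S) (h : ∀ x ∈ S, p x = p' x) : Pr p A = Pr p' A :=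
  E_congr_prob hS (DependsOn.ind hA) h

theorem Pr_reindex (p : ι → ℝ) (σ : κ ≃ ι) (φ : κ → Bool) {A : (κ → Bool) → Prop} (hA : Loc A) :
    Pr p (fun ω => A fun x => xor (ω (σ x)) (φ x)) =
      Pr (fun x => if φ x then 1 - p (σ x) else p (σ x)) A :=
  E_reindex p σ φ hA.ind

theorem Pr_coord (p : ι → ℝ) (x : ι) : Pr p (fun ω => ω x = true) = p x := by
  have h : DependsOn (ind fun ω : ι → Bool => ω x = true) {x} := by
    intro ω ω' hh
    simp [ind, hh x rfl]
  rw [Pr, E_eq p (l := [x]) h (by simp) (fun _ => false)]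
  simp [ex, st, ind]

/-! ### The bridge to Bernoulli product measures -/

theorem measure_ge_of_ex {p : ι → ℝ} (hp : IsProb p) {P : Measure (Config ι)}
    (hP : IsBernoulliProduct p P) (A : (ι → Bool) → Prop) (l : List ι) (hl : l.Nodup)
    (s : Finset ι) (hs : ∀ x ∈ l, x ∉ s) (g : ι → Bool)
    (hA : DependsOn A ({x | x ∈ l} ∪ s)) :
    ENNReal.ofReal (ex p l (ind A) g) * P {ω | ∀ e ∈ s, ω e = g e} ≤
      P {ω | A ω ∧ ∀ e ∈ s, ω e = g e} := by
  induction l generalizing s g with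
  | nil =>
    simp only [ex, ind]
    by_cases h : A g
    · simp only [h, if_true, ENNReal.ofReal_one, one_mul]
      apply measure_mono
      intro ω hω
      refine ⟨?_, hω⟩
      rwa [hA (y := g)]
      intro x hx
      simp only [List.not_mem_nil, ofPred_false, empty_union] at hx
      exact hω x hx
    · simp [h]
  | cons x l ih =>
    have hxs : x ∉ s := hs x (by simp)
    have hxl : x ∉ l := (List.nodup_cons.1 hl).1
    have key : ∀ b : Bool, ENNReal.ofReal (ex p l (ind A) (Function.update g x b)) *
        (ENNReal.ofReal (if b then p x else 1 - p x) * P {ω | ∀ e ∈ s, ω e = g e}) ≤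
        P ({ω | A ω ∧ ∀ e ∈ s, ω e = g e} ∩ {ω | ω x = b}) := by
      intro b
      have h := ih (List.nodup_cons.1 hl).2 (insert x s) (by
        intro y hy
        simp only [Finset.mem_insert, not_or]
        exact ⟨fun h => hxl (h ▸ hy), hs y (by simp [hy])⟩) (Function.update g x b)
        (by
          convert hA using 1
          ext y
          simp
          tauto)
      have hset : ∀ ω : ι → Bool, (∀ e ∈ insert x s, ω e = Function.update g x b e) ↔
          (ω x = b ∧ ∀ e ∈ s, ω e = g e) := by
        intro ω
        simp only [Finset.mem_insert, forall_eq_or_imp, Function.update_self]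
        apply and_congr_right
        intro _
        apply forall₂_congr
        intro e he
        rw [Function.update_of_ne]
        rintro rfl
        exact hxs he
      have hprob : P {ω | ∀ e ∈ insert x s, ω e = Function.update g x b e} =
          ENNReal.ofReal (if b then p x else 1 - p x) * P {ω | ∀ e ∈ s, ω e = g e} := by
        rw [hP.2, hP.2, Finset.prod_insert hxs]
        congr 1
        · simp
        · apply Finset.prod_congr rfl
          intro e he
          rw [Function.update_of_ne]
          rintro rfl
          exact hxs he
      rw [hprob] at h
      refine h.trans (measure_mono ?_)
      rintro ω ⟨h1, h2⟩
      rw [hset] at h2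
      exact ⟨⟨h1, h2.2⟩, h2.1⟩
    have hmeas : MeasurableSet {ω : ι → Bool | ω x = true} :=
      measurableSet_eq_fun (measurable_pi_apply x) measurable_const
    have hsplit := measure_inter_add_sdiff (μ := P) {ω | A ω ∧ ∀ e ∈ s, ω e = g e} hmeas
    have hdiff : {ω | A ω ∧ ∀ e ∈ s, ω e = g e} \ {ω : ι → Bool | ω x = true} =
        {ω | A ω ∧ ∀ e ∈ s, ω e = g e} ∩ {ω | ω x = false} := by
      ext ω; simp
    rw [hdiff] at hsplit
    rw [← hsplit]
    refine le_trans (le_of_eq ?_) (add_le_add (key true) (key false))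
    have n1 : ∀ b, 0 ≤ ex p l (ind A) (Function.update g x b) := by
      intro b
      have := ex_mono hp l (f := fun _ => 0) (ind_nonneg A) (Function.update g x b)
      rwa [ex_const] at this
    have n2 := hp x
    simp only [ex, st, if_true, Bool.false_eq_true, if_false]
    rw [ENNReal.ofReal_add (mul_nonneg n2.1 (n1 _)) (mul_nonneg (sub_nonneg.2 n2.2) (n1 _)),
      ENNReal.ofReal_mul n2.1, ENNReal.ofReal_mul (sub_nonneg.2 n2.2)]
    ring

theorem measure_ge_Pr {p : ι → ℝ} (hp : IsProb p) {P : Measure (Config ι)}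
    (hP : IsBernoulliProduct p P) {A : (ι → Bool) → Prop} (hA : Loc A) :
    ENNReal.ofReal (Pr p A) ≤ P {ω | A ω} := by
  obtain ⟨S, hS, hA⟩ := hA
  have h := measure_ge_of_ex hp hP A hS.toFinset.toList (Finset.nodup_toList _) ∅ (by simp)
    (fun _ => false) (by simpa using hA)
  rw [Pr, E_eq p (l := hS.toFinset.toList) (DependsOn.ind hA) (by simp) (fun _ => false)]
  have := hP.1
  simpa using h

end Expectation

/-- One step along the diagonal of a face of `D`. -/
inductive Step (D : Set (ℤ × ℤ)) (ω : ℤ × ℤ → Bool) : ℤ × ℤ → ℤ × ℤ → Prop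
  | ur (i j : ℤ) : (i, j) ∈ D → ω (i, j) = true → Step D ω (i, j) (i + 1, j + 1)
  | dl (i j : ℤ) : (i, j) ∈ D → ω (i, j) = true → Step D ω (i + 1, j + 1) (i, j)
  | ul (i j : ℤ) : (i, j) ∈ D → ω (i, j) = false → Step D ω (i + 1, j) (i, j + 1)
  | dr (i j : ℤ) : (i, j) ∈ D → ω (i, j) = false → Step D ω (i, j + 1) (i + 1, j)

/-- Two sites joined by a path of diagonals of faces of `D`. -/
def Conn (D : Set (ℤ × ℤ)) (ω : ℤ × ℤ → Bool) : ℤ × ℤ → ℤ × ℤ → Prop :=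
  Relation.ReflTransGen (Step D ω)

/-- The parity classes of sites. -/
def cls (c : ℤ) (v : ℤ × ℤ) : Prop := (v.1 + v.2 + c) % 2 = 0

/-- The state of a face in which its diagonal joins sites of class `c`. -/
def ori (c : ℤ) (f : ℤ × ℤ) : Bool := decide ((f.1 + f.2 + c) % 2 = 0)

/-- The face of a diagonal. -/
def face (s : (ℤ × ℤ) × (ℤ × ℤ)) : ℤ × ℤ := (min s.1.1 s.2.1, min s.1.2 s.2.2)

theorem Step.symm {D : Set (ℤ × ℤ)} {ω : ℤ × ℤ → Bool} {u v : ℤ × ℤ} (h : Step D ω u v) :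
    Step D ω v u := by
  cases h with
  | ur i j h1 h2 => exact .dl i j h1 h2
  | dl i j h1 h2 => exact .ur i j h1 h2
  | ul i j h1 h2 => exact .dr i j h1 h2
  | dr i j h1 h2 => exact .ul i j h1 h2

theorem Step.face_mem {D : Set (ℤ × ℤ)} {ω : ℤ × ℤ → Bool} {u v : ℤ × ℤ} (h : Step D ω u v) :
    face (u, v) ∈ D := by
  cases h with
  | ur i j h1 h2 => simpa [face] using h1
  | dl i j h1 h2 => simpa [face] using h1
  | ul i j h1 h2 => simpa [face] using h1
  | dr i j h1 h2 => simpa [face] using h1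

theorem Step.congr {D D' : Set (ℤ × ℤ)} {ω ω' : ℤ × ℤ → Bool} {u v : ℤ × ℤ} (h : Step D ω u v)
    (hD : face (u, v) ∈ D') (hω : ω (face (u, v)) = ω' (face (u, v))) : Step D' ω' u v := by
  cases h with
  | ur i j h1 h2 => simp [face] at hD hω; exact .ur i j hD (by rw [← hω, h2])
  | dl i j h1 h2 => simp [face] at hD hω; exact .dl i j hD (by rw [← hω, h2])
  | ul i j h1 h2 => simp [face] at hD hω; exact .ul i j hD (by rw [← hω, h2])
  | dr i j h1 h2 => simp [face] at hD hω; exact .dr i j hD (by rw [← hω, h2])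

/-- The coordinates of the ends of a step. -/
theorem Step.coord {D : Set (ℤ × ℤ)} {ω : ℤ × ℤ → Bool} {u v : ℤ × ℤ} (h : Step D ω u v) :
    (v.1 = u.1 + 1 ∨ v.1 = u.1 - 1) ∧ (v.2 = u.2 + 1 ∨ v.2 = u.2 - 1) := by
  cases h <;> simp

theorem Step.cls {D : Set (ℤ × ℤ)} {ω : ℤ × ℤ → Bool} {u v : ℤ × ℤ} (h : Step D ω u v) (c : ℤ) :
    cls c u ↔ cls c v := by
  have := h.coord
  unfold Perc.cls
  omega

theorem Step.ori {D : Set (ℤ × ℤ)} {ω : ℤ × ℤ → Bool} {u v : ℤ × ℤ} (h : Step D ω u v) {c : ℤ}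
    (hu : Perc.cls c u) : ω (face (u, v)) = ori c (face (u, v)) := by
  cases h with
  | ur i j h1 h2 => simp [face, Perc.ori, Perc.cls] at *; simp [h2]; omega
  | dl i j h1 h2 => simp [face, Perc.ori, Perc.cls] at *; simp [h2]; omega
  | ul i j h1 h2 => simp [face, Perc.ori, Perc.cls] at *; simp [h2]; omega
  | dr i j h1 h2 => simp [face, Perc.ori, Perc.cls] at *; simp [h2]; omega

/-- Steps in the same face have the same ends. -/
theorem Step.eq_of_face {D D' : Set (ℤ × ℤ)} {ω : ℤ × ℤ → Bool} {u v u' v' : ℤ × ℤ}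
    (h : Step D ω u v) (h' : Step D' ω u' v') (hf : face (u, v) = face (u', v')) :
    (u' = u ∧ v' = v) ∨ (u' = v ∧ v' = u) := by
  cases h <;> cases h' <;> simp [face] at hf <;> obtain ⟨h3, h4⟩ := hf <;> subst h3 <;> subst h4 <;>
    simp_all

theorem Step.mono {D D' : Set (ℤ × ℤ)} (hD : D ⊆ D') {ω : ℤ × ℤ → Bool} {u v : ℤ × ℤ}
    (h : Step D ω u v) : Step D' ω u v := h.congr (hD h.face_mem) rfl

theorem Conn.refl {D : Set (ℤ × ℤ)} {ω : ℤ × ℤ → Bool} {u : ℤ × ℤ} : Conn D ω u u :=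
  Relation.ReflTransGen.refl

theorem Conn.tail {D : Set (ℤ × ℤ)} {ω : ℤ × ℤ → Bool} {u v w : ℤ × ℤ} (h : Conn D ω u v)
    (h' : Step D ω v w) : Conn D ω u w := Relation.ReflTransGen.tail h h'

theorem Step.conn {D : Set (ℤ × ℤ)} {ω : ℤ × ℤ → Bool} {u v : ℤ × ℤ} (h : Step D ω u v) :
    Conn D ω u v := Conn.refl.tail h

theorem Conn.trans {D : Set (ℤ × ℤ)} {ω : ℤ × ℤ → Bool} {u v w : ℤ × ℤ} (h : Conn D ω u v)
    (h' : Conn D ω v w) : Conn D ω u w := Relation.ReflTransGen.trans h h'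

theorem Conn.symm {D : Set (ℤ × ℤ)} {ω : ℤ × ℤ → Bool} {u v : ℤ × ℤ} (h : Conn D ω u v) :
    Conn D ω v u := by
  induction h with
  | refl => exact .refl
  | tail _ h2 ih => exact h2.symm.conn.trans ih

theorem Conn.mono {D D' : Set (ℤ × ℤ)} (hD : D ⊆ D') {ω : ℤ × ℤ → Bool} {u v : ℤ × ℤ}
    (h : Conn D ω u v) : Conn D' ω u v := Relation.ReflTransGen.mono (fun _ _ h => h.mono hD) _ _ h

theorem Conn.cls {D : Set (ℤ × ℤ)} {ω : ℤ × ℤ → Bool} {u v : ℤ × ℤ} (h : Conn D ω u v) (c : ℤ) :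
    cls c u ↔ cls c v := by
  induction h with
  | refl => rfl
  | tail _ h2 ih => exact ih.trans (h2.cls c)

theorem Conn.congr {D : Set (ℤ × ℤ)} {ω ω' : ℤ × ℤ → Bool} {u v : ℤ × ℤ} (h : Conn D ω u v)
    (hω : ∀ f ∈ D, ω f = ω' f) : Conn D ω' u v :=
  Relation.ReflTransGen.mono (fun _ _ h => h.congr h.face_mem (hω _ h.face_mem)) _ _ h

theorem Conn.inc {D : Set (ℤ × ℤ)} {ω ω' : ℤ × ℤ → Bool} {u v : ℤ × ℤ} {c : ℤ}
    (h : Conn D ω u v) (hu : Perc.cls c u) (hω : ∀ f, ω f = ori c f → ω' f = ori c f) :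
    Conn D ω' u v := by
  induction h with
  | refl => exact .refl
  | @tail b d h1 h2 ih =>
    refine Conn.tail ih (h2.congr h2.face_mem ?_)
    have := h2.ori ((Conn.cls h1 c).1 hu)
    rw [this, hω _ this]

theorem dependsOn_conn (D : Set (ℤ × ℤ)) (u v : ℤ × ℤ) : DependsOn (fun ω => Conn D ω u v) D :=
  fun _ _ h => propext ⟨fun hc => hc.congr h, fun hc => hc.congr fun f hf => (h f hf).symm⟩

/-- Sites of a connection stay in the region spanned by `D`. -/
theorem Conn.induct {D : Set (ℤ × ℤ)} {ω : ℤ × ℤ → Bool} {u v : ℤ × ℤ} (h : Conn D ω u v)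
    {p : ℤ × ℤ → Prop} (hu : p u)
    (hs : ∀ w w', Conn D ω u w → Step D ω w w' → p w → p w') : p v := by
  induction h with
  | refl => exact hu
  | tail h1 h2 ih => exact hs _ _ h1 h2 ih

/-! ### Chains mod 2 -/

theorem Conn.chain {D : Set (ℤ × ℤ)} {ω : ℤ × ℤ → Bool} {u v : ℤ × ℤ} (h : Conn D ω u v) :
    ∃ Z : List ((ℤ × ℤ) × (ℤ × ℤ)), (∀ s ∈ Z, Step D ω s.1 s.2 ∧ Conn D ω u s.1) ∧
      ∀ φ : ℤ × ℤ → ZMod 2, (Z.map fun s => φ s.1 + φ s.2).sum = φ u + φ v := by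
  induction h with
  | refl => exact ⟨[], by simp, fun φ => by simp [CharTwo.add_self_eq_zero]⟩
  | @tail b c h1 h2 ih =>
    obtain ⟨Z, hZ, hφ⟩ := ih
    refine ⟨(b, c) :: Z, ?_, fun φ => ?_⟩
    · intro s hs
      rcases List.mem_cons.1 hs with rfl | hs
      · exact ⟨h2, h1⟩
      · exact hZ s hs
    · simp only [List.map_cons, List.sum_cons, hφ]
      linear_combination φ b * (CharTwo.two_eq_zero (R := ZMod 2))

/-- A diagonal unit step. -/
def IsDiag (s : (ℤ × ℤ) × (ℤ × ℤ)) : Prop :=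
  (s.2.1 = s.1.1 + 1 ∨ s.2.1 = s.1.1 - 1) ∧ (s.2.2 = s.1.2 + 1 ∨ s.2.2 = s.1.2 - 1)

open Classical in
/-- Truth value mod 2. -/
noncomputable def b2 (P : Prop) : ZMod 2 := if P then 1 else 0

theorem b2_pos {P : Prop} (h : P) : b2 P = 1 := if_pos h

theorem b2_neg {P : Prop} (h : ¬ P) : b2 P = 0 := if_neg h

/-- Indicator mod 2 of the open half-line to the right of `w`. -/
noncomputable def chi (w p : ℤ × ℤ) : ZMod 2 := b2 (p.2 = w.2 ∧ w.1 < p.1)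

/-- The number mod 2 of the steps of `Z` in the row above `w` to the right of `w`. -/
noncomputable def cnt (Z : List ((ℤ × ℤ) × (ℤ × ℤ))) (w : ℤ × ℤ) : ZMod 2 :=
  (Z.map fun s => b2 ((face s).2 = w.2 ∧ w.1 ≤ (face s).1)).sum

/-- The boundary of `Z` integrated against `φ`. -/
def bdy (Z : List ((ℤ × ℤ) × (ℤ × ℤ))) (φ : ℤ × ℤ → ZMod 2) : ZMod 2 :=
  (Z.map fun s => φ s.1 + φ s.2).sum

theorem cnt_add_cnt {Z : List ((ℤ × ℤ) × (ℤ × ℤ))} {w : ℤ × ℤ} (hd : ∀ s ∈ Z, IsDiag s)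
    (hw : ∀ s ∈ Z, s.1 ≠ w ∧ s.2 ≠ w) :
    cnt Z w + cnt Z (w.1, w.2 - 1) = bdy Z (chi w) := by
  induction Z with
  | nil => simp [cnt, bdy]
  | cons s Z ih =>
    have ih := ih (fun t ht => hd t (by simp [ht])) (fun t ht => hw t (by simp [ht]))
    have h1 := hd s (by simp)
    have h2 := hw s (by simp)
    simp only [cnt, bdy, List.map_cons, List.sum_cons] at ih ⊢
    rw [← sub_eq_zero] at ih ⊢
    obtain ⟨⟨a, b⟩, c, d⟩ := s
    obtain ⟨x, y⟩ := w
    simp only [IsDiag, face, chi, ne_eq, Prod.mk.injEq] at *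
    have key : b2 (min b d = y ∧ x ≤ min a c) + b2 (min b d = y - 1 ∧ x ≤ min a c) -
        (b2 (b = y ∧ x < a) + b2 (d = y ∧ x < c)) = 0 := by
      have e0 : ∀ P Q R S : Prop, (P ∧ ¬ Q ∧ (R ∧ ¬ S ∨ ¬ R ∧ S) ∨
          ¬ P ∧ Q ∧ (R ∧ ¬ S ∨ ¬ R ∧ S) ∨ ¬ P ∧ ¬ Q ∧ (R ↔ S)) →
          b2 P + b2 Q - (b2 R + b2 S) = 0 := by
        intro P Q R S h
        by_cases hP : P <;> by_cases hQ : Q <;> by_cases hR : R <;> by_cases hS : S <;>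
          simp [hP, hQ, hR, hS, b2] at h ⊢ <;> decide
      apply e0
      omega
    linear_combination ih + key

theorem cnt_shift {Z : List ((ℤ × ℤ) × (ℤ × ℤ))} {x y : ℤ} (h : ∀ s ∈ Z, face s ≠ (x, y)) :
    cnt Z (x, y) = cnt Z (x + 1, y) := by
  induction Z with
  | nil => rfl
  | cons s Z ih =>
    have ih := ih (fun t ht => h t (by simp [ht]))
    have h1 := h s (by simp)
    simp only [cnt, List.map_cons, List.sum_cons] at ih ⊢
    rw [ih]
    congr 2
    rw [ne_eq, Prod.ext_iff] at h1
    simp only at h1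
    apply propext
    omega

/-- The side of `Z` does not change along a diagonal upward step. -/
theorem cnt_step {Z : List ((ℤ × ℤ) × (ℤ × ℤ))} {w w' : ℤ × ℤ} (hd : ∀ s ∈ Z, IsDiag s)
    (hup : w'.2 = w.2 + 1) (hx : w'.1 = w.1 + 1 ∨ w'.1 = w.1 - 1)
    (hf : ∀ s ∈ Z, face s ≠ face (w, w')) (hw : ∀ s ∈ Z, s.1 ≠ w' ∧ s.2 ≠ w')
    (hb : bdy Z (chi w') = 0) : cnt Z w = cnt Z w' := by
  have h := cnt_add_cnt hd hw
  rw [hb, CharTwo.add_eq_zero] at h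
  rw [h]
  obtain ⟨x, y⟩ := w
  obtain ⟨x', y'⟩ := w'
  simp only at hup hx ⊢
  subst hup
  rcases hx with rfl | rfl
  · have : face ((x, y), (x + 1, y + 1)) = (x, y) := by simp [face]
    rw [this] at hf
    rw [cnt_shift hf]
    simp
  · have : face ((x, y), (x - 1, y + 1)) = (x - 1, y) := by simp [face]
    rw [this] at hf
    have := cnt_shift hf
    rw [sub_add_cancel] at this
    rw [← this]
    simp

theorem cnt_eq_of_step {Z : List ((ℤ × ℤ) × (ℤ × ℤ))} {D : Set (ℤ × ℤ)} {ω : ℤ × ℤ → Bool}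
    {w w' : ℤ × ℤ} (hd : ∀ s ∈ Z, IsDiag s) (h : Step D ω w w')
    (hf : ∀ s ∈ Z, face s ≠ face (w, w')) (hw : ∀ s ∈ Z, s.1 ≠ w ∧ s.2 ≠ w)
    (hw' : ∀ s ∈ Z, s.1 ≠ w' ∧ s.2 ≠ w')
    (hb : ∀ p : ℤ × ℤ, (p.1 = w.1 ∨ p.1 = w'.1) → p.2 = (face (w, w')).2 + 1 →
      bdy Z (chi p) = 0) : cnt Z w = cnt Z w' := by
  have hc := h.coord
  rcases hc.2 with h2 | h2
  · refine cnt_step hd h2 hc.1 hf hw' (hb _ (Or.inr rfl) ?_)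
    simp [face, h2]
  · symm
    refine cnt_step hd (by omega) (by omega) (fun s hs => ?_) hw (hb _ (Or.inl rfl) ?_)
    · have := hf s hs
      simpa only [face, min_comm] using this
    · simp [face, h2]

theorem bdy_row {Z : List ((ℤ × ℤ) × (ℤ × ℤ))} (hd : ∀ s ∈ Z, IsDiag s) (w : ℤ × ℤ)
    (hx : ∀ s ∈ Z, (face s).2 = w.2 → w.1 ≤ (face s).1) :
    cnt Z w = bdy Z (fun p => b2 (p.2 ≤ w.2)) := by
  unfold cnt bdy
  congr 1
  apply List.map_congr_left
  intro s hs
  have h1 := hd s hs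
  have h2 := hx s hs
  obtain ⟨⟨a, b⟩, c, d⟩ := s
  obtain ⟨x, y⟩ := w
  simp only [IsDiag, face] at *
  by_cases h3 : b ≤ y <;> by_cases h4 : d ≤ y <;>
    by_cases h5 : min b d = y ∧ x ≤ min a c <;> simp only [h3, h4, h5, b2, if_true, if_false] <;>
    first | decide | omega

theorem cnt_eq_zero {Z : List ((ℤ × ℤ) × (ℤ × ℤ))} (w : ℤ × ℤ)
    (hx : ∀ s ∈ Z, (face s).2 = w.2 → (face s).1 < w.1) : cnt Z w = 0 := by
  unfold cnt
  apply List.sum_eq_zero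
  intro t ht
  obtain ⟨s, hs, rfl⟩ := List.mem_map.1 ht
  apply b2_neg
  rintro ⟨h1, h2⟩
  exact absurd (hx s hs h1) (not_lt.2 h2)

theorem Step.isDiag {D : Set (ℤ × ℤ)} {ω : ℤ × ℤ → Bool} {u v : ℤ × ℤ} (h : Step D ω u v) :
    IsDiag (u, v) := h.coord

/-- A vertical and a horizontal path of crossing each other have a common site. -/
theorem exists_common {D D' : Set (ℤ × ℤ)} {ω : ℤ × ℤ → Bool} {u v l r : ℤ × ℤ}
    {a b y₀ y₁ : ℤ} (hD : ∀ f ∈ D, a ≤ f.1 ∧ f.1 < b) (hD' : ∀ f ∈ D', y₀ ≤ f.2 ∧ f.2 < y₁)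
    (huv : Conn D ω u v) (hlr : Conn D' ω l r) (hu : u.2 ≤ y₀) (hv : y₁ ≤ v.2)
    (hva : a ≤ v.1) (hvb : v.1 ≤ b) (hl0 : y₀ ≤ l.2) (hl1 : l.2 ≤ y₁) (hl : l.1 ≤ a)
    (hr : b ≤ r.1) : ∃ w, Conn D ω u w ∧ Conn D' ω l w := by
  by_contra hno
  push Not at hno
  obtain ⟨Z, hZ, hφ⟩ := huv.chain
  set e : (ℤ × ℤ) × (ℤ × ℤ) := (v, (v.1 - 1, v.2 + 1)) with he
  have hdiag : ∀ s ∈ e :: Z, IsDiag s := by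
    intro s hs
    rcases List.mem_cons.1 hs with rfl | hs
    · simp [IsDiag, he]
    · exact (hZ s hs).1.isDiag
  have hbdy : ∀ φ, bdy (e :: Z) φ = φ u + φ (v.1 - 1, v.2 + 1) := by
    intro φ
    simp only [bdy, List.map_cons, List.sum_cons, hφ, he]
    linear_combination φ v * (CharTwo.two_eq_zero (R := ZMod 2))
  have hrow : ∀ w, Conn D' ω l w → y₀ ≤ w.2 ∧ w.2 ≤ y₁ := by
    intro w hw
    refine hw.induct (p := fun w => y₀ ≤ w.2 ∧ w.2 ≤ y₁) ⟨hl0, hl1⟩ ?_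
    intro w w' _ hs _
    have := hD' _ hs.face_mem
    have := hs.coord
    simp only [face] at *
    omega
  have hne : ∀ w, Conn D' ω l w → ∀ s ∈ e :: Z, s.1 ≠ w ∧ s.2 ≠ w := by
    intro w hw s hs
    rcases List.mem_cons.1 hs with rfl | hs
    · refine ⟨fun h => hno v huv (by rwa [← h] at hw), fun h => ?_⟩
      have := hrow w hw
      rw [← h] at this
      simp only [he] at this
      omega
    · obtain ⟨h1, h2⟩ := hZ s hs
      exact ⟨fun h => hno w (h ▸ h2) hw, fun h => hno w (h ▸ Conn.tail h2 h1) hw⟩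
  have hconst : cnt (e :: Z) r = cnt (e :: Z) l := by
    refine hlr.induct (p := fun w => cnt (e :: Z) w = cnt (e :: Z) l) rfl ?_
    intro w w' hw hs hp
    rw [← hp]
    symm
    have hrows := hD' _ hs.face_mem
    apply cnt_eq_of_step hdiag hs _ (hne w hw) (hne w' (hw.tail hs))
    · intro p _ hp2
      rw [hbdy]
      simp only [chi]
      rw [b2_neg (by omega), b2_neg (by omega), add_zero]
    · intro s hs' hf
      rcases List.mem_cons.1 hs' with rfl | hs'
      · have : (face e).2 = v.2 := by simp [face, he]
        rw [hf] at this
        omega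
      · obtain ⟨h1, h2⟩ := hZ s hs'
        have hw1 := hne w hw s (by simp [hs'])
        rcases h1.eq_of_face hs hf with ⟨h3, h4⟩ | ⟨h3, h4⟩
        · exact hw1.1 h3.symm
        · exact hw1.2 h3.symm
  have h0 : cnt (e :: Z) r = 0 := by
    apply cnt_eq_zero
    intro s hs _
    rcases List.mem_cons.1 hs with rfl | hs
    · simp [face, he]; omega
    · have : _ ∧ _ := hD (face s) (hZ s hs).1.face_mem
      omega
  have h1 : cnt (e :: Z) l = 1 := by
    rw [bdy_row hdiag, hbdy, b2_pos (by omega), b2_neg (by dsimp only; omega), add_zero]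
    intro s hs h2
    rcases List.mem_cons.1 hs with rfl | hs
    · simp only [face, he] at h2 ⊢
      have := (hne l .refl e (by simp)).1
      rw [ne_eq, Prod.ext_iff] at this
      simp only [he] at this
      omega
    · have : _ ∧ _ := hD (face s) (hZ s hs).1.face_mem
      omega
  rw [h0, h1] at hconst
  exact absurd hconst (by decide)

/-- An arch from `(x - 1, h)` to `(x + 1, h)` encloses the upper cluster of `(x, h)`. -/
theorem arch_encloses {D D' : Set (ℤ × ℤ)} {ω : ℤ × ℤ → Bool} {x h C : ℤ}
    (hD : ∀ f ∈ D, h ≤ f.2 ∧ f.2 < h + C) (hD' : ∀ f ∈ D', h ≤ f.2)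
    (harch : Conn D ω (x - 1, h) (x + 1, h)) {w : ℤ × ℤ} (hw : Conn D' ω (x, h) w) :
    w.2 < h + C ∧ (w.2 = h → w = (x, h)) := by
  obtain ⟨Z, hZ, hφ⟩ := harch.chain
  have hdiag : ∀ s ∈ Z, IsDiag s := fun s hs => (hZ s hs).1.isDiag
  have hbdy : ∀ φ, bdy Z φ = φ (x - 1, h) + φ (x + 1, h) := hφ
  have hne : ∀ w, Conn D' ω (x, h) w → ∀ s ∈ Z, s.1 ≠ w ∧ s.2 ≠ w := by
    intro w hw s hs
    obtain ⟨h1, h2⟩ := hZ s hs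
    have e1 := h2.cls (x + h)
    have e2 := (Conn.tail h2 h1).cls (x + h)
    have e3 := hw.cls (x + h)
    simp only [cls] at e1 e2 e3
    constructor <;> rintro rfl <;> omega
  have hrow : ∀ w, Conn D' ω (x, h) w → h ≤ w.2 := by
    intro w hw
    refine hw.induct (p := fun w => h ≤ w.2) le_rfl ?_
    intro w w' _ hs _
    have := hD' _ hs.face_mem
    have := hs.coord
    simp only [face] at *
    omega
  have hlow : ∀ w, Conn D' ω (x, h) w → w.2 = h → cnt Z w = bdy Z (chi w) := by
    intro w hw h2
    rw [← cnt_add_cnt hdiag (hne w hw), cnt_eq_zero (w.1, w.2 - 1), add_zero]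
    intro s hs h3
    have : _ ∧ _ := hD (face s) (hZ s hs).1.face_mem
    omega
  have hconst : ∀ w, Conn D' ω (x, h) w → cnt Z w = 1 := by
    intro w hw
    refine hw.induct (p := fun w => cnt Z w = 1) ?_ ?_
    · rw [hlow _ .refl rfl, hbdy]
      simp [chi, b2]
    · intro w w' hw hs hp
      rw [← hp]
      symm
      have hrows := hD' _ hs.face_mem
      apply cnt_eq_of_step hdiag hs _ (hne w hw) (hne w' (hw.tail hs))
      · intro p _ hp2
        rw [hbdy]
        simp only [chi]
        rw [b2_neg (by omega), b2_neg (by omega), add_zero]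
      · intro s hs' hf
        obtain ⟨h1, h2⟩ := hZ s hs'
        have hw1 := hne w hw s (by simp [hs'])
        rcases h1.eq_of_face hs hf with ⟨h3, h4⟩ | ⟨h3, h4⟩
        · exact hw1.1 h3.symm
        · exact hw1.2 h3.symm
  refine ⟨?_, fun h2 => ?_⟩
  · by_contra hge
    have h0 : cnt Z w = 0 := by
      apply cnt_eq_zero
      intro s hs h3
      have : _ ∧ _ := hD (face s) (hZ s hs).1.face_mem
      omega
    rw [hconst w hw] at h0
    exact absurd h0 (by decide)
  · have h3 := hlow w hw h2
    rw [hconst w hw, hbdy] at h3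
    have h4 := (hw.cls (x + h)).1 (by simp only [cls]; omega)
    obtain ⟨w1, w2⟩ := w
    simp only [chi, cls] at h2 h3 h4
    subst h2
    simp only [true_and] at h3
    by_cases h5 : w1 < x - 1
    · rw [b2_pos h5, b2_pos (by omega)] at h3
      exact absurd h3 (by decide)
    · by_cases h6 : w1 < x + 1
      · ext <;> simp only
        omega
      · rw [b2_neg h5, b2_neg h6] at h3
        exact absurd h3 (by decide)

/-- The faces of a rectangle. -/
def RF (a b c d : ℤ) : Set (ℤ × ℤ) := {f | a ≤ f.1 ∧ f.1 < b ∧ c ≤ f.2 ∧ f.2 < d}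

/-- The faces having a corner in `K`. -/
def touch (K : Set (ℤ × ℤ)) : Set (ℤ × ℤ) :=
  {f | f ∈ K ∨ (f.1 + 1, f.2) ∈ K ∨ (f.1, f.2 + 1) ∈ K ∨ (f.1 + 1, f.2 + 1) ∈ K}

theorem RF_finite (a b c d : ℤ) : (RF a b c d).Finite := by
  apply Set.Finite.subset (Set.finite_Icc ((a, c) : ℤ × ℤ) (b, d))
  rintro ⟨x, y⟩ ⟨h1, h2, h3, h4⟩
  simp only [mem_Icc, Prod.mk_le_mk] at *
  omega

theorem RF_subset {a b c d a' b' c' d' : ℤ} (h1 : a' ≤ a) (h2 : b ≤ b') (h3 : c' ≤ c)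
    (h4 : d ≤ d') : RF a b c d ⊆ RF a' b' c' d' := by
  rintro ⟨x, y⟩ ⟨h1, h2, h3, h4⟩
  simp only [RF, mem_ofPred_eq] at *
  omega

theorem Conn.mem_rect {a b c d : ℤ} {ω : ℤ × ℤ → Bool} {u v : ℤ × ℤ}
    (h : Conn (RF a b c d) ω u v) (hu : a ≤ u.1 ∧ u.1 ≤ b ∧ c ≤ u.2 ∧ u.2 ≤ d) :
    a ≤ v.1 ∧ v.1 ≤ b ∧ c ≤ v.2 ∧ v.2 ≤ d := by
  refine h.induct (p := fun v => a ≤ v.1 ∧ v.1 ≤ b ∧ c ≤ v.2 ∧ v.2 ≤ d) hu ?_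
  intro w w' _ hs hw
  have h1 := hs.face_mem
  have h2 := hs.coord
  simp only [RF, face, mem_ofPred_eq] at *
  omega

/-- Crossing from bottom to top of a rectangle in class `k`. -/
def VC (k a b c d : ℤ) (ω : ℤ × ℤ → Bool) : Prop :=
  ∃ u v, cls k u ∧ u.2 = c ∧ v.2 = d ∧ a ≤ u.1 ∧ u.1 ≤ b ∧ a ≤ v.1 ∧ v.1 ≤ b ∧
    Conn (RF a b c d) ω u v

/-- Crossing from left to right of a rectangle in class `k`. -/
def HC (k a b c d : ℤ) (ω : ℤ × ℤ → Bool) : Prop :=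
  ∃ u v, cls k u ∧ u.1 = a ∧ v.1 = b ∧ c ≤ u.2 ∧ u.2 ≤ d ∧ c ≤ v.2 ∧ v.2 ≤ d ∧
    Conn (RF a b c d) ω u v

theorem dependsOn_of_imp {S : Set (ℤ × ℤ)} {A : (ℤ × ℤ → Bool) → Prop}
    (h : ∀ ω ω', (∀ f ∈ S, ω f = ω' f) → A ω → A ω') : DependsOn A S :=
  fun ω ω' hh => propext ⟨h ω ω' hh, h ω' ω fun f hf => (hh f hf).symm⟩

theorem dependsOn_VC (k a b c d : ℤ) : DependsOn (VC k a b c d) (RF a b c d) := by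
  apply dependsOn_of_imp
  rintro ω ω' h ⟨u, v, h1, h2, h3, h4, h5, h6, h7, h8⟩
  exact ⟨u, v, h1, h2, h3, h4, h5, h6, h7, h8.congr h⟩

theorem dependsOn_HC (k a b c d : ℤ) : DependsOn (HC k a b c d) (RF a b c d) := by
  apply dependsOn_of_imp
  rintro ω ω' h ⟨u, v, h1, h2, h3, h4, h5, h6, h7, h8⟩
  exact ⟨u, v, h1, h2, h3, h4, h5, h6, h7, h8.congr h⟩

theorem loc_VC (k a b c d : ℤ) : Loc (VC k a b c d) := ⟨_, RF_finite a b c d, dependsOn_VC ..⟩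

theorem loc_HC (k a b c d : ℤ) : Loc (HC k a b c d) := ⟨_, RF_finite a b c d, dependsOn_HC ..⟩

theorem incE_VC (k a b c d : ℤ) : IncE (ori k) (VC k a b c d) := by
  rintro ω ω' h ⟨u, v, h1, h2, h3, h4, h5, h6, h7, h8⟩
  exact ⟨u, v, h1, h2, h3, h4, h5, h6, h7, h8.inc h1 h⟩

theorem incE_HC (k a b c d : ℤ) : IncE (ori k) (HC k a b c d) := by
  rintro ω ω' h ⟨u, v, h1, h2, h3, h4, h5, h6, h7, h8⟩
  exact ⟨u, v, h1, h2, h3, h4, h5, h6, h7, h8.inc h1 h⟩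

/-- Truncation of a path at a level. -/
theorem Conn.first_level {D : Set (ℤ × ℤ)} {ω : ℤ × ℤ → Bool} {u v : ℤ × ℤ} {h : ℤ}
    (hc : Conn D ω u v) (hu : u.2 ≤ h) (hv : h ≤ v.2) :
    ∃ w, w.2 = h ∧ Conn (D ∩ {f | f.2 < h}) ω u w := by
  have key : (v.2 ≤ h ∧ Conn (D ∩ {f | f.2 < h}) ω u v) ∨
      ∃ w, w.2 = h ∧ Conn (D ∩ {f | f.2 < h}) ω u w := by
    refine hc.induct (p := fun v => (v.2 ≤ h ∧ Conn (D ∩ {f | f.2 < h}) ω u v) ∨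
      ∃ w, w.2 = h ∧ Conn (D ∩ {f | f.2 < h}) ω u w) (Or.inl ⟨hu, .refl⟩) ?_
    rintro w w' _ hs (⟨h1, h2⟩ | h1)
    · by_cases hw : w.2 = h
      · exact Or.inr ⟨w, hw, h2⟩
      · have hco := hs.coord
        refine Or.inl ⟨by omega, h2.tail (hs.congr ⟨hs.face_mem, ?_⟩ rfl)⟩
        simp only [face, mem_ofPred_eq]
        omega
    · exact Or.inr h1
  rcases key with ⟨h1, h2⟩ | h1
  · exact ⟨v, le_antisymm h1 hv, h2⟩
  · exact h1

/-- A crossing of a vertical path and a horizontal path, in the same region. -/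
theorem HC_VC_common {k k' a b c d : ℤ} {ω : ℤ × ℤ → Bool} (hV : VC k a b c d ω)
    (hH : HC k' a b c d ω) : cls k = cls k' := by
  obtain ⟨u, v, h1, h2, h3, h4, h5, h6, h7, h8⟩ := hV
  obtain ⟨l, r, g1, g2, g3, g4, g5, g6, g7, g8⟩ := hH
  obtain ⟨w, hw1, hw2⟩ := exists_common (a := a) (b := b) (y₀ := c) (y₁ := d)
    (fun f hf => ⟨hf.1, hf.2.1⟩) (fun f hf => hf.2.2)
    h8 g8 (by omega) (by omega) h6 h7 g4 g5 (by omega) (by omega)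
  have e1 := (hw1.cls k).1 h1
  have e2 := (hw2.cls k').1 g1
  funext z
  simp only [cls] at *
  apply propext
  omega

theorem hex_parity (m n : ℕ) (ψ : ℕ → ℕ → ZMod 2)
    (hface : ∀ i < m, ∀ j < n, (ψ i j + ψ (i + 1) (j + 1)) * (ψ (i + 1) j + ψ i (j + 1)) = 0) :
    ∑ i ∈ Finset.range m, (ψ i 0 * ψ (i + 1) 0 + ψ i n * ψ (i + 1) n) +
      ∑ j ∈ Finset.range n, (ψ 0 j * ψ 0 (j + 1) + ψ m j * ψ m (j + 1)) = 0 := by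
  have tel : ∀ (n : ℕ) (g : ℕ → ZMod 2),
      ∑ j ∈ Finset.range n, (g j + g (j + 1)) = g 0 + g n := by
    intro n g
    induction n with
    | zero => simp [CharTwo.add_self_eq_zero]
    | succ n ih =>
      rw [Finset.sum_range_succ, ih]
      linear_combination g n * (CharTwo.two_eq_zero (R := ZMod 2))
  have h1 : ∀ i, ψ i 0 * ψ (i + 1) 0 + ψ i n * ψ (i + 1) n =
      ∑ j ∈ Finset.range n, (ψ i j * ψ (i + 1) j + ψ i (j + 1) * ψ (i + 1) (j + 1)) :=
    fun i => (tel n fun j => ψ i j * ψ (i + 1) j).symm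
  have h2 : ∀ j, ψ 0 j * ψ 0 (j + 1) + ψ m j * ψ m (j + 1) =
      ∑ i ∈ Finset.range m, (ψ i j * ψ i (j + 1) + ψ (i + 1) j * ψ (i + 1) (j + 1)) :=
    fun j => (tel m fun i => ψ i j * ψ i (j + 1)).symm
  simp only [h1, h2]
  rw [Finset.sum_comm (s := Finset.range n), ← Finset.sum_add_distrib]
  apply Finset.sum_eq_zero
  intro i hi
  rw [← Finset.sum_add_distrib]
  apply Finset.sum_eq_zero
  intro j hj
  have := hface i (by simpa using hi) j (by simpa using hj)
  linear_combination this

/-- Either class `k` crosses from bottom to top, along faces touching the sites joined to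
the left side in the opposite class, or the opposite class crosses from left to right. -/
theorem hex {a b c d : ℤ} (hab : a < b) (hcd : c < d) (k : ℤ) (ω : ℤ × ℤ → Bool)
    (K : Set (ℤ × ℤ)) (hK : K = {v | ∃ u, cls (k + 1) u ∧ u.1 = a ∧ c ≤ u.2 ∧ u.2 ≤ d ∧
      Conn (RF a b c d) ω u v}) :
    (∃ u v, cls k u ∧ u.2 = c ∧ v.2 = d ∧ a ≤ u.1 ∧ u.1 ≤ b ∧
      Conn (RF a b c d ∩ touch K) ω u v) ∨ ∃ v ∈ K, v.1 = b := by
  by_contra hno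
  push Not at hno
  obtain ⟨hno1, hno2⟩ := hno
  obtain ⟨m, hm⟩ := Int.eq_ofNat_of_zero_le (sub_nonneg.2 hab.le)
  obtain ⟨n, hn⟩ := Int.eq_ofNat_of_zero_le (sub_nonneg.2 hcd.le)
  have hKcls : ∀ v ∈ K, cls (k + 1) v := by
    rintro v hv
    rw [hK] at hv
    obtain ⟨u, h1, _, _, _, h2⟩ := hv
    exact (h2.cls _).1 h1
  set M : ℤ × ℤ → Prop := fun v => (∃ u, cls k u ∧ u.2 = c ∧ a ≤ u.1 ∧ u.1 ≤ b ∧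
      Conn (RF a b c d ∩ touch K) ω u v) ∨ v ∈ K with hM
  have hMk : ∀ v, cls k v → (M v ↔ ∃ u, cls k u ∧ u.2 = c ∧ a ≤ u.1 ∧ u.1 ≤ b ∧
      Conn (RF a b c d ∩ touch K) ω u v) := by
    intro v hv
    refine or_iff_left fun h => ?_
    have := hKcls v h
    simp only [cls] at *
    omega
  have hMk1 : ∀ v, cls (k + 1) v → (M v ↔ v ∈ K) := by
    intro v hv
    refine or_iff_right ?_
    rintro ⟨u, h1, _, _, _, h⟩
    have := (h.cls k).1 h1
    simp only [cls] at *
    omega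
  -- a diagonal in class `k` touching `K` joins equally marked sites
  have stepK : ∀ u v, Step (RF a b c d) ω u v → u ∈ K → v ∈ K := by
    intro u v hs hu
    rw [hK] at hu ⊢
    obtain ⟨w, h1, h2, h3, h4, h5⟩ := hu
    exact ⟨w, h1, h2, h3, h4, h5.tail hs⟩
  have stepM : ∀ u v, cls k u → Step (RF a b c d) ω u v → face (u, v) ∈ touch K → M u → M v := by
    intro u v hcu hs ht hu
    rw [hMk u hcu] at hu
    rw [hMk v ((hs.cls k).1 hcu)]
    obtain ⟨w, h1, h2, h3, h4, h5⟩ := hu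
    exact ⟨w, h1, h2, h3, h4, h5.tail (hs.congr ⟨hs.face_mem, ht⟩ rfl)⟩
  have hpar : ∀ v, cls k v ∨ cls (k + 1) v := by
    intro v; simp only [cls]; omega
  have hface : ∀ i j, (i, j) ∈ RF a b c d →
      (b2 (M (i, j)) + b2 (M (i + 1, j + 1))) * (b2 (M (i + 1, j)) + b2 (M (i, j + 1))) = 0 := by
    intro i j hij
    have hsteps : (∃ u v, Step (RF a b c d) ω u v ∧
        ((u = (i, j) ∧ v = (i + 1, j + 1)) ∨ (u = (i + 1, j) ∧ v = (i, j + 1)))) := by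
      cases h : ω (i, j) with
      | true => exact ⟨_, _, .ur i j hij h, Or.inl ⟨rfl, rfl⟩⟩
      | false => exact ⟨_, _, .ul i j hij h, Or.inr ⟨rfl, rfl⟩⟩
    obtain ⟨u, v, hs, huv⟩ := hsteps
    have hfe : face (u, v) = (i, j) := by
      rcases huv with ⟨rfl, rfl⟩ | ⟨rfl, rfl⟩ <;> simp [face]
    have eqs : ∀ P Q : Prop, (P ↔ Q) → b2 P + b2 Q = 0 := by
      intro P Q h
      rw [h]
      exact CharTwo.add_self_eq_zero _
    have goal1 : (M u ↔ M v) → (b2 (M (i, j)) + b2 (M (i + 1, j + 1))) *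
        (b2 (M (i + 1, j)) + b2 (M (i, j + 1))) = 0 := by
      intro h
      rcases huv with ⟨rfl, rfl⟩ | ⟨rfl, rfl⟩
      · rw [eqs _ _ h, zero_mul]
      · rw [eqs _ _ h, mul_zero]
    rcases hpar u with hu | hu
    · by_cases ht : (i, j) ∈ touch K
      · apply goal1
        have hsf := hs.symm
        refine ⟨stepM u v hu hs (by rwa [hfe]), stepM v u ((hs.cls k).1 hu) hs.symm ?_⟩
        have : face (v, u) = face (u, v) := by simp [face, min_comm]
        rwa [this, hfe]
      · -- the opposite corners are unmarked
        have hcl := hu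
        have nn : ∀ z, cls (k + 1) z → (z = (i, j) ∨ z = (i + 1, j) ∨ z = (i, j + 1) ∨
            z = (i + 1, j + 1)) → ¬ M z := by
          intro z hz hzc
          rw [hMk1 z hz]
          intro hzK
          apply ht
          rcases hzc with rfl | rfl | rfl | rfl
          · exact Or.inl hzK
          · exact Or.inr (Or.inl hzK)
          · exact Or.inr (Or.inr (Or.inl hzK))
          · exact Or.inr (Or.inr (Or.inr hzK))
        rcases huv with ⟨rfl, rfl⟩ | ⟨rfl, rfl⟩
        · rw [b2_neg (nn (i + 1, j) (by simp only [cls] at *; omega) (by simp)),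
            b2_neg (nn (i, j + 1) (by simp only [cls] at *; omega) (by simp)), add_zero, mul_zero]
        · rw [b2_neg (nn (i, j) (by simp only [cls] at *; omega) (by simp)),
            b2_neg (nn (i + 1, j + 1) (by simp only [cls] at *; omega) (by simp)), add_zero,
            zero_mul]
    · apply goal1
      rw [hMk1 u hu, hMk1 v ((hs.cls _).1 hu)]
      exact ⟨stepK u v hs, stepK v u hs.symm⟩
  have hpr := hex_parity m n (fun i j => b2 (M (a + i, c + j))) (by
    intro i hi j hj
    have := hface (a + i) (c + j) (by simp only [RF, mem_ofPred_eq]; omega)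
    push_cast
    simpa only [add_assoc] using this)
  -- boundary values
  have hbot : ∀ x, a ≤ x → x ≤ b → cls k (x, c) → M (x, c) := by
    intro x h1 h2 h3
    exact Or.inl ⟨(x, c), h3, rfl, h1, h2, .refl⟩
  have hleft : ∀ y, c ≤ y → y ≤ d → cls (k + 1) (a, y) → M (a, y) := by
    intro y h1 h2 h3
    refine Or.inr ?_
    rw [hK]
    exact ⟨(a, y), h3, rfl, h1, h2, .refl⟩
  have htop : ∀ x, cls k (x, d) → ¬ M (x, d) := by
    intro x h3 h
    obtain ⟨u, g1, g2, g3, g4, g5⟩ := (hMk _ h3).1 h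
    exact hno1 u (x, d) g1 g2 rfl g3 g4 g5
  have hright : ∀ y, cls (k + 1) (b, y) → ¬ M (b, y) := by
    intro y h3 h
    exact hno2 _ ((hMk1 _ h3).1 h) rfl
  have hb : a + (m : ℤ) = b := by omega
  have hd : c + (n : ℤ) = d := by omega
  rw [Finset.sum_add_distrib, Finset.sum_add_distrib] at hpr
  have e1 : ∀ i ∈ Finset.range m, b2 (M (a + (i : ℕ), c + (0 : ℕ))) *
      b2 (M (a + (i + 1 : ℕ), c + (0 : ℕ))) = b2 (M (a + (i : ℕ), c)) +
      b2 (M (a + (i + 1 : ℕ), c)) + 1 := by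
    intro i hi
    have hi : i < m := by simpa using hi
    simp only [Nat.cast_zero, add_zero]
    rcases hpar (a + (i : ℕ), c) with h | h
    · rw [b2_pos (hbot _ (by omega) (by omega) h)]
      linear_combination (-1 : ZMod 2) * (CharTwo.two_eq_zero (R := ZMod 2))
    · rw [b2_pos (hbot (a + (i + 1 : ℕ)) (by omega) (by omega) (by simp only [cls] at *; omega))]
      linear_combination (-1 : ZMod 2) * (CharTwo.two_eq_zero (R := ZMod 2))
  have e2 : ∀ i ∈ Finset.range m, b2 (M (a + (i : ℕ), c + (n : ℕ))) *
      b2 (M (a + (i + 1 : ℕ), c + (n : ℕ))) = 0 := by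
    intro i hi
    rw [hd]
    rcases hpar (a + (i : ℕ), d) with h | h
    · rw [b2_neg (htop _ h), zero_mul]
    · rw [b2_neg (htop (a + (i + 1 : ℕ)) (by simp only [cls] at *; omega)), mul_zero]
  have e3 : ∀ j ∈ Finset.range n, b2 (M (a + (0 : ℕ), c + (j : ℕ))) *
      b2 (M (a + (0 : ℕ), c + (j + 1 : ℕ))) = b2 (M (a, c + (j : ℕ))) +
      b2 (M (a, c + (j + 1 : ℕ))) + 1 := by
    intro j hj
    have hj : j < n := by simpa using hj
    simp only [Nat.cast_zero, add_zero]
    rcases hpar (a, c + (j : ℕ)) with h | h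
    · rw [b2_pos (hleft (c + (j + 1 : ℕ)) (by omega) (by omega) (by simp only [cls] at *; omega))]
      linear_combination (-1 : ZMod 2) * (CharTwo.two_eq_zero (R := ZMod 2))
    · rw [b2_pos (hleft _ (by omega) (by omega) h)]
      linear_combination (-1 : ZMod 2) * (CharTwo.two_eq_zero (R := ZMod 2))
  have e4 : ∀ j ∈ Finset.range n, b2 (M (a + (m : ℕ), c + (j : ℕ))) *
      b2 (M (a + (m : ℕ), c + (j + 1 : ℕ))) = 0 := by
    intro j hj
    rw [hb]
    rcases hpar (b, c + (j : ℕ)) with h | h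
    · rw [b2_neg (hright (c + (j + 1 : ℕ)) (by simp only [cls] at *; omega)), mul_zero]
    · rw [b2_neg (hright _ h), zero_mul]
  rw [Finset.sum_congr rfl e1, Finset.sum_congr rfl e2, Finset.sum_congr rfl e3,
    Finset.sum_congr rfl e4] at hpr
  have tel : ∀ (n : ℕ) (g : ℕ → ZMod 2),
      ∑ j ∈ Finset.range n, (g j + g (j + 1) + 1) = g 0 + g n + n := by
    intro n g
    induction n with
    | zero => simp [CharTwo.add_self_eq_zero]
    | succ n ih =>
      rw [Finset.sum_range_succ, ih]
      push_cast
      linear_combination g n * (CharTwo.two_eq_zero (R := ZMod 2))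
  rw [tel m fun i => b2 (M (a + (i : ℕ), c)), tel n fun j => b2 (M (a, c + (j : ℕ)))] at hpr
  simp only [Finset.sum_const_zero, add_zero, Nat.cast_zero, hb, hd] at hpr
  have h3 : b2 (M (b, c)) + b2 (M (a, d)) + ((m + n : ℕ) : ZMod 2) = 0 := by
    push_cast
    linear_combination hpr - b2 (M (a, c)) * (CharTwo.two_eq_zero (R := ZMod 2))
  have cast2 : ∀ N : ℕ, (N % 2 = 0 → (N : ZMod 2) = 0) ∧ (N % 2 = 1 → (N : ZMod 2) = 1) := by
    intro N
    constructor <;> intro h <;> rw [← ZMod.natCast_mod, h] <;> simp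
  rcases hpar (b, c) with hbc | hbc <;> rcases hpar (a, d) with had | had
  · rw [b2_pos (hbot b hab.le le_rfl hbc), b2_neg (htop a had),
      (cast2 _).1 (by simp only [cls] at *; omega)] at h3
    exact absurd h3 (by decide)
  · rw [b2_pos (hbot b hab.le le_rfl hbc), b2_pos (hleft d hcd.le le_rfl had),
      (cast2 _).2 (by simp only [cls] at *; omega)] at h3
    exact absurd h3 (by decide)
  · rw [b2_neg (hright c hbc), b2_neg (htop a had),
      (cast2 _).2 (by simp only [cls] at *; omega)] at h3
    exact absurd h3 (by decide)
  · rw [b2_neg (hright c hbc), b2_pos (hleft d hcd.le le_rfl had),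
      (cast2 _).1 (by simp only [cls] at *; omega)] at h3
    exact absurd h3 (by decide)

theorem VC_or_HC {a b c d : ℤ} (hab : a < b) (hcd : c < d) (k : ℤ) (ω : ℤ × ℤ → Bool) :
    VC k a b c d ω ∨ HC (k + 1) a b c d ω := by
  rcases hex hab hcd k ω _ rfl with ⟨u, v, h1, h2, h3, h4, h5, h6⟩ | ⟨v, ⟨u, h1, h2, h3, h4, h5⟩, h6⟩
  · have h7 := h6.mono inter_subset_left
    have := h7.mem_rect (by omega)
    exact Or.inl ⟨u, v, h1, h2, h3, h4, h5, this.1, this.2.1, h7⟩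
  · have := h5.mem_rect (by omega)
    exact Or.inr ⟨u, v, h1, h2, h6, h3, h4, this.2.2.1, this.2.2.2, h5⟩

theorem not_VC_HC {k a b c d : ℤ} {ω : ℤ × ℤ → Bool} (hV : VC k a b c d ω) :
    ¬ HC (k + 1) a b c d ω := by
  intro hH
  have := congrFun (HC_VC_common hV hH) (0, -k)
  simp only [cls, eq_iff_iff] at this
  omega

/-- The equivalence relation identifying `u` and `v`. -/
def es (u v : ℤ × ℤ) : Setoid (ℤ × ℤ) where
  r a b := a = b ∨ (a = u ∧ b = v) ∨ (a = v ∧ b = u)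
  iseqv := ⟨fun _ => .inl rfl, by
    rintro a b (h | h | h)
    · exact .inl h.symm
    · exact .inr (.inr h.symm)
    · exact .inr (.inl h.symm), by
    rintro a b c (rfl | ⟨rfl, rfl⟩ | ⟨rfl, rfl⟩) h
    · exact h
    · rcases h with rfl | ⟨rfl, rfl⟩ | ⟨_, rfl⟩ <;> simp
    · rcases h with rfl | ⟨_, rfl⟩ | ⟨rfl, rfl⟩ <;> simp⟩

theorem sup_es (s : Setoid (ℤ × ℤ)) (u v a b : ℤ × ℤ) :
    (s ⊔ es u v) a b ↔ s a b ∨ (s a u ∧ s v b) ∨ (s a v ∧ s u b) := by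
  constructor
  · intro h
    let t : Setoid (ℤ × ℤ) := ⟨fun a b => s a b ∨ (s a u ∧ s v b) ∨ (s a v ∧ s u b),
      ⟨fun x => .inl (s.refl x), by
        rintro x y (h | ⟨h, h'⟩ | ⟨h, h'⟩)
        · exact .inl (s.symm h)
        · exact .inr (.inr ⟨s.symm h', s.symm h⟩)
        · exact .inr (.inl ⟨s.symm h', s.symm h⟩), by
        rintro x y z (h | ⟨h, h'⟩ | ⟨h, h'⟩) (k | ⟨k, k'⟩ | ⟨k, k'⟩)
        · exact .inl (s.trans h k)
        · exact .inr (.inl ⟨s.trans h k, k'⟩)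
        · exact .inr (.inr ⟨s.trans h k, k'⟩)
        · exact .inr (.inl ⟨h, s.trans h' k⟩)
        · exact .inr (.inl ⟨h, k'⟩)
        · exact .inl (s.trans h k')
        · exact .inr (.inr ⟨h, s.trans h' k⟩)
        · exact .inl (s.trans h k')
        · exact .inr (.inr ⟨h, k'⟩)⟩⟩
    have : s ⊔ es u v ≤ t := by
      refine sup_le (fun x y h => Or.inl h) ?_
      rintro x y (rfl | ⟨rfl, rfl⟩ | ⟨rfl, rfl⟩)
      · exact Or.inl (s.refl _)
      · exact Or.inr (.inl ⟨s.refl _, s.refl _⟩)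
      · exact Or.inr (.inr ⟨s.refl _, s.refl _⟩)
    exact this h
  · have h1 : s ≤ s ⊔ es u v := le_sup_left
    have h2 : es u v ≤ s ⊔ es u v := le_sup_right
    have h3 : (s ⊔ es u v) u v := h2 (Or.inr (.inl ⟨rfl, rfl⟩))
    rintro (h | ⟨h, h'⟩ | ⟨h, h'⟩)
    · exact h1 h
    · exact Setoid.trans' _ (h1 h) (Setoid.trans' _ h3 (h1 h'))
    · exact Setoid.trans' _ (h1 h) (Setoid.trans' _ (Setoid.symm' _ h3) (h1 h'))

/-- The average of `F` over the random relation obtained from `s` by opening the weighted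
edges of a list independently. -/
def avg : List ((ℤ × ℤ) × (ℤ × ℤ) × ℝ) → (Setoid (ℤ × ℤ) → ℝ) → Setoid (ℤ × ℤ) → ℝ
  | [], F, s => F s
  | e :: L, F, s => e.2.2 * avg L F (s ⊔ es e.1 e.2.1) + (1 - e.2.2) * avg L F s

theorem avg_append (L M : List ((ℤ × ℤ) × (ℤ × ℤ) × ℝ)) (F : Setoid (ℤ × ℤ) → ℝ)
    (s : Setoid (ℤ × ℤ)) : avg (L ++ M) F s = avg L (avg M F) s := by
  induction L generalizing s with
  | nil => rfl
  | cons e L ih => simp [avg, ih]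

theorem avg_perm {L M : List ((ℤ × ℤ) × (ℤ × ℤ) × ℝ)} (h : L.Perm M) (F : Setoid (ℤ × ℤ) → ℝ)
    (s : Setoid (ℤ × ℤ)) : avg L F s = avg M F s := by
  induction h generalizing s with
  | nil => rfl
  | cons e _ ih => simp [avg, ih]
  | swap e e' L =>
    simp only [avg]
    rw [sup_right_comm]
    ring
  | trans _ _ ih1 ih2 => rw [ih1, ih2]

/-- `F` does not distinguish relations which agree off `M`. -/
def Ign (M : Set (ℤ × ℤ)) (F : Setoid (ℤ × ℤ) → ℝ) : Prop :=
  ∀ s s' : Setoid (ℤ × ℤ), (∀ a b, a ∉ M → b ∉ M → (s a b ↔ s' a b)) → F s = F s'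

theorem Ign.anti {M M' : Set (ℤ × ℤ)} {F : Setoid (ℤ × ℤ) → ℝ} (h : Ign M F) (hM : M' ⊆ M) :
    Ign M' F :=
  fun s s' hs => h s s' fun a b ha hb => hs a b (fun h => ha (hM h)) (fun h => hb (hM h))

theorem Ign.avg {M : Set (ℤ × ℤ)} {F : Setoid (ℤ × ℤ) → ℝ} (h : Ign M F)
    {L : List ((ℤ × ℤ) × (ℤ × ℤ) × ℝ)} (hL : ∀ e ∈ L, e.1 ∉ M ∧ e.2.1 ∉ M) :
    Ign M (Perc.avg L F) := by
  induction L with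
  | nil => exact h
  | cons e L ih =>
    intro s s' hs
    have ih := ih fun e he => hL e (List.mem_cons_of_mem _ he)
    have he := hL e List.mem_cons_self
    simp only [Perc.avg]
    rw [ih s s' hs, ih (s ⊔ es e.1 e.2.1) (s' ⊔ es e.1 e.2.1)]
    intro a b ha hb
    refine (sup_es s _ _ a b).trans ?_
    rw [sup_es, hs _ _ ha hb, hs _ _ ha he.1, hs _ _ ha he.2, hs _ _ he.1 hb, hs _ _ he.2 hb]

theorem avg_congr {I : Setoid (ℤ × ℤ) → Prop} {L : List ((ℤ × ℤ) × (ℤ × ℤ) × ℝ)}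
    (hI : ∀ e ∈ L, ∀ s, I s → I (s ⊔ es e.1 e.2.1)) {F G : Setoid (ℤ × ℤ) → ℝ}
    (hFG : ∀ s, I s → F s = G s) {s : Setoid (ℤ × ℤ)} (hs : I s) : avg L F s = avg L G s := by
  induction L generalizing s with
  | nil => exact hFG s hs
  | cons e L ih =>
    have ih := fun {s} => @ih (fun e he => hI e (List.mem_cons_of_mem _ he)) s
    simp only [avg]
    rw [ih hs, ih (hI e List.mem_cons_self s hs)]

/-- The class of `x` is a singleton. -/
def Iso (s : Setoid (ℤ × ℤ)) (x : ℤ × ℤ) : Prop := ∀ z, s x z → z = x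

theorem Iso.symm {s : Setoid (ℤ × ℤ)} {x z : ℤ × ℤ} (h : Iso s x) (hz : s z x) : z = x :=
  h z (s.symm hz)

theorem Iso.sup {s : Setoid (ℤ × ℤ)} {x u v : ℤ × ℤ} (h : Iso s x) (hu : u ≠ x) (hv : v ≠ x) :
    Iso (s ⊔ es u v) x := by
  intro z hz
  rw [sup_es] at hz
  rcases hz with h1 | ⟨h1, _⟩ | ⟨h1, _⟩
  · exact h z h1
  · exact absurd (h _ h1) hu
  · exact absurd (h _ h1) hv

theorem Iso.bot (x : ℤ × ℤ) : Iso ⊥ x := fun z h => by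
  have : x = z := h
  exact this.symm

theorem es_le {t : Setoid (ℤ × ℤ)} {u v : ℤ × ℤ} (h : t u v) : es u v ≤ t := by
  rintro x y (rfl | ⟨rfl, rfl⟩ | ⟨rfl, rfl⟩)
  · exact t.refl _
  · exact h
  · exact t.symm h

theorem es_comm (u v : ℤ × ℤ) : es u v = es v u :=
  le_antisymm (es_le (.inr (.inr ⟨rfl, rfl⟩))) (es_le (.inr (.inr ⟨rfl, rfl⟩)))

theorem es_self {s t : Setoid (ℤ × ℤ)} {u v : ℤ × ℤ} (h : s ⊔ es u v ≤ t) : t u v :=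
  le_sup_right.trans h (Or.inr (.inl ⟨rfl, rfl⟩))

theorem es_swap (s : Setoid (ℤ × ℤ)) (A B c : ℤ × ℤ) :
    s ⊔ es A c ⊔ es B c = s ⊔ es A B ⊔ es B c := by
  apply le_antisymm
  · have h1 : (s ⊔ es A B ⊔ es B c) A B := es_self le_sup_left
    have h2 : (s ⊔ es A B ⊔ es B c) B c := es_self le_rfl
    exact sup_le (sup_le (le_sup_left.trans le_sup_left) (es_le (Setoid.trans' _ h1 h2)))
      le_sup_right
  · have h1 : (s ⊔ es A c ⊔ es B c) A c := es_self le_sup_left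
    have h2 : (s ⊔ es A c ⊔ es B c) B c := es_self le_rfl
    exact sup_le (sup_le (le_sup_left.trans le_sup_left)
      (es_le (Setoid.trans' _ h1 (Setoid.symm' _ h2)))) le_sup_right

theorem Ign.pendant {s : Setoid (ℤ × ℤ)} {B c : ℤ × ℤ} {F : Setoid (ℤ × ℤ) → ℝ} (hs : Iso s c)
    (hF : Ign {c} F) : F (s ⊔ es B c) = F s := by
  refine hF _ _ fun a b ha hb => ?_
  rw [sup_es]
  constructor
  · rintro (h | ⟨_, h⟩ | ⟨h, _⟩)
    · exact h
    · exact absurd (hs _ h) hb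
    · exact absurd (hs.symm h) ha
  · exact .inl

/-- The star–triangle transformation. -/
theorem star_triangle {s : Setoid (ℤ × ℤ)} {A B C c : ℤ × ℤ} {α β γ : ℝ}
    {F : Setoid (ℤ × ℤ) → ℝ} (hs : Iso s c) (hF : Ign {c} F) (hA : A ≠ c) (hB : B ≠ c) (hC : C ≠ c)
    (h : (1 - α) * (1 - β) * (1 - γ) + α * (1 - β) * (1 - γ) + β * (1 - α) * (1 - γ)
      + γ * (1 - α) * (1 - β) = α * β * γ) :
    avg [(A, c, α), (B, c, β), (C, c, γ)] F s =
      avg [(B, C, 1 - α), (A, C, 1 - β), (A, B, 1 - γ)] F s := by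
  simp only [avg]
  have e1 : s ⊔ es B C ⊔ es A B = s ⊔ es B C ⊔ es A C := by
    rw [sup_right_comm, ← es_swap, sup_right_comm]
  have e2 : s ⊔ es A C ⊔ es A B = s ⊔ es B C ⊔ es A C := by
    rw [es_comm A C, es_comm A B, es_swap, es_comm B A, es_comm C B, e1, es_comm A C]
  have e3 : s ⊔ es B C ⊔ es A C ⊔ es A B = s ⊔ es B C ⊔ es A C := by
    rw [← e1, sup_assoc, sup_idem]
  rw [es_swap s A B c, es_swap s A C c, es_swap s B C c, es_swap (s ⊔ es A B) B C c, e1, e2, e3,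
    sup_right_comm s (es A B), e1, hF.pendant hs, hF.pendant hs, hF.pendant hs,
    hF.pendant (hs.sup hA hB), hF.pendant (hs.sup hA hC), hF.pendant (hs.sup hB hC),
    hF.pendant ((hs.sup hB hC).sup hA hC)]
  linear_combination (F s - F (s ⊔ es B C ⊔ es A C)) * h

/-- The edges of `w` column pairs of a double row whose middle sites are shifted by `z`. -/
def dbl (q q' : ℝ) (y z : ℤ) : ℕ → ℤ → List ((ℤ × ℤ) × (ℤ × ℤ) × ℝ)
  | 0, _ => []
  | w + 1, a =>
    ((a + 1, y), (a + z, y + 1), 1 - q) :: ((a + z, y + 1), (a + 1, y + 1 + 1), q') ::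
    ((a + 1, y), (a + 1 + 1 + z, y + 1), q) :: ((a + 1 + 1 + z, y + 1), (a + 1, y + 1 + 1), 1 - q') ::
    dbl q q' y z w (a + 2)

theorem dbl_ends {q q' : ℝ} {y z a : ℤ} {w : ℕ} {e : (ℤ × ℤ) × (ℤ × ℤ) × ℝ}
    (he : e ∈ dbl q q' y z w a) {x : ℤ} (hx : x < a + z ∨ a + z + 2 * w < x) :
    e.1 ≠ (x, y + 1) ∧ e.2.1 ≠ (x, y + 1) := by
  induction w generalizing a with
  | zero => simp [dbl] at he
  | succ w ih =>
    push_cast at hx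
    simp only [dbl, List.mem_cons] at he
    rcases he with rfl | rfl | rfl | rfl | he
    all_goals first
      | exact ih he (by omega)
      | (simp only [ne_eq, Prod.mk.injEq]; omega)

theorem avg_push {q q' r : ℝ} (hr : (1 - r) * (1 - q * (1 - q')) = q' - q) {y : ℤ}
    {F : Setoid (ℤ × ℤ) → ℝ} (hF : Ign {v | v.2 = y + 1} F) (w : ℕ) (a : ℤ)
    {s : Setoid (ℤ × ℤ)} (hs : ∀ x, a ≤ x → Iso s (x, y + 1)) :
    avg (((a - 2, y + 1), (a, y + 1), r) :: dbl q q' y 0 w a) F s =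
      avg (dbl q' q y (-2) w a ++ [((a + 2 * w - 2, y + 1), (a + 2 * w, y + 1), r)]) F s := by
  induction w generalizing a s with
  | zero => simp [dbl]
  | succ w ih =>
    have key : (1 - r) * (1 - (1 - q)) * (1 - q') + r * (1 - (1 - q)) * (1 - q')
        + (1 - q) * (1 - r) * (1 - q') + q' * (1 - r) * (1 - (1 - q)) = r * (1 - q) * q' := by
      linear_combination hr
    set A : ℤ × ℤ := (a - 2, y + 1) with hA
    set c : ℤ × ℤ := (a, y + 1) with hc
    set m : ℤ × ℤ := (a + 2, y + 1) with hm
    set b : ℤ × ℤ := (a + 1, y) with hb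
    set t : ℤ × ℤ := (a + 1, y + 1 + 1) with ht
    have hAc : A ≠ c := by simp [hA, hc]
    have hbc : b ≠ c := by simp [hb, hc]
    have htc : t ≠ c := by simp [ht, hc]
    have hmc : m ≠ c := by simp [hm, hc]
    have hic : Iso s c := hs a le_rfl
    have hFc : Ign {c} F := hF.anti (by rintro _ rfl; rfl)
    have e1 : dbl q q' y 0 (w + 1) a =
        (b, c, 1 - q) :: (c, t, q') :: (b, m, q) :: (m, t, 1 - q') :: dbl q q' y 0 w (a + 2) := by
      simp only [dbl, add_zero, hb, hc, ht, hm]; norm_num [add_assoc]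
    have e2 : dbl q' q y (-2) (w + 1) a =
        (b, A, 1 - q') :: (A, t, q) :: (b, c, q') :: (c, t, 1 - q) :: dbl q' q y (-2) w (a + 2) := by
      simp only [dbl, hb, hc, ht, hA]
      rw [show a + 1 + 1 + -2 = a by ring, show a + -2 = a - 2 by ring]
    have hd : ∀ e ∈ dbl q q' y 0 w (a + 2), e.1 ≠ c ∧ e.2.1 ≠ c := fun e he =>
      dbl_ends he (.inl (by omega))
    have swap : ∀ (u v : ℤ × ℤ) (p : ℝ) (L : List ((ℤ × ℤ) × (ℤ × ℤ) × ℝ)) (s : Setoid (ℤ × ℤ)),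
        avg ((u, v, p) :: L) F s = avg ((v, u, p) :: L) F s := fun u v p L s => by
      simp only [avg, es_comm u v]
    have f1 : avg ((A, c, r) :: dbl q q' y 0 (w + 1) a) F s =
        avg [(A, c, r), (b, c, 1 - q), (t, c, q')]
          (avg ((b, m, q) :: (m, t, 1 - q') :: dbl q q' y 0 w (a + 2)) F) s := by
      rw [e1]
      simp only [avg, es_comm c t]
    have f2 : avg [(A, c, r), (b, c, 1 - q), (t, c, q')]
          (avg ((b, m, q) :: (m, t, 1 - q') :: dbl q q' y 0 w (a + 2)) F) s =
        avg [(b, t, 1 - r), (A, t, q), (A, b, 1 - q')]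
          (avg ((b, m, q) :: (m, t, 1 - q') :: dbl q q' y 0 w (a + 2)) F) s := by
      rw [star_triangle hic (hFc.avg _) hAc hbc htc key]
      · norm_num
      · intro e he
        simp only [List.mem_cons, mem_singleton_iff] at he ⊢
        rcases he with rfl | rfl | he
        · exact ⟨hbc, hmc⟩
        · exact ⟨hmc, htc⟩
        · exact hd e he
    have f3 : avg [(b, t, 1 - r), (A, t, q), (A, b, 1 - q')]
          (avg ((b, m, q) :: (m, t, 1 - q') :: dbl q q' y 0 w (a + 2)) F) s =
        avg ([(A, t, q), (b, A, 1 - q')] ++ dbl q q' y 0 w (a + 2))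
          (avg [(b, t, 1 - r), (m, t, 1 - q'), (m, b, q)] F) s := by
      rw [← avg_append, ← avg_append]
      refine Eq.trans (b := avg ((b, t, 1 - r) :: (A, t, q) :: (b, A, 1 - q') :: (m, b, q) ::
        (m, t, 1 - q') :: dbl q q' y 0 w (a + 2)) F s) ?_ (avg_perm ?_ F s)
      · simp only [List.cons_append, List.nil_append, avg, es_comm A b, es_comm b m]
      · classical
        rw [List.perm_iff_count]
        intro e
        simp only [List.cons_append, List.nil_append, List.count_cons, List.count_append,
          List.count_nil]
        omega
    have f4 : avg ([(A, t, q), (b, A, 1 - q')] ++ dbl q q' y 0 w (a + 2))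
          (avg [(b, t, 1 - r), (m, t, 1 - q'), (m, b, q)] F) s =
        avg ([(A, t, q), (b, A, 1 - q')] ++ dbl q q' y 0 w (a + 2))
          (avg [(m, c, r), (b, c, q'), (t, c, 1 - q)] F) s := by
      refine avg_congr (I := fun s => Iso s c) ?_ ?_ hic
      · intro e he s hs
        simp only [List.mem_append, List.mem_cons, List.not_mem_nil, or_false] at he
        rcases he with (rfl | rfl) | he
        · exact hs.sup hAc htc
        · exact hs.sup hbc hAc
        · exact hs.sup (hd e he).1 (hd e he).2
      · intro s hs
        rw [star_triangle hs hFc hmc hbc htc (by linear_combination hr)]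
        norm_num
    have f5 : avg ([(A, t, q), (b, A, 1 - q')] ++ dbl q q' y 0 w (a + 2))
          (avg [(m, c, r), (b, c, q'), (t, c, 1 - q)] F) s =
        avg [(b, A, 1 - q'), (A, t, q), (b, c, q'), (c, t, 1 - q)]
          (avg ((c, m, r) :: dbl q q' y 0 w (a + 2)) F) s := by
      rw [← avg_append, ← avg_append]
      refine Eq.trans (b := avg ((b, A, 1 - q') :: (A, t, q) :: (b, c, q') :: (t, c, 1 - q) ::
        (m, c, r) :: dbl q q' y 0 w (a + 2)) F s) (avg_perm ?_ F s) ?_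
      · classical
        rw [List.perm_iff_count]
        intro e
        simp only [List.cons_append, List.nil_append, List.count_cons, List.count_append,
          List.count_nil]
        omega
      · simp only [List.cons_append, List.nil_append, avg, es_comm t c, es_comm m c]
    rw [f1, f2, f3, f4, f5, e2]
    have f6 : avg [(b, A, 1 - q'), (A, t, q), (b, c, q'), (c, t, 1 - q)]
          (avg ((c, m, r) :: dbl q q' y 0 w (a + 2)) F) s =
        avg [(b, A, 1 - q'), (A, t, q), (b, c, q'), (c, t, 1 - q)]
          (avg (dbl q' q y (-2) w (a + 2) ++
            [((a + 2 + 2 * w - 2, y + 1), (a + 2 + 2 * w, y + 1), r)]) F) s := by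
      refine avg_congr (I := fun s => ∀ x, a + 2 ≤ x → Iso s (x, y + 1)) ?_ ?_
        fun x hx => hs x (by omega)
      · intro e he s hs x hx
        simp only [List.mem_cons, List.not_mem_nil, or_false] at he
        rcases he with rfl | rfl | rfl | rfl <;> refine (hs x hx).sup ?_ ?_ <;>
          simp only [hA, hb, hc, ht, ne_eq, Prod.mk.injEq] <;> omega
      · intro s hs
        rw [← ih (a + 2) hs]
        simp [hc, hm]
    rw [f6, ← avg_append]
    congr 1
    push_cast
    simp only [List.cons_append, List.nil_append]
    ring_nf

theorem avg_dbl_shift {q q' : ℝ} (hne : 1 - q * (1 - q') ≠ 0) {y : ℤ}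
    {F : Setoid (ℤ × ℤ) → ℝ} (hF : Ign {v | v.2 = y + 1} F) (w : ℕ) (a : ℤ) :
    avg (dbl q q' y 0 w a) F ⊥ = avg (dbl q' q y (-2) w a) F ⊥ := by
  obtain ⟨r, hr⟩ : ∃ r : ℝ, (1 - r) * (1 - q * (1 - q')) = q' - q :=
    ⟨1 - (q' - q) / (1 - q * (1 - q')), by field_simp; ring⟩
  have key := avg_push hr hF w a (s := ⊥) fun x _ => Iso.bot _
  have pend : ∀ {L : List ((ℤ × ℤ) × (ℤ × ℤ) × ℝ)} {B : ℤ × ℤ} {x : ℤ},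
      (∀ e ∈ L, e.1 ≠ (x, y + 1) ∧ e.2.1 ≠ (x, y + 1)) →
      avg (L ++ [(B, (x, y + 1), r)]) F ⊥ = avg L F ⊥ := by
    intro L B x hL
    rw [avg_append]
    refine avg_congr (I := fun s => Iso s (x, y + 1)) (fun e he s hs =>
      hs.sup (hL e he).1 (hL e he).2) (fun s hs => ?_) (Iso.bot _)
    simp only [avg]
    rw [(hF.anti (by rintro _ rfl; rfl)).pendant hs]
    ring
  rw [pend] at key
  · rw [← key]
    refine (Eq.trans ?_ (pend (L := dbl q q' y 0 w a) (B := (a, y + 1)) (x := a - 2) ?_)).symm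
    · rw [avg_perm (List.perm_append_singleton _ _)]
      simp only [avg, es_comm (a, y + 1)]
    · exact fun e he => dbl_ends he (.inl (by omega))
  · exact fun e he => dbl_ends he (.inr (by omega))

/-- Transport of weighted edges along a bijection of the sites. -/
def mapE (σ : ℤ × ℤ ≃ ℤ × ℤ) (e : (ℤ × ℤ) × (ℤ × ℤ) × ℝ) : (ℤ × ℤ) × (ℤ × ℤ) × ℝ :=
  (σ e.1, σ e.2.1, e.2.2)

theorem avg_map (σ : ℤ × ℤ ≃ ℤ × ℤ) {F : Setoid (ℤ × ℤ) → ℝ}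
    (hF : ∀ s, F s = F (s.comap σ)) (L : List ((ℤ × ℤ) × (ℤ × ℤ) × ℝ)) (s : Setoid (ℤ × ℤ)) :
    avg (L.map (mapE σ)) F s = avg L F (s.comap σ) := by
  induction L generalizing s with
  | nil => exact hF s
  | cons e L ih =>
    have h : (s ⊔ es (σ e.1) (σ e.2.1)).comap σ = s.comap σ ⊔ es e.1 e.2.1 :=
      Setoid.ext fun a b => (sup_es s _ _ _ _).trans (sup_es (s.comap σ) _ _ _ _).symm
    simp only [List.map_cons, avg, ih, mapE, h]

/-- The shift of level `m` by two. -/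
def shiftLevel (m : ℤ) : ℤ × ℤ ≃ ℤ × ℤ where
  toFun v := if v.2 = m then (v.1 + 2, v.2) else v
  invFun v := if v.2 = m then (v.1 - 2, v.2) else v
  left_inv v := by by_cases h : v.2 = m <;> simp [h, Prod.ext_iff]
  right_inv v := by by_cases h : v.2 = m <;> simp [h, Prod.ext_iff]

theorem dbl_map (q q' : ℝ) (y : ℤ) (w : ℕ) (a : ℤ) :
    (dbl q q' y (-2) w a).map (mapE (shiftLevel (y + 1))) = dbl q q' y 0 w a := by
  induction w generalizing a with
  | zero => rfl
  | succ w ih =>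
    simp only [dbl, List.map_cons, ih]
    simp [mapE, shiftLevel]

theorem avg_dbl {q q' : ℝ} (hne : 1 - q * (1 - q') ≠ 0) {y : ℤ}
    {F : Setoid (ℤ × ℤ) → ℝ} (hF : Ign {v | v.2 = y + 1} F) (w : ℕ) (a : ℤ) :
    avg (dbl q q' y 0 w a) F ⊥ = avg (dbl q' q y 0 w a) F ⊥ := by
  rw [avg_dbl_shift hne hF, ← dbl_map q' q, avg_map]
  · congr 1
    ext u v
    exact (shiftLevel (y + 1)).injective.eq_iff.symm
  · intro s
    refine hF _ _ fun a b ha hb => ?_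
    have ha : a.2 ≠ y + 1 := ha
    have hb : b.2 ≠ y + 1 := hb
    have ha' : shiftLevel (y + 1) a = a := if_neg ha
    have hb' : shiftLevel (y + 1) b = b := if_neg hb
    have h : (s.comap (shiftLevel (y + 1))) a b ↔
        s (shiftLevel (y + 1) a) (shiftLevel (y + 1) b) := Iff.rfl
    rw [ha', hb'] at h
    exact h.symm

/-- The diagonal of class `c` of a face. -/
def diag (c : ℤ) (f : ℤ × ℤ) : (ℤ × ℤ) × (ℤ × ℤ) :=
  if ori c f then (f, (f.1 + 1, f.2 + 1)) else ((f.1 + 1, f.2), (f.1, f.2 + 1))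

/-- The diagonal of class `c` of a face with its probability. -/
def wdiag (c : ℤ) (p : ℤ × ℤ → ℝ) (f : ℤ × ℤ) : (ℤ × ℤ) × (ℤ × ℤ) × ℝ :=
  ((diag c f).1, (diag c f).2, if ori c f then p f else 1 - p f)

/-- The relation generated by the open diagonals of class `c` of a list of faces. -/
def gen (c : ℤ) : List (ℤ × ℤ) → (ℤ × ℤ → Bool) → Setoid (ℤ × ℤ)
  | [], _ => ⊥
  | f :: l, ω => (if ω f = ori c f then es (diag c f).1 (diag c f).2 else ⊥) ⊔ gen c l ω

theorem gen_update (c : ℤ) {l : List (ℤ × ℤ)} {f : ℤ × ℤ} (hf : f ∉ l) (ω : ℤ × ℤ → Bool)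
    (v : Bool) : gen c l (Function.update ω f v) = gen c l ω := by
  induction l with
  | nil => rfl
  | cons g l ih =>
    simp only [List.mem_cons, not_or] at hf
    rw [gen, gen, ih hf.2, Function.update_of_ne (Ne.symm hf.1)]

theorem ex_gen (c : ℤ) (p : ℤ × ℤ → ℝ) {l : List (ℤ × ℤ)} (hl : l.Nodup)
    (F : Setoid (ℤ × ℤ) → ℝ) (s : Setoid (ℤ × ℤ)) (ω : ℤ × ℤ → Bool) :
    ex p l (fun ω => F (s ⊔ gen c l ω)) ω = avg (l.map (wdiag c p)) F s := by
  induction l generalizing s with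
  | nil => simp [ex, avg, gen]
  | cons f l ih =>
    have hf := (List.nodup_cons.1 hl).1
    have ih := fun s => ih (List.nodup_cons.1 hl).2 s
    have hex : ex p (f :: l) (fun ω => F (s ⊔ gen c (f :: l) ω)) ω =
        ex p l (st p f (fun ω => F (s ⊔ gen c (f :: l) ω))) ω := by
      rw [ex, ex_st_comm]
    have hst : st p f (fun ω => F (s ⊔ gen c (f :: l) ω)) = fun ω =>
        (if ori c f then p f else 1 - p f) *
          F ((s ⊔ es (diag c f).1 (diag c f).2) ⊔ gen c l ω) +
        (1 - if ori c f then p f else 1 - p f) * F (s ⊔ gen c l ω) := by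
      funext ω
      simp only [st, gen, gen_update c hf, Function.update_self, sup_assoc]
      cases ori c f <;> simp
      ring
    rw [hex, hst, ex_add, ex_const_mul, ex_const_mul]
    simp only [ih]
    rfl

theorem Conn.of_gen {c : ℤ} {D : Set (ℤ × ℤ)} {l : List (ℤ × ℤ)} (hl : ∀ f ∈ l, f ∈ D)
    {ω : ℤ × ℤ → Bool} {u v : ℤ × ℤ} (h : gen c l ω u v) : Conn D ω u v := by
  let t : Setoid (ℤ × ℤ) := ⟨Conn D ω, fun _ => .refl, fun h => h.symm, fun h h' => h.trans h'⟩
  suffices gen c l ω ≤ t from this h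
  clear h
  induction l with
  | nil => exact bot_le
  | cons f l ih =>
    refine sup_le ?_ (ih fun f hf => hl f (List.mem_cons_of_mem _ hf))
    have hf := hl f List.mem_cons_self
    split_ifs with h
    · apply es_le
      change Conn D ω _ _
      unfold diag
      split_ifs with h'
      · exact (Step.ur f.1 f.2 hf (h.trans h')).conn
      · exact (Step.ul f.1 f.2 hf (h.trans (by simpa using h'))).conn
    · exact bot_le

theorem gen_of_conn {c : ℤ} {D : Set (ℤ × ℤ)} {l : List (ℤ × ℤ)} (hl : ∀ f ∈ D, f ∈ l)
    {ω : ℤ × ℤ → Bool} {u v : ℤ × ℤ} (h : Conn D ω u v) (hu : cls c u) : gen c l ω u v := by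
  have key : ∀ l : List (ℤ × ℤ), ∀ f ∈ l, ω f = ori c f →
      es (diag c f).1 (diag c f).2 ≤ gen c l ω := by
    intro l f hf h
    induction l with
    | nil => simp at hf
    | cons g l ih =>
      rcases List.mem_cons.1 hf with rfl | hf
      · simp only [gen, if_pos h]; exact le_sup_left
      · exact (ih hf).trans le_sup_right
  induction h with
  | refl => exact Setoid.refl' _ _
  | @tail x y h1 h2 ih =>
    refine Setoid.trans' _ ih ?_
    have hx : cls c x := (Conn.cls h1 c).1 hu
    have hy := (h2.cls c).1 hx
    have ho : ω (face (x, y)) = ori c (face (x, y)) := h2.ori hx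
    have hk := key l _ (hl _ h2.face_mem) ho
    have hd : diag c (face (x, y)) = (x, y) ∨ diag c (face (x, y)) = (y, x) := by
      unfold diag
      cases h2 <;> simp_all [face]
    rcases hd with hd | hd <;> rw [hd] at hk
    · exact hk (Or.inr (.inl ⟨rfl, rfl⟩))
    · exact hk (Or.inr (.inr ⟨rfl, rfl⟩))

/-- A vertical connection of class `c` between the levels `y₀` and `y₁`. -/
def SV (c y₀ y₁ : ℤ) (D : Set (ℤ × ℤ)) (ω : ℤ × ℤ → Bool) : Prop :=
  ∃ u v, cls c u ∧ u.2 = y₀ ∧ v.2 = y₁ ∧ Conn D ω u v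

theorem dependsOn_SV (c y₀ y₁ : ℤ) (D : Set (ℤ × ℤ)) : DependsOn (SV c y₀ y₁ D) D := by
  apply dependsOn_of_imp
  rintro ω ω' h ⟨u, v, h1, h2, h3, h4⟩
  exact ⟨u, v, h1, h2, h3, (dependsOn_conn D u v h).mp h4⟩

/-- The faces of `w` column pairs of a double row. -/
def dfaces (y : ℤ) : ℕ → ℤ → List (ℤ × ℤ)
  | 0, _ => []
  | w + 1, a => (a, y) :: (a, y + 1) :: (a + 1, y) :: (a + 1, y + 1) :: dfaces y w (a + 2)

theorem mem_dfaces {y a : ℤ} {w : ℕ} {f : ℤ × ℤ} :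
    f ∈ dfaces y w a ↔ (a ≤ f.1 ∧ f.1 < a + 2 * w) ∧ (f.2 = y ∨ f.2 = y + 1) := by
  induction w generalizing a with
  | zero => simp [dfaces]
  | succ w ih =>
    simp only [dfaces, List.mem_cons, ih, Prod.ext_iff]
    push_cast
    omega

theorem nodup_dfaces (y a : ℤ) (w : ℕ) : (dfaces y w a).Nodup := by
  induction w generalizing a with
  | zero => simp [dfaces]
  | succ w ih =>
    simp only [dfaces, List.nodup_cons, List.mem_cons, mem_dfaces, Prod.ext_iff, ih]
    simp

theorem map_dfaces {c y a : ℤ} (hc : (a + y + 1 + c) % 2 = 0) {p : ℤ × ℤ → ℝ} {q q' : ℝ} (w : ℕ)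
    (h1 : ∀ i, p (i, y) = q) (h2 : ∀ i, p (i, y + 1) = q') :
    (dfaces y w a).map (wdiag c p) = dbl q q' y 0 w a := by
  induction w generalizing a with
  | zero => rfl
  | succ w ih =>
    have o1 : ori c (a, y) = false := by simp only [ori, decide_eq_false_iff_not]; omega
    have o2 : ori c (a, y + 1) = true := by simp only [ori, decide_eq_true_eq]; omega
    have o3 : ori c (a + 1, y) = true := by simp only [ori, decide_eq_true_eq]; omega
    have o4 : ori c (a + 1, y + 1) = false := by simp only [ori, decide_eq_false_iff_not]; omega
    simp only [dfaces, List.map_cons, ih (a := a + 2) (by omega), dbl]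
    simp [wdiag, diag, o1, o2, o3, o4, h1, h2]

/-- Exchanging the parameters of two rows of equal extent does not change the probability of a
vertical connection. -/
theorem Pr_exchange {c y a y₀ y₁ : ℤ} (hc : (a + y + 1 + c) % 2 = 0) {w : ℕ} {D : Set (ℤ × ℤ)}
    (hD : D.Finite) (hrow : ∀ i j, (j = y ∨ j = y + 1) → ((i, j) ∈ D ↔ a ≤ i ∧ i < a + 2 * w))
    (h0 : y + 1 ≠ y₀) (h1 : y + 1 ≠ y₁) {p p' : ℤ × ℤ → ℝ} {q q' : ℝ}
    (hne : 1 - q * (1 - q') ≠ 0)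
    (hp : ∀ i, p (i, y) = q) (hp1 : ∀ i, p (i, y + 1) = q')
    (hp' : ∀ i, p' (i, y) = q') (hp'1 : ∀ i, p' (i, y + 1) = q)
    (hpp : ∀ f : ℤ × ℤ, f.2 ≠ y → f.2 ≠ y + 1 → p f = p' f) :
    Pr p (SV c y₀ y₁ D) = Pr p' (SV c y₀ y₁ D) := by
  classical
  obtain ⟨m, hm⟩ : ∃ m : List (ℤ × ℤ), m.Nodup ∧ ∀ f, f ∈ m ↔ f ∈ D ∧ f.2 ≠ y ∧ f.2 ≠ y + 1 :=
    ⟨(hD.toFinset.filter fun f => f.2 ≠ y ∧ f.2 ≠ y + 1).toList, Finset.nodup_toList _, by simp⟩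
  set l := m ++ dfaces y w a with hl
  have hmem : ∀ f, f ∈ l ↔ f ∈ D := by
    intro f
    rw [hl, List.mem_append, hm.2, mem_dfaces]
    have := hrow f.1 f.2
    by_cases hf : f.2 = y ∨ f.2 = y + 1
    · have := this hf
      tauto
    · tauto
  have hnd : l.Nodup := by
    refine List.Nodup.append hm.1 (nodup_dfaces ..) fun f hf hf' => ?_
    have := ((hm.2 f).1 hf).2
    have := (mem_dfaces.1 hf').2
    tauto
  let F : Setoid (ℤ × ℤ) → ℝ := fun s =>
    open Classical in if ∃ u v, cls c u ∧ u.2 = y₀ ∧ v.2 = y₁ ∧ s u v then 1 else 0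
  have hF : Ign {v | v.2 = y + 1} F := by
    intro s s' hs
    have : (∃ u v, cls c u ∧ u.2 = y₀ ∧ v.2 = y₁ ∧ s u v) ↔
        ∃ u v, cls c u ∧ u.2 = y₀ ∧ v.2 = y₁ ∧ s' u v := by
      constructor <;> rintro ⟨u, v, k1, k2, k3, k4⟩ <;> refine ⟨u, v, k1, k2, k3, ?_⟩ <;>
        have := hs u v (by simp only [mem_ofPred_eq]; omega) (by simp only [mem_ofPred_eq]; omega)
      · exact this.1 k4
      · exact this.2 k4
    simp only [F, this]
  have key : ∀ p : ℤ × ℤ → ℝ, Pr p (SV c y₀ y₁ D) =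
      avg (dfaces y w a |>.map (wdiag c p)) (avg (m.map (wdiag c p)) F) ⊥ := by
    intro p
    have e : ind (SV c y₀ y₁ D) = fun ω => F (⊥ ⊔ gen c l ω) := by
      funext ω
      have : SV c y₀ y₁ D ω ↔ ∃ u v, cls c u ∧ u.2 = y₀ ∧ v.2 = y₁ ∧ (⊥ ⊔ gen c l ω) u v := by
        rw [bot_sup_eq]
        constructor <;> rintro ⟨u, v, k1, k2, k3, k4⟩ <;> refine ⟨u, v, k1, k2, k3, ?_⟩
        · exact gen_of_conn (fun f hf => (hmem f).2 hf) k4 k1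
        · exact Conn.of_gen (fun f hf => (hmem f).1 hf) k4
      simp only [ind, F, this]
    rw [Pr, E_eq p (DependsOn.ind (dependsOn_SV c y₀ y₁ D)) (fun f hf => (hmem f).2 hf) fun _ => true, e,
      ex_gen c p hnd, hl, List.map_append, ← avg_append]
    exact avg_perm List.perm_append_comm _ _
  have hm' : m.map (wdiag c p) = m.map (wdiag c p') := by
    apply List.map_congr_left
    intro f hf
    have := ((hm.2 f).1 hf).2
    simp only [wdiag, hpp f this.1 this.2]
  rw [key, key, map_dfaces hc w hp hp1, map_dfaces hc w hp' hp'1, hm', avg_dbl hne]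
  apply hF.avg
  intro e he
  obtain ⟨f, hf, rfl⟩ := List.mem_map.1 he
  have := ((hm.2 f).1 hf).2
  simp only [wdiag, diag, mem_ofPred_eq]
  split_ifs <;> simp <;> omega

theorem dependsOn_coord {ι : Type*} (x : ι) (b : Bool) :
    DependsOn (fun ω : ι → Bool => ω x = b) {x} := by
  intro ω ω' h
  simp only [h x rfl]

theorem Pr_eq {ι : Type} [DecidableEq ι] (p : ι → ℝ) (x : ι) (b : Bool) :
    Pr p (fun ω => ω x = b) = if b then p x else 1 - p x := by
  cases b with
  | true => simpa using Pr_coord p x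
  | false =>
    have h := Pr_not p (A := fun ω : ι → Bool => ω x = true)
      ⟨{x}, finite_singleton x, dependsOn_coord x true⟩
    simp only [Bool.not_eq_true] at h
    simp [h, Pr_coord]

theorem Pr_eq_and {ι : Type} [DecidableEq ι] (p : ι → ℝ) (x : ι) (b : Bool)
    {A : (ι → Bool) → Prop} {S : Set ι} (hS : S.Finite) (hA : DependsOn A S) (hx : x ∉ S) :
    Pr p (fun ω => ω x = b ∧ A ω) = (if b then p x else 1 - p x) * Pr p A := by
  rw [← Pr_eq p x b]
  exact Pr_indep p (finite_singleton x) hS (dependsOn_coord x b) hA (by simpa using hx)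

theorem DependsOn.eq_and {ι : Type*} (x : ι) (b : Bool) {A : (ι → Bool) → Prop} {S : Set ι}
    (hA : DependsOn A S) : DependsOn (fun ω => ω x = b ∧ A ω) (insert x S) := by
  intro ω ω' h
  simp only [h x (mem_insert _ _), hA fun y hy => h y (mem_insert_of_mem _ hy)]

/-- The parameters constant along rows. -/
def rows (q : ℤ → ℝ) (f : ℤ × ℤ) : ℝ := q f.2

/-- The neighbours of `(x, h)` in its row are connected within `k` rows above. -/
def Arch (k : ℕ) (x h : ℤ) (ω : ℤ × ℤ → Bool) : Prop :=
  Conn (RF (x - k - 1) (x + k + 1) h (h + k)) ω (x - 1, h) (x + 1, h)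

theorem loc_arch (k : ℕ) (x h : ℤ) : Loc (Arch k x h) := ⟨_, RF_finite .., dependsOn_conn ..⟩

theorem Pr_arch {q : ℤ → ℝ} {z : ℝ} (hq : ∀ j, 0 ≤ q j ∧ q j ≤ 1)
    (hz : ∀ j, z ≤ q j * (1 - q j)) (k : ℕ) (x h : ℤ) :
    1 / 3 * (1 - (1 - 3 * z) ^ k) ≤ Pr (rows q) (Arch k x h) := by
  have hp : IsProb (rows q) := fun f => hq f.2
  induction k generalizing x h with
  | zero => simpa using Pr_nonneg hp (loc_arch 0 x h)
  | succ k ih =>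
    set A₁ : (ℤ × ℤ → Bool) → Prop := Arch k (x + 1) (h + 1)
    set A₂ : (ℤ × ℤ → Bool) → Prop := Arch k (x - 1) (h + 1)
    have d₁ : DependsOn A₁ (RF (x + 1 - k - 1) (x + 1 + k + 1) (h + 1) (h + 1 + k)) :=
      dependsOn_conn ..
    have d₂ : DependsOn A₂ (RF (x - 1 - k - 1) (x - 1 + k + 1) (h + 1) (h + 1 + k)) :=
      dependsOn_conn ..
    have t : DependsOn (fun _ : ℤ × ℤ → Bool => True) ∅ := fun _ _ _ => rfl
    set E₀ : (ℤ × ℤ → Bool) → Prop := fun ω => ω (x - 1, h) = true ∧ ω (x, h) = false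
    set E₁ : (ℤ × ℤ → Bool) → Prop := fun ω =>
      ω (x - 1, h) = true ∧ ω (x, h) = true ∧ ω (x + 1, h) = true ∧ A₁ ω
    set E₂ : (ℤ × ℤ → Bool) → Prop := fun ω =>
      ω (x - 2, h) = false ∧ ω (x - 1, h) = false ∧ ω (x, h) = false ∧ A₂ ω
    have n1 : ∀ (i a b c : ℤ), (i, h) ∉ RF a b (h + 1) c := fun i a b c => by
      simp only [RF, mem_ofPred_eq]; omega
    have D₀ := DependsOn.eq_and (x - 1, h) true (dependsOn_coord (x, h) false)
    have D₁ := DependsOn.eq_and (x, h) true (DependsOn.eq_and (x + 1, h) true d₁)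
    have D₂ := DependsOn.eq_and (x - 1, h) false (DependsOn.eq_and (x, h) false d₂)
    have D₁' := DependsOn.eq_and (x - 1, h) true D₁
    have D₂' := DependsOn.eq_and (x - 2, h) false D₂
    have F₁ := RF_finite (x + 1 - k - 1) (x + 1 + k + 1) (h + 1) (h + 1 + k)
    have F₂ := RF_finite (x - 1 - k - 1) (x - 1 + k + 1) (h + 1) (h + 1 + k)
    have L₀ : Loc E₀ := ⟨_, (finite_singleton _).insert _, D₀⟩
    have L₁ : Loc E₁ := ⟨_, ((F₁.insert _).insert _).insert _, D₁'⟩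
    have L₂ : Loc E₂ := ⟨_, ((F₂.insert _).insert _).insert _, D₂'⟩
    have P₀ : Pr (rows q) E₀ = q h * (1 - q h) := by
      rw [Pr_eq_and _ _ _ (finite_singleton _) (dependsOn_coord (x, h) false) (by simp), Pr_eq]
      simp [rows]
    have P₁ : Pr (rows q) E₁ = q h * (q h * (q h * Pr (rows q) A₁)) := by
      rw [Pr_eq_and _ _ _ ((F₁.insert _).insert _) D₁ (by
          simp only [mem_insert_iff, Prod.mk.injEq, not_or]
          exact ⟨by omega, by omega, n1 _ _ _ _⟩),
        Pr_eq_and _ _ _ (F₁.insert _) (DependsOn.eq_and (x + 1, h) true d₁) (by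
          simp only [mem_insert_iff, Prod.mk.injEq, not_or]
          exact ⟨by omega, n1 _ _ _ _⟩),
        Pr_eq_and _ _ _ F₁ d₁ (n1 _ _ _ _)]
      simp [rows]
    have P₂ : Pr (rows q) E₂ = (1 - q h) * ((1 - q h) * ((1 - q h) * Pr (rows q) A₂)) := by
      rw [Pr_eq_and _ _ _ ((F₂.insert _).insert _) D₂ (by
          simp only [mem_insert_iff, Prod.mk.injEq, not_or]
          exact ⟨by omega, by omega, n1 _ _ _ _⟩),
        Pr_eq_and _ _ _ (F₂.insert _) (DependsOn.eq_and (x, h) false d₂) (by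
          simp only [mem_insert_iff, Prod.mk.injEq, not_or]
          exact ⟨by omega, n1 _ _ _ _⟩),
        Pr_eq_and _ _ _ F₂ d₂ (n1 _ _ _ _)]
      simp [rows]
    have hle : Pr (rows q) (fun ω => (E₀ ω ∨ E₁ ω) ∨ E₂ ω) ≤ Pr (rows q) (Arch (k + 1) x h) := by
      refine Pr_mono hp ((L₀.or L₁).or L₂) (loc_arch _ _ _) ?_
      set D := RF (x - (k + 1 : ℕ) - 1) (x + (k + 1 : ℕ) + 1) h (h + (k + 1 : ℕ)) with hD
      have hr : ∀ i, x - 2 ≤ i → i ≤ x + 1 → (i, h) ∈ D := fun i h1 h2 => by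
        simp only [hD, RF, mem_ofPred_eq]; push_cast; omega
      rintro ω ((⟨h1, h2⟩ | ⟨h1, -, h2, h3⟩) | ⟨h1, -, h2, h3⟩)
      · have s1 := (Step.ur (x - 1) h (hr _ (by omega) (by omega)) h1).conn
        have s2 := (Step.dr x h (hr _ (by omega) (by omega)) h2).conn
        rw [sub_add_cancel] at s1
        exact s1.trans s2
      · have s1 := (Step.ur (x - 1) h (hr _ (by omega) (by omega)) h1).conn
        have s2 := (Step.dl (x + 1) h (hr _ (by omega) (by omega)) h2).conn
        rw [sub_add_cancel] at s1
        have h4 : Conn D ω (x + 1 - 1, h + 1) (x + 1 + 1, h + 1) := Conn.mono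
          (RF_subset (by push_cast; omega) (by push_cast; omega) (by omega)
            (by push_cast; omega)) h3
        rw [add_sub_cancel_right] at h4
        exact (s1.trans h4).trans s2
      · have s1 := (Step.ul x h (hr _ (by omega) (by omega)) h2).conn
        have s2 := (Step.dr (x - 2) h (hr _ (by omega) (by omega)) h1).conn
        have h4 : Conn D ω (x - 1 - 1, h + 1) (x - 1 + 1, h + 1) := Conn.mono
          (RF_subset (by push_cast; omega) (by push_cast; omega) (by omega)
            (by push_cast; omega)) h3
        rw [show x - 1 - 1 = x - 2 by ring, show x - 1 + 1 = x by ring] at h4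
        rw [show x - 2 + 1 = x - 1 by ring] at s2
        exact ((s1.trans h4.symm).trans s2).symm
    rw [Pr_or_of_disjoint _ (L₀.or L₁) L₂ (by
        rintro ω (⟨h1, _⟩ | ⟨h1, _⟩) ⟨_, h2, _⟩ <;> simp [h1] at h2),
      Pr_or_of_disjoint _ L₀ L₁ (by
        rintro ω ⟨_, h1⟩ ⟨_, h2, _⟩; simp [h1] at h2), P₀, P₁, P₂] at hle
    have i₁ := ih (x + 1) (h + 1)
    have i₂ := ih (x - 1) (h + 1)
    have hz := hz h
    have q0 := (hq h).1
    have q1 := (hq h).2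
    set b := (1 - 3 * z) ^ k
    have hb : 0 ≤ b := by
      apply pow_nonneg
      nlinarith [sq_nonneg (2 * q h - 1)]
    have j1 := mul_le_mul_of_nonneg_left i₁ (by positivity : 0 ≤ q h * (q h * q h))
    have j2 := mul_le_mul_of_nonneg_left i₂
      (mul_nonneg (sub_nonneg.2 q1) (mul_nonneg (sub_nonneg.2 q1) (sub_nonneg.2 q1)))
    have j3 := mul_nonneg hb (sub_nonneg.2 hz)
    rw [pow_succ]
    change _ ≤ _
    have : 1 / 3 * (1 - b * (1 - 3 * z)) ≤ q h * (1 - q h) + q h * (q h * q h) * (1 / 3 * (1 - b))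
        + (1 - q h) * ((1 - q h) * (1 - q h)) * (1 / 3 * (1 - b)) := by
      linarith
    linarith

theorem exists_arch {z : ℝ} (hz0 : 0 < z) : ∃ C : ℕ, 0 < C ∧
    ∀ q : ℤ → ℝ, (∀ j, 0 ≤ q j ∧ q j ≤ 1) → (∀ j, z ≤ q j * (1 - q j)) →
      ∀ x h, 1 / 4 ≤ Pr (rows q) (Arch C x h) := by
  obtain ⟨C, hC⟩ := exists_pow_lt_of_lt_one (by norm_num : (0 : ℝ) < 1 / 4)
    (by linarith : 1 - 3 * z < 1)
  refine ⟨C, Nat.pos_of_ne_zero fun h => ?_, fun q hq hz x h => ?_⟩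
  · norm_num [h] at hC
  · linarith [Pr_arch hq hz C x h]

theorem Pr_false {ι : Type} [DecidableEq ι] (p : ι → ℝ) {A : (ι → Bool) → Prop}
    (h : ∀ ω, ¬ A ω) : Pr p A = 0 := by
  have : ind A = fun _ => 0 := by funext ω; simp [ind, h ω]
  rw [Pr, this, E_const]

theorem Pr_true {ι : Type} [DecidableEq ι] (p : ι → ℝ) {A : (ι → Bool) → Prop}
    (h : ∀ ω, A ω) : Pr p A = 1 := by
  have : ind A = fun _ => 1 := by funext ω; simp [ind, h ω]
  rw [Pr, this, E_const]

theorem Pr_partition {ι α : Type} [DecidableEq ι] (p : ι → ℝ) {X : (ι → Bool) → α}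
    (hX : Loc X) {A : (ι → Bool) → Prop} (hA : Loc A) (S : Finset α) (h : ∀ ω, A ω → X ω ∈ S) :
    Pr p A = ∑ s ∈ S, Pr p (fun ω => X ω = s ∧ A ω) := by
  classical
  have key : ∀ S : Finset α, Pr p (fun ω => X ω ∈ S ∧ A ω) =
      ∑ s ∈ S, Pr p (fun ω => X ω = s ∧ A ω) := by
    intro S
    induction S using Finset.induction_on with
    | empty => simpa using Pr_false p (by simp)
    | insert a S ha ih =>
      rw [Finset.sum_insert ha, ← ih, ← Pr_or_of_disjoint p ((hX.comp (· = a)).and hA)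
        ((hX.comp (· ∈ S)).and hA)]
      · congr 1
        funext ω
        simp only [Finset.mem_insert, or_and_right]
      · rintro ω ⟨h1, _⟩ ⟨h2, _⟩
        exact ha (h1 ▸ h2)
  rw [← key]
  congr 1
  funext ω
  exact propext ⟨fun hω => ⟨h ω hω, hω⟩, And.right⟩

theorem Loc.forall_finset {ι α : Type} {A : α → (ι → Bool) → Prop} (hA : ∀ a, Loc (A a))
    (S : Finset α) : Loc (fun ω => ∀ a ∈ S, A a ω) := by
  choose T hT hd using hA
  refine ⟨⋃ a ∈ S, T a, S.finite_toSet.biUnion fun a _ => hT a, fun ω ω' h => ?_⟩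
  refine propext (forall₂_congr fun a ha => ?_)
  rw [hd a fun x hx => h x (mem_biUnion (Finset.mem_coe.2 ha) hx)]

theorem IncE.forall_finset {ι α : Type} {o : ι → Bool} {A : α → (ι → Bool) → Prop}
    {S : Finset α} (hA : ∀ a ∈ S, IncE o (A a)) : IncE o (fun ω => ∀ a ∈ S, A a ω) :=
  fun ω ω' h hω a ha => hA a ha ω ω' h (hω a ha)

theorem Pr_forall_ge {ι α : Type} [DecidableEq ι] {p : ι → ℝ} (hp : IsProb p) {o : ι → Bool}
    {A : α → (ι → Bool) → Prop} (hA : ∀ a, Loc (A a)) {S : Finset α}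
    (hi : ∀ a ∈ S, IncE o (A a)) {c : ℝ} (hc : 0 ≤ c) (h : ∀ a ∈ S, c ≤ Pr p (A a)) :
    c ^ S.card ≤ Pr p (fun ω => ∀ a ∈ S, A a ω) := by
  classical
  induction S using Finset.induction_on with
  | empty => rw [Pr_true _ (by simp)]; simp
  | insert a S ha ih =>
    have ih := ih (fun b hb => hi b (Finset.mem_insert_of_mem hb))
      (fun b hb => h b (Finset.mem_insert_of_mem hb))
    have h1 := h a (Finset.mem_insert_self a S)
    have hh := Pr_harris hp (hi a (Finset.mem_insert_self a S))
      (IncE.forall_finset fun b hb => hi b (Finset.mem_insert_of_mem hb)) (hA a)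
      (Loc.forall_finset hA S)
    rw [Finset.card_insert_of_notMem ha, pow_succ']
    simp only [Finset.forall_mem_insert]
    exact (mul_le_mul h1 ih (pow_nonneg hc _) (hc.trans h1)).trans hh

theorem Pr_forall_le {ι α : Type} [DecidableEq ι] {p : ι → ℝ} (hp : IsProb p)
    {A : α → (ι → Bool) → Prop} {T : α → Set ι} (hT : ∀ a, (T a).Finite)
    (hA : ∀ a, DependsOn (A a) (T a)) {S : Finset α}
    (hd : ∀ a ∈ S, ∀ b ∈ S, a ≠ b → Disjoint (T a) (T b)) {c : ℝ} (hc : 0 ≤ c)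
    (h : ∀ a ∈ S, Pr p (A a) ≤ c) :
    Pr p (fun ω => ∀ a ∈ S, A a ω) ≤ c ^ S.card := by
  classical
  induction S using Finset.induction_on with
  | empty => rw [Pr_true _ (by simp)]; simp
  | insert a S ha ih =>
    have ih := ih (fun b hb b' hb' => hd b (Finset.mem_insert_of_mem hb) b'
      (Finset.mem_insert_of_mem hb')) (fun b hb => h b (Finset.mem_insert_of_mem hb))
    have h1 := h a (Finset.mem_insert_self a S)
    rw [Finset.card_insert_of_notMem ha, pow_succ']
    simp only [Finset.forall_mem_insert]
    have dS : DependsOn (fun ω => ∀ b ∈ S, A b ω) (⋃ b ∈ S, T b) := fun ω ω' h =>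
      propext (forall₂_congr fun b hb => by
        rw [hA b fun x hx => h x (mem_biUnion (Finset.mem_coe.2 hb) hx)])
    rw [Pr_indep p (hT a) (S.finite_toSet.biUnion fun a _ => hT a) (hA a) dS]
    · exact mul_le_mul h1 ih (Pr_nonneg hp (Loc.forall_finset (fun b => ⟨_, hT b, hA b⟩) S)) hc
    · simp only [disjoint_iUnion_right]
      intro b hb
      exact hd a (Finset.mem_insert_self a S) b (Finset.mem_insert_of_mem hb)
        (by rintro rfl; exact ha hb)

/-- The trapezoid of `h` rows whose bottom row has half-width `A`. -/
def Trap (A h : ℤ) : Set (ℤ × ℤ) := {f | 0 ≤ f.2 ∧ f.2 < h ∧ -A + f.2 ≤ f.1 ∧ f.1 < A - f.2}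

theorem Trap_subset_RF (A h : ℤ) : Trap A h ⊆ RF (-A) A 0 h := by
  intro f hf
  simp only [Trap, RF, mem_ofPred_eq] at *
  omega

theorem Trap_finite (A h : ℤ) : (Trap A h).Finite := (RF_finite _ _ _ _).subset (Trap_subset_RF A h)

theorem loc_SV {c y₀ y₁ : ℤ} {D : Set (ℤ × ℤ)} (hD : D.Finite) : Loc (SV c y₀ y₁ D) :=
  ⟨_, hD, dependsOn_SV ..⟩

theorem SV.mono {c y₀ y₁ : ℤ} {D D' : Set (ℤ × ℤ)} (hD : D ⊆ D') {ω : ℤ × ℤ → Bool}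
    (h : SV c y₀ y₁ D ω) : SV c y₀ y₁ D' ω := by
  obtain ⟨u, v, h1, h2, h3, h4⟩ := h
  exact ⟨u, v, h1, h2, h3, h4.mono hD⟩

/-- The probability of crossing a trapezoid upwards. -/
noncomputable def trapPr (A h : ℤ) (q : ℤ → ℝ) : ℝ := Pr (rows q) (SV 0 0 h (Trap A h))

open Classical in
/-- The sites of level `h` connected to level `0` in the trapezoid. -/
noncomputable def reach (A h : ℤ) (ω : ℤ × ℤ → Bool) : Finset ℤ :=
  (Finset.Icc (-A + h) (A - h)).filter fun x =>
    (x + h) % 2 = 0 ∧ ∃ u, cls 0 u ∧ u.2 = 0 ∧ Conn (Trap A h) ω u (x, h)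

theorem mem_reach {A h x : ℤ} {ω : ℤ × ℤ → Bool} : x ∈ reach A h ω ↔
    (-A + h ≤ x ∧ x ≤ A - h) ∧ (x + h) % 2 = 0 ∧
      ∃ u, cls 0 u ∧ u.2 = 0 ∧ Conn (Trap A h) ω u (x, h) := by
  simp [reach, and_assoc]

theorem dependsOn_reach (A h : ℤ) : DependsOn (reach A h) (Trap A h) := by
  intro ω ω' hω
  ext x
  simp only [mem_reach, dependsOn_conn (Trap A h) _ (x, h) hω]

theorem SV.not_arch {A h : ℤ} {C : ℕ} (hh : 0 ≤ h) (hC : 0 < C) {ω : ℤ × ℤ → Bool}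
    (hV : SV 0 0 (h + C) (Trap A (h + C)) ω) : ∃ x ∈ reach A h ω, ¬ Arch C x h ω := by
  by_contra! hall
  obtain ⟨u, v, hu, hu0, hv, hconn⟩ := hV
  have key : ∀ x ∈ reach A h ω, ∀ w, Conn {f | h ≤ f.2} ω (x, h) w →
      w.2 < h + C ∧ (w.2 = h → w = (x, h)) := by
    intro x hx w hw
    exact arch_encloses (fun f hf => ⟨hf.2.2.1, hf.2.2.2⟩) (fun f hf => hf) (hall x hx) hw
  have main : ∀ w, Conn (Trap A (h + C)) ω u w →
      (w.2 ≤ h ∧ ∃ u', cls 0 u' ∧ u'.2 = 0 ∧ Conn (Trap A h) ω u' w) ∨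
        ∃ x ∈ reach A h ω, Conn {f | h ≤ f.2} ω (x, h) w := by
    intro w hw
    induction hw with
    | refl => exact .inl ⟨by omega, u, hu, hu0, .refl⟩
    | @tail w w' h1 h2 ih =>
      have hf := h2.face_mem
      have hc := h2.coord
      by_cases hr : (face (w, w')).2 < h
      · have hs : Step (Trap A h) ω w w' := h2.congr ⟨hf.1, hr, hf.2.2⟩ rfl
        have : w.2 ≤ h ∧ w'.2 ≤ h := by simp only [face] at hr; omega
        rcases ih with ⟨_, u', hu', hu0', ih⟩ | ⟨x, hx, ih⟩
        · exact .inl ⟨this.2, u', hu', hu0', ih.tail hs⟩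
        · have hk := key x hx w ih
          have h3 : ∀ {a b}, Conn {f | h ≤ f.2} ω a b → h ≤ a.2 → h ≤ b.2 := by
            intro a b hab ha
            induction hab with
            | refl => exact ha
            | tail _ hs _ =>
              have := hs.face_mem
              simp only [face, mem_ofPred_eq] at this
              omega
          have hw2 : w = (x, h) := hk.2 (le_antisymm this.1 (h3 ih le_rfl))
          obtain ⟨_, _, u', hu', hu0', hcu⟩ := mem_reach.1 hx
          exact .inl ⟨this.2, u', hu', hu0', (hw2 ▸ hcu : Conn (Trap A h) ω u' w).tail hs⟩
      · have hs : Step {f : ℤ × ℤ | h ≤ f.2} ω w w' := h2.congr (not_lt.1 hr) rfl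
        rcases ih with ⟨ih1, u', hu', hu0', ih⟩ | ⟨x, hx, ih⟩
        · have hwh : w.2 = h := by simp only [face] at hr; omega
          have hw0 : (w.1, h) = w := Prod.ext rfl hwh.symm
          refine .inr ⟨w.1, mem_reach.2 ⟨?_, ?_, u', hu', hu0', ?_⟩, ?_⟩
          · have := hf.2.2
            simp only [face] at this hr
            omega
          · have := (Conn.cls ih 0).1 hu'
            simp only [cls] at this
            omega
          · rwa [hw0]
          · rw [hw0]; exact hs.conn
        · exact .inr ⟨x, hx, ih.tail hs⟩
  rcases main v hconn with ⟨h1, _⟩ | ⟨x, hx, h1⟩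
  · omega
  · have := (key x hx v h1).1
    omega

theorem SV.of_reach {A h x : ℤ} (hh : 0 ≤ h) {ω : ℤ × ℤ → Bool} (hx : x ∈ reach A h ω)
    (hω : ¬ (ω (x - 1, h) = true ∧ ω (x, h) = false)) : SV 0 0 (h + 1) (Trap (A + 2) (h + 1)) ω := by
  obtain ⟨h1, h2, u, hu, hu0, hc⟩ := mem_reach.1 hx
  have hc' : Conn (Trap (A + 2) (h + 1)) ω u (x, h) := by
    refine hc.mono fun f hf => ?_
    simp only [Trap, mem_ofPred_eq] at *
    omega
  by_cases hr : ω (x, h) = true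
  · refine ⟨u, (x + 1, h + 1), hu, hu0, rfl, hc'.tail (.ur x h ?_ hr)⟩
    simp only [Trap, mem_ofPred_eq]
    omega
  · have hl : ω (x - 1, h) = false := by
      simp only [Bool.not_eq_true] at hr
      simpa [hr] using hω
    refine ⟨u, (x - 1, h + 1), hu, hu0, rfl, hc'.tail ?_⟩
    have := Step.ul (D := Trap (A + 2) (h + 1)) (ω := ω) (x - 1) h ?_ hl
    · simpa using this
    · simp only [Trap, mem_ofPred_eq]
      omega

theorem Loc.forall_mem {ι α : Type} {X : (ι → Bool) → Finset α} (hX : Loc X) {S : Finset α}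
    (hS : ∀ ω, X ω ⊆ S) {A : α → (ι → Bool) → Prop} (hA : ∀ a, Loc (A a)) :
    Loc (fun ω => ∀ a ∈ X ω, A a ω) := by
  have := Loc.forall_finset (fun a => (hX.comp fun s => a ∈ s).comp₂ (hA a) fun P Q => P → Q) S
  convert this using 3 with ω
  exact ⟨fun h _ ha => h ha, fun h ha => h (hS ω ha) ha⟩

/-- Comparison of two families of events indexed by an independent random finite set. -/
theorem Pr_forall_mem_le {ι α : Type} [DecidableEq ι] {p p' : ι → ℝ} (hp : IsProb p)
    (hp' : IsProb p') {X : (ι → Bool) → Finset α} {T : Set ι} (hT : T.Finite)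
    (hX : DependsOn X T) (hpp : ∀ x ∈ T, p' x = p x) {S : Finset α} (hS : ∀ ω, X ω ⊆ S)
    {A B : α → (ι → Bool) → Prop} {TA TB : α → Set ι} (hTA : ∀ a, (TA a).Finite)
    (hTB : ∀ a, (TB a).Finite) (hA : ∀ a, DependsOn (A a) (TA a))
    (hB : ∀ a, DependsOn (B a) (TB a)) (hdA : ∀ a, Disjoint T (TA a))
    (hdB : ∀ a, Disjoint T (TB a)) {o : ι → Bool} (hi : ∀ a ∈ S, IncE o (A a))
    (hd : ∀ a ∈ S, ∀ b ∈ S, a ≠ b → Disjoint (TB a) (TB b)) {c : ℝ} (hc : 0 ≤ c)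
    (h1 : ∀ a ∈ S, c ≤ Pr p (A a)) (h2 : ∀ a ∈ S, Pr p' (B a) ≤ c) :
    Pr p' (fun ω => ∀ a ∈ X ω, B a ω) ≤ Pr p (fun ω => ∀ a ∈ X ω, A a ω) := by
  have lX : Loc X := ⟨T, hT, hX⟩
  have lA : ∀ a, Loc (A a) := fun a => ⟨_, hTA a, hA a⟩
  have lB : ∀ a, Loc (B a) := fun a => ⟨_, hTB a, hB a⟩
  rw [Pr_partition p' lX (Loc.forall_mem lX hS lB) S.powerset
      (fun ω _ => Finset.mem_powerset.2 (hS ω)),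
    Pr_partition p lX (Loc.forall_mem lX hS lA) S.powerset
      (fun ω _ => Finset.mem_powerset.2 (hS ω))]
  refine Finset.sum_le_sum fun s hs => ?_
  have hs := Finset.mem_powerset.1 hs
  have dX : DependsOn (fun ω => X ω = s) T := fun ω ω' h => by simp only [hX h]
  have key : ∀ (p : ι → ℝ) (A : α → (ι → Bool) → Prop) (TA : α → Set ι),
      (∀ a, (TA a).Finite) → (∀ a, DependsOn (A a) (TA a)) → (∀ a, Disjoint T (TA a)) →
      Pr p (fun ω => X ω = s ∧ ∀ a ∈ X ω, A a ω) =
        Pr p (fun ω => X ω = s) * Pr p (fun ω => ∀ a ∈ s, A a ω) := by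
    intro p A TA hTA hA hdA
    rw [← Pr_indep p hT (s.finite_toSet.biUnion fun a _ => hTA a) dX (T := ⋃ a ∈ s, TA a)
      (fun ω ω' h => propext (forall₂_congr fun b hb => by
        rw [hA b fun x hx => h x (mem_biUnion (Finset.mem_coe.2 hb) hx)]))
      (by simp only [disjoint_iUnion_right]; exact fun a _ => hdA a)]
    congr 1
    funext ω
    exact propext ⟨fun ⟨h, h'⟩ => ⟨h, h ▸ h'⟩, fun ⟨h, h'⟩ => ⟨h, h ▸ h'⟩⟩
  rw [key p' B TB hTB hB hdB, key p A TA hTA hA hdA, Pr_congr_prob hT dX hpp]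
  refine mul_le_mul_of_nonneg_left ?_ (Pr_nonneg hp ⟨T, hT, dX⟩)
  exact (Pr_forall_le hp' hTB hB (fun a ha b hb => hd a (hs ha) b (hs hb)) hc
    fun a ha => h2 a (hs ha)).trans
    (Pr_forall_ge hp lA (fun a ha => hi a (hs ha)) hc fun a ha => h1 a (hs ha))

/-- The top `C` rows of a trapezoid may be replaced by a single row of arbitrary parameter. -/
theorem trapPr_replace {A h : ℤ} (hh : 0 ≤ h) {C : ℕ} (hC : 0 < C) {q q' : ℤ → ℝ}
    (hq : ∀ j, 0 ≤ q j ∧ q j ≤ 1) (hq' : ∀ j, 0 ≤ q' j ∧ q' j ≤ 1)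
    (hqq : ∀ j, 0 ≤ j → j < h → q' j = q j)
    (harch : ∀ x, 1 / 4 ≤ Pr (rows q) (Arch C x h)) :
    trapPr A (h + C) q ≤ trapPr (A + 2) (h + 1) q' := by
  have hp : IsProb (rows q) := fun f => hq f.2
  have hp' : IsProb (rows q') := fun f => hq' f.2
  set B : ℤ → (ℤ × ℤ → Bool) → Prop := fun x ω => ω (x - 1, h) = true ∧ ω (x, h) = false with hB
  set S : Finset ℤ := (Finset.Icc (-A + h) (A - h)).filter fun x => (x + h) % 2 = 0 with hS
  have hXS : ∀ ω, reach A h ω ⊆ S := fun ω x hx => by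
    have := mem_reach.1 hx
    exact Finset.mem_filter.2 ⟨Finset.mem_Icc.2 this.1, this.2.1⟩
  have lX : Loc (reach A h) := ⟨_, Trap_finite A h, dependsOn_reach A h⟩
  have dB : ∀ x, DependsOn (B x) {(x - 1, h), (x, h)} := fun x ω ω' hω => by
    simp only [hB, hω (x - 1, h) (by simp), hω (x, h) (by simp)]
  have lB : ∀ x, Loc (B x) := fun x => ⟨_, by simp, dB x⟩
  have hcmp : Pr (rows q') (fun ω => ∀ x ∈ reach A h ω, B x ω) ≤
      Pr (rows q) (fun ω => ∀ x ∈ reach A h ω, Arch C x h ω) := by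
    refine Pr_forall_mem_le (o := ori 1) (c := 1 / 4) hp hp' (Trap_finite A h)
      (dependsOn_reach A h) (fun f hf => hqq f.2 hf.1 hf.2.1) hXS
      (TA := fun x => RF (x - C - 1) (x + C + 1) h (h + C))
      (fun x => RF_finite ..) (fun x => by simp) (fun x => dependsOn_conn ..) dB ?_ ?_ ?_ ?_
      (by norm_num) (fun x _ => harch x) ?_
    · intro x
      rw [Set.disjoint_left]
      intro f hf hf'
      have := hf.2.1
      have := hf'.2.2.1
      omega
    · intro x
      rw [Set.disjoint_left]
      rintro f hf (rfl | rfl) <;> exact absurd hf.2.1 (lt_irrefl _)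
    · intro x hx ω ω' hi ha
      refine Conn.inc ha ?_ hi
      simp only [hS, Finset.mem_filter] at hx
      simp only [cls]
      omega
    · intro x hx y hy hxy
      simp only [hS, Finset.mem_filter] at hx hy
      rw [Set.disjoint_left]
      rintro f (rfl | rfl) (hf | hf) <;> simp at hf <;> omega
    · intro x _
      have e1 := Pr_eq_and (rows q') (x - 1, h) true (S := {(x, h)}) (by simp)
        (dependsOn_coord (x, h) false) (by simp)
      have e2 := Pr_eq (rows q') (x, h) false
      simp only [hB]
      rw [e1, e2]
      simp only [rows]
      norm_num
      nlinarith [sq_nonneg (2 * q' h - 1)]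
  have h1 : trapPr A (h + C) q ≤ 1 - Pr (rows q) (fun ω => ∀ x ∈ reach A h ω, Arch C x h ω) := by
    rw [← Pr_not _ (Loc.forall_mem lX hXS fun x => loc_arch C x h)]
    refine Pr_mono hp (loc_SV (Trap_finite _ _)) (Loc.not (Loc.forall_mem lX hXS
      fun x => loc_arch C x h)) fun ω hω => ?_
    obtain ⟨x, hx, hx'⟩ := hω.not_arch hh hC
    exact fun hall => hx' (hall x hx)
  have h2 : 1 - Pr (rows q') (fun ω => ∀ x ∈ reach A h ω, B x ω) ≤ trapPr (A + 2) (h + 1) q' := by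
    rw [← Pr_not _ (Loc.forall_mem lX hXS lB)]
    refine Pr_mono hp' (Loc.not (Loc.forall_mem lX hXS lB)) (loc_SV (Trap_finite _ _))
      fun ω hω => ?_
    push Not at hω
    obtain ⟨x, hx, hx'⟩ := hω
    exact SV.of_reach hh hx hx'
  linarith

/-- The top row of a trapezoid may be moved to the bottom. -/
theorem trapPr_pass {A h : ℤ} (hA : A % 2 = 1) (hh : 0 ≤ h) {q q₂ : ℤ → ℝ}
    (hq : ∀ j, 0 < q j ∧ q j < 1) (h0 : q₂ 0 = q h) (h1 : ∀ j, 0 ≤ j → j < h → q₂ (j + 1) = q j) :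
    trapPr A (h + 1) q ≤ trapPr (A + 2) (h + 1) q₂ := by
  set U : ℤ → Set (ℤ × ℤ) := fun m => {f | 0 ≤ f.2 ∧ f.2 ≤ h ∧
    ((f.2 ≤ m ∧ -A + f.2 ≤ f.1 ∧ f.1 < A - f.2) ∨
      (m < f.2 ∧ -A + f.2 - 1 ≤ f.1 ∧ f.1 < A - f.2 + 1))} with hU
  set r : ℤ → ℤ → ℝ := fun m j => if j < m then q j else if j = m then q h else
    if j ≤ h then q (j - 1) else q j with hr
  have hr01 : ∀ m, IsProb (rows (r m)) := by
    intro m f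
    simp only [rows, hr]
    split_ifs <;> exact ⟨(hq _).1.le, (hq _).2.le⟩
  have fU : ∀ m, (U m).Finite := fun m => (RF_finite (-A - 1) (A + 1) 0 (h + 1)).subset (by
    intro f hf
    simp only [hU, RF, mem_ofPred_eq] at *
    omega)
  have key : ∀ k : ℕ, (k : ℤ) ≤ h →
      trapPr A (h + 1) q ≤ Pr (rows (r (h - k))) (SV 0 0 (h + 1) (U (h - k))) := by
    intro k
    induction k with
    | zero =>
      intro _
      have e1 : r (h - (0 : ℕ)) = q := by
        funext j
        simp only [hr, Nat.cast_zero, sub_zero]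
        split_ifs with h1 h2 h3 <;> first | rfl | (rw [h2]) | omega
      have e2 : U (h - (0 : ℕ)) = Trap A (h + 1) := by
        ext f
        simp only [hU, Trap, mem_ofPred_eq, Nat.cast_zero, sub_zero]
        omega
      rw [e1, e2]
      exact le_rfl
    | succ k ih =>
      intro hk
      push_cast at hk ⊢
      refine (ih (by omega)).trans ?_
      set m : ℤ := h - (k + 1) with hm
      have hmk : h - (k : ℤ) = m + 1 := by omega
      rw [hmk]
      have hsub : U (m + 1) ⊆ U m := by
        intro f hf
        simp only [hU, mem_ofPred_eq] at *
        omega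
      refine (Pr_mono (hr01 _) (loc_SV (fU _)) (loc_SV (fU m)) fun ω hω => hω.mono hsub).trans
        (le_of_eq ?_)
      refine Pr_exchange (a := -A + m) (y := m) (w := (A - m).toNat) (q := q m) (q' := q h)
        (by omega) (fU m) ?_ (by omega) (by omega) ?_ ?_ ?_ ?_ ?_ ?_
      · intro i j hj
        simp only [hU, mem_ofPred_eq]
        omega
      · nlinarith [hq m, hq h]
      · intro i
        simp [rows, hr]
      · intro i
        simp [rows, hr]
      · intro i
        simp [rows, hr]
      · intro i
        have : m + 1 ≤ h := by omega
        simp [rows, hr, this]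
      · intro f hf1 hf2
        simp only [rows, hr]
        have e1 : f.2 < m + 1 ↔ f.2 < m := by omega
        simp only [e1, hf1, hf2, if_false]
  have hk := key h.toNat (by omega)
  rw [show h - (h.toNat : ℤ) = 0 by omega] at hk
  refine hk.trans ?_
  have hsub : U 0 ⊆ Trap (A + 2) (h + 1) := by
    intro f hf
    simp only [hU, Trap, mem_ofPred_eq] at *
    omega
  refine (Pr_mono (hr01 _) (loc_SV (fU _)) (loc_SV (Trap_finite _ _))
    fun ω hω => hω.mono hsub).trans (le_of_eq ?_)
  refine Pr_congr_prob (Trap_finite _ _) (dependsOn_SV ..) fun f hf => ?_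
  obtain ⟨hf0, hf1, -⟩ := hf
  simp only [rows, hr]
  rcases hf0.lt_or_eq with hf0 | hf0
  · have := h1 (f.2 - 1) (by omega) (by omega)
    rw [sub_add_cancel] at this
    rw [if_neg (by omega), if_neg (by omega), if_pos (by omega), this]
  · rw [← hf0, if_neg (by omega), if_pos rfl, h0]

theorem trapPr_compare_aux {C : ℕ} (hC : 0 < C) {z : ℝ} (hz : z ≤ 1 / 4)
    (harch : ∀ q : ℤ → ℝ, (∀ j, 0 ≤ q j ∧ q j ≤ 1) → (∀ j, z ≤ q j * (1 - q j)) →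
      ∀ x h, 1 / 4 ≤ Pr (rows q) (Arch C x h)) {t : ℤ → ℝ} (ht : ∀ j, 0 < t j ∧ t j < 1) (n : ℕ) :
    ∀ A : ℤ, A % 2 = 1 → ∀ k : ℤ, 0 ≤ k → ∀ q : ℤ → ℝ, (∀ j, 0 < q j ∧ q j < 1) →
      (∀ j, k ≤ j → z ≤ q j * (1 - q j)) →
      trapPr A (k + C * n) q ≤
        trapPr (A + 4 * n) (n + k) (fun j => if j < n then t j else q (j - n)) := by
  induction n with
  | zero =>
    intro A hA k hk q hq hzq
    simp only [Nat.cast_zero, mul_zero, add_zero, zero_add, sub_zero, trapPr]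
    refine le_of_eq (Pr_congr_prob (Trap_finite _ _) (dependsOn_SV ..) fun f hf => ?_)
    simp only [rows]
    rw [if_neg (not_lt.2 hf.1)]
  | succ n ih =>
    intro A hA k hk q hq hzq
    set h : ℤ := k + C * n with hh
    have hkh : k ≤ h := by
      have : (0 : ℤ) ≤ C * n := by positivity
      omega
    have hq01 : ∀ j, 0 ≤ q j ∧ q j ≤ 1 := fun j => ⟨(hq j).1.le, (hq j).2.le⟩
    set q' : ℤ → ℝ := fun j => if j < h then q j else t n with hq'
    set q₂ : ℤ → ℝ := fun j => if j ≤ 0 then t n else q (j - 1) with hq₂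
    have s1 : trapPr A (h + C) q ≤ trapPr (A + 2) (h + 1) q' := by
      refine trapPr_replace (hk.trans hkh) hC hq01 ?_ ?_ ?_
      · intro j
        simp only [hq']
        split_ifs
        · exact hq01 j
        · exact ⟨(ht n).1.le, (ht n).2.le⟩
      · intro j _ hj
        simp only [hq', if_pos hj]
      · intro x
        have := harch (fun j => if j < h then 1 / 2 else q j) ?_ ?_ x h
        · refine this.trans (le_of_eq ?_)
          refine Pr_congr_prob (RF_finite ..) (dependsOn_conn ..) fun f hf => ?_
          simp only [rows]
          rw [if_neg (not_lt.2 hf.2.2.1)]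
        · intro j
          split_ifs
          · norm_num
          · exact hq01 j
        · intro j
          split_ifs with hj
          · norm_num
            linarith
          · exact hzq j (hkh.trans (not_lt.1 hj))
    have s2 : trapPr (A + 2) (h + 1) q' ≤ trapPr (A + 2 + 2) (h + 1) q₂ := by
      refine trapPr_pass (by omega) (hk.trans hkh) ?_ ?_ ?_
      · intro j
        simp only [hq']
        split_ifs
        · exact hq j
        · exact ht n
      · simp [hq', hq₂]
      · intro j hj0 hj
        simp only [hq', hq₂, if_pos hj, if_neg (by omega : ¬ j + 1 ≤ 0), add_sub_cancel_right]
    have s3 := ih (A + 2 + 2) (by omega) (k + 1) (by omega) q₂ ?_ ?_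
    · have e1 : k + C * ((n + 1 : ℕ) : ℤ) = h + C := by push_cast; rw [hh]; ring
      have e2 : h + 1 = k + 1 + C * n := by rw [hh]; ring
      rw [e1]
      refine s1.trans (s2.trans ?_)
      rw [e2]
      refine s3.trans (le_of_eq ?_)
      have e3 : A + 2 + 2 + 4 * (n : ℤ) = A + 4 * ((n + 1 : ℕ) : ℤ) := by push_cast; ring
      have e4 : (n : ℤ) + (k + 1) = ((n + 1 : ℕ) : ℤ) + k := by push_cast; ring
      rw [e3, e4]
      congr 1
      funext j
      simp only [hq₂]
      push_cast
      rcases lt_trichotomy j n with hj | hj | hj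
      · rw [if_pos hj, if_pos (by omega)]
      · rw [if_neg (by omega), if_pos (by omega), if_pos (by omega), hj]
      · rw [if_neg (by omega), if_neg (by omega), if_neg (by omega)]
        congr 1
        ring
    · intro j
      simp only [hq₂]
      split_ifs
      · exact ht n
      · exact hq _
    · intro j hj
      simp only [hq₂, if_neg (by omega : ¬ j ≤ 0)]
      exact hzq _ (by omega)

/-- Crossing a trapezoid with rows `q` of height `C n` is at most as likely as crossing one with
rows `t` of height `n`. -/
theorem trapPr_compare {C : ℕ} (hC : 0 < C) {z : ℝ} (hz : z ≤ 1 / 4)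
    (harch : ∀ q : ℤ → ℝ, (∀ j, 0 ≤ q j ∧ q j ≤ 1) → (∀ j, z ≤ q j * (1 - q j)) →
      ∀ x h, 1 / 4 ≤ Pr (rows q) (Arch C x h)) {q t : ℤ → ℝ} (hq : ∀ j, 0 < q j ∧ q j < 1)
    (ht : ∀ j, 0 < t j ∧ t j < 1) (hzq : ∀ j, z ≤ q j * (1 - q j)) {A : ℤ} (hA : A % 2 = 1)
    (n : ℕ) : trapPr A (C * n) q ≤ trapPr (A + 4 * n) n t := by
  have := trapPr_compare_aux hC hz harch ht n A hA 0 le_rfl q hq fun j _ => hzq j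
  rw [zero_add, add_zero] at this
  refine this.trans (le_of_eq ?_)
  refine Pr_congr_prob (Trap_finite _ _) (dependsOn_SV ..) fun f hf => ?_
  simp only [rows]
  rw [if_pos hf.2.1]

theorem trapPr_anti {A h h' : ℤ} (h0 : 0 ≤ h) (hh : h ≤ h') {q : ℤ → ℝ}
    (hq : ∀ j, 0 ≤ q j ∧ q j ≤ 1) : trapPr A h' q ≤ trapPr A h q := by
  refine Pr_mono (fun f => hq f.2) (loc_SV (Trap_finite _ _)) (loc_SV (Trap_finite _ _)) ?_
  rintro ω ⟨u, v, h1, h2, h3, h4⟩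
  obtain ⟨w, hw, hc⟩ := h4.first_level (h := h) (by omega) (by omega)
  refine ⟨u, w, h1, h2, hw, hc.mono ?_⟩
  rintro f ⟨hf, hf'⟩
  exact ⟨hf.1, hf', hf.2.2⟩

/-- A symmetry of the grid: a map of sites, the inverse map of faces, and whether the two
diagonals of a face are exchanged. -/
structure Sym where
  site : ℤ × ℤ → ℤ × ℤ
  face : ℤ × ℤ ≃ ℤ × ℤ
  flip : Bool
  step : ∀ {D : Set (ℤ × ℤ)} {ω : ℤ × ℤ → Bool} {u v : ℤ × ℤ}, Step D ω u v →
    Step (face ⁻¹' D) (fun f => xor (ω (face f)) flip) (site u) (site v)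

/-- The image of a configuration. -/
def Sym.act (s : Sym) (ω : ℤ × ℤ → Bool) : ℤ × ℤ → Bool := fun f => xor (ω (s.face f)) s.flip

theorem Sym.conn (s : Sym) {D : Set (ℤ × ℤ)} {ω : ℤ × ℤ → Bool} {u v : ℤ × ℤ}
    (h : Conn D ω u v) : Conn (s.face ⁻¹' D) (s.act ω) (s.site u) (s.site v) := by
  induction h with
  | refl => exact .refl
  | tail _ h2 ih => exact ih.tail (s.step h2)

theorem Sym.conn_of_subset (s : Sym) {D D' : Set (ℤ × ℤ)} {ω : ℤ × ℤ → Bool} {u v : ℤ × ℤ}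
    (h : Conn D ω u v) (hD : ∀ f, s.face f ∈ D → f ∈ D') :
    Conn D' (s.act ω) (s.site u) (s.site v) :=
  (s.conn h).mono hD

theorem Sym.Pr_act (s : Sym) (p : ℤ × ℤ → ℝ) {A : (ℤ × ℤ → Bool) → Prop} (hA : Loc A) :
    Pr p (fun ω => A (s.act ω)) =
      Pr (fun f => if s.flip then 1 - p (s.face f) else p (s.face f)) A :=
  Pr_reindex p s.face (fun _ => s.flip) hA

theorem Sym.loc (s : Sym) {A : (ℤ × ℤ → Bool) → Prop} (hA : Loc A) :
    Loc (fun ω => A (s.act ω)) := by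
  obtain ⟨S, hS, h⟩ := hA
  refine ⟨s.face '' S, hS.image _, fun ω ω' hω => h fun f hf => ?_⟩
  simp only [act, hω _ (mem_image_of_mem _ hf)]

/-- The reflection `y ↦ r - y`. -/
def symY (r : ℤ) : Sym where
  site v := (v.1, r - v.2)
  face := ⟨fun f => (f.1, r - 1 - f.2), fun f => (f.1, r - 1 - f.2), fun f => by simp, fun f => by simp⟩
  flip := true
  step h := by
    have e : ∀ j, r - 1 - (r - (j + 1)) = j := fun j => by ring
    have e' : ∀ j, r - (j + 1) + 1 = r - j := fun j => by ring
    cases h with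
    | ur i j h1 h2 => simpa [e'] using Step.dr i (r - (j + 1)) (by simpa [e] using h1) (by simp [e, h2])
    | dl i j h1 h2 => simpa [e'] using Step.ul i (r - (j + 1)) (by simpa [e] using h1) (by simp [e, h2])
    | ul i j h1 h2 => simpa [e'] using Step.dl i (r - (j + 1)) (by simpa [e] using h1) (by simp [e, h2])
    | dr i j h1 h2 => simpa [e'] using Step.ur i (r - (j + 1)) (by simpa [e] using h1) (by simp [e, h2])

/-- The transposition. -/
def symT : Sym where
  site v := (v.2, v.1)
  face := Equiv.prodComm ℤ ℤ
  flip := false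
  step h := by
    cases h with
    | ur i j h1 h2 => exact Step.ur j i (by simpa using h1) (by simp [h2])
    | dl i j h1 h2 => exact Step.dl j i (by simpa using h1) (by simp [h2])
    | ul i j h1 h2 => exact Step.dr j i (by simpa using h1) (by simp [h2])
    | dr i j h1 h2 => exact Step.ul j i (by simpa using h1) (by simp [h2])

/-- The reflection `x ↦ r - x`. -/
def symX (r : ℤ) : Sym where
  site v := (r - v.1, v.2)
  face := ⟨fun f => (r - 1 - f.1, f.2), fun f => (r - 1 - f.1, f.2), fun f => by simp, fun f => by simp⟩
  flip := true
  step h := by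
    have e : ∀ j, r - 1 - (r - (j + 1)) = j := fun j => by ring
    have e' : ∀ j, r - (j + 1) + 1 = r - j := fun j => by ring
    cases h with
    | ur i j h1 h2 => simpa [e'] using Step.ul (r - (i + 1)) j (by simpa [e] using h1) (by simp [e, h2])
    | dl i j h1 h2 => simpa [e'] using Step.dr (r - (i + 1)) j (by simpa [e] using h1) (by simp [e, h2])
    | ul i j h1 h2 => simpa [e'] using Step.ur (r - (i + 1)) j (by simpa [e] using h1) (by simp [e, h2])
    | dr i j h1 h2 => simpa [e'] using Step.dl (r - (i + 1)) j (by simpa [e] using h1) (by simp [e, h2])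

/-- The translation by `(a, b)`. -/
def symS (a b : ℤ) : Sym where
  site v := (v.1 + a, v.2 + b)
  face := ⟨fun f => (f.1 - a, f.2 - b), fun f => (f.1 + a, f.2 + b), fun f => by simp, fun f => by simp⟩
  flip := false
  step h := by
    have e : ∀ i a : ℤ, i + 1 + a = i + a + 1 := fun i a => by ring
    cases h with
    | ur i j h1 h2 => simpa [e] using Step.ur (i + a) (j + b) (by simpa using h1) (by simp [h2])
    | dl i j h1 h2 => simpa [e] using Step.dl (i + a) (j + b) (by simpa using h1) (by simp [h2])
    | ul i j h1 h2 => simpa [e] using Step.ul (i + a) (j + b) (by simpa using h1) (by simp [h2])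
    | dr i j h1 h2 => simpa [e] using Step.dr (i + a) (j + b) (by simpa using h1) (by simp [h2])

theorem VC.act_symS {k a b c d : ℤ} {ω : ℤ × ℤ → Bool} (s t : ℤ) (h : VC k a b c d ω) :
    VC (k + s + t) (a + s) (b + s) (c + t) (d + t) ((symS s t).act ω) := by
  obtain ⟨u, v, h1, h2, h3, h4, h5, h6, h7, h8⟩ := h
  have hc := (symS s t).conn_of_subset h8 (D' := RF (a + s) (b + s) (c + t) (d + t)) fun f hf => by
    simp only [symS, RF, mem_ofPred_eq, Equiv.coe_fn_mk] at *
    omega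
  refine ⟨_, _, ?_, ?_, ?_, ?_, ?_, ?_, ?_, hc⟩ <;> simp only [symS, cls] at * <;> omega

theorem HC.act_symS {k a b c d : ℤ} {ω : ℤ × ℤ → Bool} (s t : ℤ) (h : HC k a b c d ω) :
    HC (k + s + t) (a + s) (b + s) (c + t) (d + t) ((symS s t).act ω) := by
  obtain ⟨u, v, h1, h2, h3, h4, h5, h6, h7, h8⟩ := h
  have hc := (symS s t).conn_of_subset h8 (D' := RF (a + s) (b + s) (c + t) (d + t)) fun f hf => by
    simp only [symS, RF, mem_ofPred_eq, Equiv.coe_fn_mk] at *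
    omega
  refine ⟨_, _, ?_, ?_, ?_, ?_, ?_, ?_, ?_, hc⟩ <;> simp only [symS, cls] at * <;> omega

theorem HC.act_symX {k a b c d : ℤ} {ω : ℤ × ℤ → Bool} (r : ℤ) (h : HC k a b c d ω) :
    HC (k + r) (r - b) (r - a) c d ((symX r).act ω) := by
  obtain ⟨u, v, h1, h2, h3, h4, h5, h6, h7, h8⟩ := h
  have hc := (symX r).conn_of_subset h8 (D' := RF (r - b) (r - a) c d) fun f hf => by
    simp only [symX, RF, mem_ofPred_eq, Equiv.coe_fn_mk] at *
    omega
  have h9 := (Conn.cls h8 k).1 h1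
  refine ⟨_, _, ?_, ?_, ?_, ?_, ?_, ?_, ?_, hc.symm⟩ <;> simp only [symX, cls] at * <;> omega

theorem VC.act_symT {k a b c d : ℤ} {ω : ℤ × ℤ → Bool} (h : VC k a b c d ω) :
    HC k c d a b (symT.act ω) := by
  obtain ⟨u, v, h1, h2, h3, h4, h5, h6, h7, h8⟩ := h
  have hc := symT.conn_of_subset h8 (D' := RF c d a b) fun f hf => by
    simp only [symT, RF, mem_ofPred_eq, Equiv.prodComm_apply, Prod.fst_swap, Prod.snd_swap] at *
    omega
  refine ⟨_, _, ?_, ?_, ?_, ?_, ?_, ?_, ?_, hc⟩ <;> simp only [symT, cls] at * <;> omega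

theorem HC.act_symT {k a b c d : ℤ} {ω : ℤ × ℤ → Bool} (h : HC k a b c d ω) :
    VC k c d a b (symT.act ω) := by
  obtain ⟨u, v, h1, h2, h3, h4, h5, h6, h7, h8⟩ := h
  have hc := symT.conn_of_subset h8 (D' := RF c d a b) fun f hf => by
    simp only [symT, RF, mem_ofPred_eq, Equiv.prodComm_apply, Prod.fst_swap, Prod.snd_swap] at *
    omega
  refine ⟨_, _, ?_, ?_, ?_, ?_, ?_, ?_, ?_, hc⟩ <;> simp only [symT, cls] at * <;> omega

/-- The symmetric parameters. -/
noncomputable def half : ℤ × ℤ → ℝ := rows fun _ => 1 / 2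

theorem isProb_half : IsProb half := fun _ => by norm_num [half, rows]

theorem Sym.Pr_half (s : Sym) {A : (ℤ × ℤ → Bool) → Prop} (hA : Loc A) :
    Pr half (fun ω => A (s.act ω)) = Pr half A := by
  rw [s.Pr_act half hA]
  congr 1
  funext f
  simp only [half, rows]
  split_ifs <;> norm_num

theorem Sym.Pr_half_le (s : Sym) {A B : (ℤ × ℤ → Bool) → Prop} (hA : Loc A) (hB : Loc B)
    (h : ∀ ω, A ω → B (s.act ω)) : Pr half A ≤ Pr half B := by
  rw [← s.Pr_half hB]
  exact Pr_mono isProb_half hA (s.loc hB) h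

theorem Pr_VC_add_HC {p : ℤ × ℤ → ℝ} {a b c d : ℤ} (hab : a < b) (hcd : c < d)
    (k : ℤ) : Pr p (VC k a b c d) + Pr p (HC (k + 1) a b c d) = 1 := by
  rw [← Pr_or_of_disjoint p (loc_VC ..) (loc_HC ..) fun ω hV hH => not_VC_HC hV hH]
  exact Pr_true p (VC_or_HC hab hcd k)

theorem HC_congr_cls {k k' : ℤ} (hk : (k - k') % 2 = 0) (a b c d : ℤ) :
    HC k a b c d = HC k' a b c d := by
  funext ω
  refine propext (exists₂_congr fun u v => and_congr_left fun _ => ?_)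
  simp only [cls]
  omega

theorem Pr_half_square {n : ℤ} (hn : n % 2 = 1) (hn0 : 0 < n) (k : ℤ) :
    Pr half (HC k 0 n 0 n) = 1 / 2 := by
  have h1 := Pr_VC_add_HC (p := half) hn0 hn0 k
  have h2 : Pr half (VC k 0 n 0 n) = Pr half (HC k 0 n 0 n) :=
    le_antisymm (symT.Pr_half_le (loc_VC ..) (loc_HC ..) fun ω h => h.act_symT)
      (symT.Pr_half_le (loc_HC ..) (loc_VC ..) fun ω h => h.act_symT)
  have h3 : ∀ k, Pr half (HC k 0 n 0 n) ≤ Pr half (HC (k + 1) 0 n 0 n) := fun k => by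
    refine (symX n).Pr_half_le (loc_HC ..) (loc_HC ..) fun ω h => ?_
    have := h.act_symX n
    rwa [sub_self, sub_zero, HC_congr_cls (k' := k + 1) (by omega)] at this
  have h4 := h3 k
  have h5 := h3 (k + 1)
  rw [HC_congr_cls (k' := k) (by omega : (k + 1 + 1 - k) % 2 = 0)] at h5
  linarith

/-- The sites of class `k + 1` joined to the left side of the square of side `n`. -/
def explored (n k : ℤ) (ω : ℤ × ℤ → Bool) : Set (ℤ × ℤ) :=
  {v | ∃ u, cls (k + 1) u ∧ u.1 = 0 ∧ 0 ≤ u.2 ∧ u.2 ≤ n ∧ Conn (RF 0 n 0 n) ω u v}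

/-- The faces of the square having a corner in `d`. -/
def nbhd (n : ℤ) (d : Set (ℤ × ℤ)) : Set (ℤ × ℤ) := RF 0 n 0 n ∩ touch d

def IsCorner (f v : ℤ × ℤ) : Prop := (v.1 = f.1 ∨ v.1 = f.1 + 1) ∧ (v.2 = f.2 ∨ v.2 = f.2 + 1)

/-- The corners of the faces of `nbhd n d`. -/
def rim (n : ℤ) (d : Set (ℤ × ℤ)) : Set (ℤ × ℤ) := {v | ∃ f ∈ nbhd n d, IsCorner f v}

/-- The rim, together with its reflection. -/
def rim₂ (n : ℤ) (d : Set (ℤ × ℤ)) : Set (ℤ × ℤ) := {v | v ∈ rim n d ∨ (v.1, 2 * n - v.2) ∈ rim n d}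

/-- Paths stopped on entering `W`. -/
def Walk (D W : Set (ℤ × ℤ)) (ω : ℤ × ℤ → Bool) : ℤ × ℤ → ℤ × ℤ → Prop :=
  Relation.ReflTransGen fun a b => a ∉ W ∧ Step D ω a b

/-- A path from the right side of the rectangle stopped at the rim, in the rim itself. -/
def HitsLow (n m k : ℤ) (d : Set (ℤ × ℤ)) (ω : ℤ × ℤ → Bool) : Prop :=
  ∃ r e, cls k r ∧ r.1 = m ∧ 0 ≤ r.2 ∧ r.2 ≤ 2 * n ∧ e ∈ rim n d ∧
    Walk (RF 0 m 0 (2 * n)) (rim₂ n d) ω r e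

def HitsHigh (n m k : ℤ) (d : Set (ℤ × ℤ)) (ω : ℤ × ℤ → Bool) : Prop :=
  ∃ r e, cls k r ∧ r.1 = m ∧ 0 ≤ r.2 ∧ r.2 ≤ 2 * n ∧ (e.1, 2 * n - e.2) ∈ rim n d ∧
    Walk (RF 0 m 0 (2 * n)) (rim₂ n d) ω r e

/-- A vertical crossing of the square of side `n` is joined to the right side of the
rectangle `[0, m] × [0, 2 n]`. -/
def Join (n m k : ℤ) (ω : ℤ × ℤ → Bool) : Prop :=
  ∃ u v r, cls k u ∧ u.2 = 0 ∧ v.2 = n ∧ 0 ≤ u.1 ∧ u.1 ≤ n ∧ Conn (RF 0 n 0 n) ω u v ∧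
    r.1 = m ∧ Conn (RF 0 m 0 (2 * n)) ω u r

theorem isCorner_face {D : Set (ℤ × ℤ)} {ω : ℤ × ℤ → Bool} {u v : ℤ × ℤ} (h : Step D ω u v) :
    IsCorner (face (u, v)) u ∧ IsCorner (face (u, v)) v := by
  have := h.coord
  simp only [face, IsCorner]
  omega

theorem IsCorner.mem_touch {f v : ℤ × ℤ} {d : Set (ℤ × ℤ)} (h : IsCorner f v) (hv : v ∈ d) :
    f ∈ touch d := by
  obtain ⟨h1 | h1, h2 | h2⟩ := h
  · exact .inl (by rwa [show f = v from Prod.ext h1.symm h2.symm])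
  · exact .inr (.inr (.inl (by rwa [show (f.1, f.2 + 1) = v from Prod.ext h1.symm h2.symm])))
  · exact .inr (.inl (by rwa [show (f.1 + 1, f.2) = v from Prod.ext h1.symm h2.symm]))
  · exact .inr (.inr (.inr (by rwa [show (f.1 + 1, f.2 + 1) = v from Prod.ext h1.symm h2.symm])))

theorem exists_corner_of_mem_touch {f : ℤ × ℤ} {d : Set (ℤ × ℤ)} (h : f ∈ touch d) :
    ∃ v ∈ d, IsCorner f v := by
  rcases h with h | h | h | h <;> exact ⟨_, h, by simp [IsCorner]⟩

theorem dependsOn_explored_eq (n k : ℤ) (d : Set (ℤ × ℤ)) :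
    DependsOn (fun ω => explored n k ω = d) (nbhd n d) := by
  apply dependsOn_of_imp
  rintro ω ω' hω rfl
  have key : ∀ u, cls (k + 1) u → u.1 = 0 → 0 ≤ u.2 → u.2 ≤ n → ∀ v,
      Conn (RF 0 n 0 n) ω u v ↔ Conn (RF 0 n 0 n) ω' u v := by
    intro u h1 h2 h3 h4 v
    have hmem : ∀ {w}, Conn (RF 0 n 0 n) ω u w → w ∈ explored n k ω := fun h =>
      ⟨u, h1, h2, h3, h4, h⟩
    constructor
    · intro h
      refine h.induct (p := Conn (RF 0 n 0 n) ω' u) .refl fun w w' hw hs ih => ih.tail ?_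
      exact hs.congr hs.face_mem (hω _ ⟨hs.face_mem, (isCorner_face hs).1.mem_touch (hmem hw)⟩)
    · intro h
      refine h.induct (p := Conn (RF 0 n 0 n) ω u) .refl fun w w' hw hs ih => ih.tail ?_
      exact hs.congr hs.face_mem
        (hω _ ⟨hs.face_mem, (isCorner_face hs).1.mem_touch (hmem ih)⟩).symm
  ext v
  refine exists_congr fun u => ?_
  constructor
  · rintro ⟨h1, h2, h3, h4, h5⟩
    exact ⟨h1, h2, h3, h4, (key u h1 h2 h3 h4 v).2 h5⟩
  · rintro ⟨h1, h2, h3, h4, h5⟩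
    exact ⟨h1, h2, h3, h4, (key u h1 h2 h3 h4 v).1 h5⟩

theorem dependsOn_explored (n k : ℤ) : DependsOn (explored n k) (RF 0 n 0 n) := by
  intro ω ω' hω
  ext v
  simp only [explored, mem_ofPred_eq, dependsOn_conn (RF 0 n 0 n) _ v hω]

theorem Walk.conn {D W : Set (ℤ × ℤ)} {ω : ℤ × ℤ → Bool} {u v : ℤ × ℤ} (h : Walk D W ω u v) :
    Conn D ω u v := Relation.ReflTransGen.mono (fun _ _ h => h.2) _ _ h

theorem Conn.exists_walk {D W : Set (ℤ × ℤ)} {ω : ℤ × ℤ → Bool} {u v : ℤ × ℤ}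
    (h : Conn D ω u v) (hv : v ∈ W) : ∃ e ∈ W, Walk D W ω u e := by
  induction h using Relation.ReflTransGen.head_induction_on with
  | refl => exact ⟨v, hv, .refl⟩
  | @head a b h1 h2 ih =>
    by_cases ha : a ∈ W
    · exact ⟨a, ha, .refl⟩
    · obtain ⟨e, he, hw⟩ := ih
      exact ⟨e, he, Relation.ReflTransGen.head ⟨ha, h1⟩ hw⟩

theorem face_notMem {n : ℤ} {d D : Set (ℤ × ℤ)} {ω : ℤ × ℤ → Bool} {u v : ℤ × ℤ}
    (h : Step D ω u v) (hu : u ∉ rim₂ n d) : face (u, v) ∉ nbhd n d ∧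
      ((face (u, v)).1, 2 * n - 1 - (face (u, v)).2) ∉ nbhd n d := by
  have hc := (isCorner_face h).1
  refine ⟨fun hf => hu (.inl ⟨_, hf, hc⟩), fun hf => hu (.inr ⟨_, hf, ?_⟩)⟩
  simp only [IsCorner] at *
  omega

theorem dependsOn_hits {n m k : ℤ} (d : Set (ℤ × ℤ)) :
    DependsOn (HitsLow n m k d) (RF 0 m 0 (2 * n) \ nbhd n d) := by
  apply dependsOn_of_imp
  rintro ω ω' hω ⟨r, e, h1, h2, h3, h4, h5, h6⟩
  refine ⟨r, e, h1, h2, h3, h4, h5, Relation.ReflTransGen.mono ?_ _ _ h6⟩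
  rintro a b ⟨ha, hs⟩
  exact ⟨ha, hs.congr hs.face_mem (hω _ ⟨hs.face_mem, (face_notMem hs ha).1⟩)⟩

theorem loc_hitsHigh {n m k : ℤ} (d : Set (ℤ × ℤ)) : Loc (HitsHigh n m k d) := by
  refine ⟨RF 0 m 0 (2 * n), RF_finite .., ?_⟩
  apply dependsOn_of_imp
  rintro ω ω' hω ⟨r, e, h1, h2, h3, h4, h5, h6⟩
  refine ⟨r, e, h1, h2, h3, h4, h5, Relation.ReflTransGen.mono ?_ _ _ h6⟩
  rintro a b ⟨ha, hs⟩
  exact ⟨ha, hs.congr hs.face_mem (hω _ hs.face_mem)⟩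

theorem loc_hitsLow {n m k : ℤ} (d : Set (ℤ × ℤ)) : Loc (HitsLow n m k d) :=
  ⟨_, (RF_finite ..).subset sdiff_subset, dependsOn_hits d⟩

theorem HitsHigh.act {n m k : ℤ} {d : Set (ℤ × ℤ)} {ω : ℤ × ℤ → Bool} (h : HitsHigh n m k d ω) :
    HitsLow n m k d ((symY (2 * n)).act ω) := by
  obtain ⟨r, e, h1, h2, h3, h4, h5, h6⟩ := h
  refine ⟨(r.1, 2 * n - r.2), (e.1, 2 * n - e.2), ?_, h2, by dsimp only; omega,
    by dsimp only; omega, h5, ?_⟩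
  · simp only [cls] at *
    omega
  · refine Relation.ReflTransGen.lift (fun v : ℤ × ℤ => (v.1, 2 * n - v.2)) ?_ _ _ h6
    rintro a b ⟨ha, hs⟩
    refine ⟨fun ha' => ha ?_, ((symY (2 * n)).step hs).mono ?_⟩
    · simp only [rim₂, mem_ofPred_eq, sub_sub_cancel] at ha' ⊢
      exact ha'.symm
    · intro f hf
      simp only [symY, RF, mem_preimage, mem_ofPred_eq, Equiv.coe_fn_mk] at *
      omega

theorem HC.hits {n m k : ℤ} (hn : 0 < n) {d : Set (ℤ × ℤ)}
    (hd : ∀ y, 0 ≤ y → y ≤ n → cls (k + 1) (0, y) → (0, y) ∈ d) {ω : ℤ × ℤ → Bool}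
    (h : HC k 0 m 0 (2 * n) ω) : HitsLow n m k d ω ∨ HitsHigh n m k d ω := by
  obtain ⟨u, v, h1, h2, h3, h4, h5, h6, h7, h8⟩ := h
  have hf : ∀ j, 0 ≤ j → j < n → (0, j) ∈ nbhd n d := by
    intro j hj0 hj
    refine ⟨by simp only [RF, mem_ofPred_eq]; omega, ?_⟩
    by_cases hc : cls (k + 1) (0, j)
    · exact .inl (hd j hj0 hj.le hc)
    · refine .inr (.inr (.inl (hd _ (by omega) (by omega) ?_)))
      simp only [cls] at *
      omega
  have hleft : ∀ y, 0 ≤ y → y ≤ n → (0, y) ∈ rim n d := by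
    intro y hy0 hy
    rcases hy.lt_or_eq with hy | rfl
    · exact ⟨(0, y), hf y hy0 hy, by simp [IsCorner]⟩
    · exact ⟨(0, y - 1), hf _ (by omega) (by omega), by simp [IsCorner]⟩
  have hu : u ∈ rim₂ n d := by
    by_cases hy : u.2 ≤ n
    · have := hleft u.2 h4 hy
      rw [← h2] at this
      exact .inl this
    · refine .inr ?_
      rw [h2]
      exact hleft _ (by omega) (by omega)
  obtain ⟨e, he, hw⟩ := h8.symm.exists_walk hu
  have hv := (Conn.cls h8 k).1 h1
  rcases he with he | he
  · exact .inl ⟨v, e, hv, h3, h6, h7, he, hw⟩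
  · exact .inr ⟨v, e, hv, h3, h6, h7, he, hw⟩

/-- The side of `Z` is the same at two adjacent sites. -/
theorem cnt_edge {Z : List ((ℤ × ℤ) × (ℤ × ℤ))} {k : ℤ} {e o : ℤ × ℤ} (hd : ∀ s ∈ Z, IsDiag s)
    (hcls : ∀ s ∈ Z, cls k s.1 ∧ cls k s.2) (he : ∀ s ∈ Z, s.1 ≠ e ∧ s.2 ≠ e) (hek : cls k e)
    (hok : cls (k + 1) o) (hb : ∀ p : ℤ × ℤ, (p.2 = e.2 ∨ p.2 = o.2) → e.2 ≠ o.2 →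
      e.2 ≤ p.2 → o.2 ≤ p.2 → bdy Z (chi p) = 0)
    (h : (o.2 = e.2 ∧ (o.1 = e.1 + 1 ∨ o.1 = e.1 - 1)) ∨
      (o.1 = e.1 ∧ (o.2 = e.2 + 1 ∨ o.2 = e.2 - 1))) : cnt Z e = cnt Z o := by
  have ho : ∀ s ∈ Z, s.1 ≠ o ∧ s.2 ≠ o := by
    intro s hs
    obtain ⟨h1, h2⟩ := hcls s hs
    constructor <;> rintro rfl <;> simp only [cls] at * <;> omega
  have hface : ∀ x y, ((x, y) = e ∧ (x + 1, y) = o ∨ (x, y) = o ∧ (x + 1, y) = e) →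
      ∀ s ∈ Z, face s ≠ (x, y) := by
    intro x y hxy s hs hf
    have h1 := hd s hs
    have h2 := hcls s hs
    have h3 := he s hs
    obtain ⟨⟨a, b⟩, c, d⟩ := s
    obtain ⟨x', y'⟩ := e
    obtain ⟨x'', y''⟩ := o
    simp only [face, IsDiag, cls, ne_eq, Prod.mk.injEq] at *
    omega
  rcases h with ⟨h1, h2 | h2⟩ | ⟨h1, h2 | h2⟩
  · have hoe : (e.1 + 1, e.2) = o := Prod.ext h2.symm h1.symm
    have := cnt_shift (hface e.1 e.2 (.inl ⟨rfl, hoe⟩))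
    rwa [hoe] at this
  · have hoe : (o.1 + 1, o.2) = e := Prod.ext (by dsimp only; omega) h1
    have := cnt_shift (hface o.1 o.2 (.inr ⟨rfl, hoe⟩))
    rw [hoe] at this
    exact this.symm
  · have h3 := cnt_add_cnt hd ho
    rw [hb o (.inr rfl) (by omega) (by omega) (by omega), CharTwo.add_eq_zero] at h3
    rw [h3]
    congr 1
    exact Prod.ext h1.symm (by dsimp only; omega)
  · have h3 := cnt_add_cnt hd he
    rw [hb e (.inl rfl) (by omega) (by omega) (by omega), CharTwo.add_eq_zero] at h3
    rw [h3]
    congr 1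
    exact Prod.ext h1.symm (by dsimp only; omega)

/-- A path from the right reaching the rim of the explored sites is joined to the vertical
crossing bordering them. -/
theorem HitsLow.join {n m k : ℤ} (hn : 0 < n) (hnm : n ≤ m) {ω : ℤ × ℤ → Bool}
    (hd : ∀ v ∈ explored n k ω, v.1 ≠ n) (h : HitsLow n m k (explored n k ω) ω) :
    Join n m k ω := by
  set d := explored n k ω with hdef
  obtain ⟨r, e, hr0, hr1, hr2, hr3, he, hw⟩ := h
  have hex := hex (a := 0) (b := n) (c := 0) (d := n) hn hn k ω d rfl
  rcases hex with ⟨u, v, hu0, hu1, hv1, hu2, hu3, huv⟩ | ⟨v, hv, hv1⟩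
  swap
  · exact absurd hv1 (hd v hv)
  change Conn (nbhd n d) ω u v at huv
  have hrim : ∀ {s : ℤ × ℤ}, s ∈ rim n d → 0 ≤ s.2 ∧ s.2 ≤ n := by
    rintro s ⟨f, ⟨⟨h1, h2, h3, h4⟩, -⟩, -, h5⟩
    omega
  have hn0 : nbhd n d ⊆ RF 0 n 0 n := inter_subset_left
  suffices hue : Conn (nbhd n d) ω u e by
    refine ⟨u, v, r, hu0, hu1, hv1, hu2, hu3, huv.mono hn0, hr1, ?_⟩
    exact (Conn.mono (hn0.trans (RF_subset le_rfl hnm le_rfl (by omega))) hue).trans hw.conn.symm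
  by_contra hue
  obtain ⟨Z, hZ, hφ⟩ := huv.chain
  set τ : ℤ × ℤ → ℤ × ℤ := fun p => (p.1, 2 * n - p.2) with hτ
  set t₀ : ℤ × ℤ := (u.1 - 1, 2 * n + 1) with ht₀
  set Z₂ := (τ u, t₀) :: (Z ++ Z.map fun s => (τ s.1, τ s.2)) with hZ₂
  have hbdy : ∀ φ, bdy Z₂ φ = φ u + φ t₀ := by
    intro φ
    have h1 := hφ φ
    have h2 := hφ fun p => φ (τ p)
    simp only [bdy, hZ₂, List.map_cons, List.map_append, List.map_map, Function.comp_def,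
      List.sum_cons, List.sum_append, h1, h2]
    have : τ v = v := Prod.ext rfl (by simp only [hτ]; omega)
    rw [this]
    linear_combination (φ (τ u) + φ v) * (CharTwo.two_eq_zero (R := ZMod 2))
  have hu_rim : u ∈ rim n d := by
    rcases Relation.ReflTransGen.cases_head huv with h1 | ⟨c, h1, h2⟩
    · rw [h1] at hu1
      omega
    · exact ⟨_, h1.face_mem, (isCorner_face h1).1⟩
  -- the steps of the closed-up path
  have hcases : ∀ s ∈ Z₂, s = (τ u, t₀) ∨ (∃ s' ∈ Z, s = s' ∨ s = (τ s'.1, τ s'.2)) := by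
    intro s hs
    simp only [hZ₂, List.mem_cons, List.mem_append, List.mem_map] at hs
    rcases hs with h | h | ⟨s', h, h'⟩
    · exact .inl h
    · exact .inr ⟨s, h, .inl rfl⟩
    · exact .inr ⟨s', h, .inr h'.symm⟩
  have hdiag : ∀ s ∈ Z₂, IsDiag s := by
    intro s hs
    rcases hcases s hs with rfl | ⟨s', h1, rfl | rfl⟩
    · simp only [IsDiag, hτ, ht₀]
      exact ⟨.inr trivial, by omega⟩
    · exact (hZ _ h1).1.isDiag
    · have := (hZ _ h1).1.isDiag
      simp only [IsDiag, hτ] at *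
      omega
  have hZcls : ∀ s ∈ Z, cls k s.1 ∧ cls k s.2 := by
    intro s hs
    have h1 := (Conn.cls (hZ s hs).2 k).1 hu0
    exact ⟨h1, ((hZ s hs).1.cls k).1 h1⟩
  have hcls : ∀ s ∈ Z₂, cls k s.1 ∧ cls k s.2 := by
    intro s hs
    rcases hcases s hs with rfl | ⟨s', h1, rfl | rfl⟩
    · simp only [cls, hτ, ht₀] at *
      omega
    · exact hZcls _ h1
    · have := hZcls _ h1
      simp only [cls, hτ] at *
      omega
  have hface : ∀ s ∈ Z₂, face s ∈ nbhd n d ∨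
      ((face s).1, 2 * n - 1 - (face s).2) ∈ nbhd n d ∨ face s = (u.1 - 1, 2 * n) := by
    intro s hs
    rcases hcases s hs with rfl | ⟨s', h1, rfl | rfl⟩
    · refine .inr (.inr ?_)
      simp only [face, hτ, ht₀, Prod.mk.injEq]
      omega
    · exact .inl (hZ _ h1).1.face_mem
    · refine .inr (.inl ?_)
      have h2 := (hZ _ h1).1.face_mem
      have h3 := (hZ _ h1).1.coord
      convert h2 using 1
      simp only [face, hτ, Prod.mk.injEq, true_and]
      omega
  have hend : ∀ s ∈ Z₂, (s.1 ∈ rim₂ n d ∨ s.1 = t₀) ∧ (s.2 ∈ rim₂ n d ∨ s.2 = t₀) := by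
    intro s hs
    rcases hcases s hs with rfl | ⟨s', h1, rfl | rfl⟩
    · refine ⟨.inl (.inr ?_), .inr rfl⟩
      simpa [hτ] using hu_rim
    · have h2 := (hZ _ h1).1
      exact ⟨.inl (.inl ⟨_, h2.face_mem, (isCorner_face h2).1⟩),
        .inl (.inl ⟨_, h2.face_mem, (isCorner_face h2).2⟩)⟩
    · have h2 := (hZ _ h1).1
      refine ⟨.inl (.inr ?_), .inl (.inr ?_)⟩
      · have h3 : s'.1 ∈ rim n d := ⟨_, h2.face_mem, (isCorner_face h2).1⟩
        simpa only [hτ, sub_sub_cancel] using h3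
      · have h3 : s'.2 ∈ rim n d := ⟨_, h2.face_mem, (isCorner_face h2).2⟩
        simpa only [hτ, sub_sub_cancel] using h3
  have he2 := hrim he
  have hZe : ∀ s ∈ Z, (s.1 ≠ e ∧ τ s.1 ≠ e) ∧ s.2 ≠ e ∧ τ s.2 ≠ e := by
    intro s hs
    obtain ⟨h1, h2⟩ := hZ s hs
    have h3 := h2.tail h1
    have a1 := hrim (⟨_, h1.face_mem, (isCorner_face h1).1⟩ : s.1 ∈ rim n d)
    have a2 := hrim (⟨_, h1.face_mem, (isCorner_face h1).2⟩ : s.2 ∈ rim n d)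
    refine ⟨⟨fun h => hue (h ▸ h2), fun h => hue ?_⟩, fun h => hue (h ▸ h3), fun h => hue ?_⟩
    · have : s.1 = e := by
        rw [← h] at he2 ⊢
        simp only [hτ] at he2 ⊢
        exact Prod.ext rfl (by dsimp only; omega)
      exact this ▸ h2
    · have : s.2 = e := by
        rw [← h] at he2 ⊢
        simp only [hτ] at he2 ⊢
        exact Prod.ext rfl (by dsimp only; omega)
      exact this ▸ h3
  have hene : ∀ s ∈ Z₂, s.1 ≠ e ∧ s.2 ≠ e := by
    intro s hs
    rcases hcases s hs with rfl | ⟨s', h1, rfl | rfl⟩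
    · constructor <;> intro h <;> rw [← h] at he2 <;> simp only [hτ, ht₀] at he2 <;> omega
    · exact ⟨(hZe _ h1).1.1, (hZe _ h1).2.1⟩
    · exact ⟨(hZe _ h1).1.2, (hZe _ h1).2.2⟩
  have hchi : ∀ p : ℤ × ℤ, 1 ≤ p.2 → p.2 ≤ 2 * n → bdy Z₂ (chi p) = 0 := by
    intro p h1 h2
    rw [hbdy, chi, chi, b2_neg, b2_neg, add_zero]
    · simp only [ht₀]
      omega
    · omega
  -- no crossing on the way from `r` to `e`
  have hre : cnt Z₂ r = cnt Z₂ e := by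
    suffices key : ∀ r, Walk (RF 0 m 0 (2 * n)) (rim₂ n d) ω r e →
        (∀ s ∈ Z₂, s.1 ≠ r ∧ s.2 ≠ r) ∧ cnt Z₂ r = cnt Z₂ e from (key r hw).2
    intro r hw
    induction hw using Relation.ReflTransGen.head_induction_on with
    | refl => exact ⟨hene, rfl⟩
    | @head a b h1 h2 ih =>
      obtain ⟨h3, h4⟩ := h1
      have h5 := h4.face_mem
      have h6 := face_notMem h4 h3
      have h7 := h4.coord
      have ha : ∀ s ∈ Z₂, s.1 ≠ a ∧ s.2 ≠ a := by
        have hat : a ≠ t₀ := by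
          rintro rfl
          simp only [face, RF, mem_ofPred_eq, ht₀] at *
          omega
        intro s hs
        obtain ⟨h8, h9⟩ := hend s hs
        constructor <;> rintro rfl
        · exact h8.elim h3 hat
        · exact h9.elim h3 hat
      refine ⟨ha, ?_⟩
      rw [← ih.2]
      refine cnt_eq_of_step hdiag h4 (fun s hs hfs => ?_) ha ih.1 fun p _ hp => hchi p ?_ ?_
      · rcases hface s hs with h | h | h
        · exact h6.1 (hfs ▸ h)
        · exact h6.2 (hfs ▸ h)
        · rw [← hfs, h] at h5
          simp only [RF, mem_ofPred_eq] at h5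
          omega
      · have := h5.2.2.1
        omega
      · have := h5.2.2.2
        omega
  have hr : cnt Z₂ r = 0 := by
    refine cnt_eq_zero r fun s hs _ => ?_
    rcases hface s hs with h | h | h
    · have := (hn0 h).2.1
      omega
    · have := (hn0 h).2.1
      dsimp only at this
      omega
    · rw [h]
      dsimp only
      omega
  -- from `e` to the left side
  obtain ⟨f, hf, hfe⟩ := id he
  obtain ⟨o, ho, hfo⟩ := exists_corner_of_mem_touch hf.2
  obtain ⟨l, hl0, hl1, hl2, hl3, hlo⟩ := id ho
  have hok := (Conn.cls hlo _).1 hl0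
  have hek := (Conn.cls hw.conn k).1 hr0
  have hoy := hlo.mem_rect ⟨by omega, by omega, hl2, hl3⟩
  have heo : cnt Z₂ e = cnt Z₂ o := by
    have h1 := hf.1
    refine cnt_edge hdiag hcls hene hek hok (fun p h2 h3 h4 h5 => hchi p ?_ ?_) ?_ <;>
      simp only [IsCorner, cls, RF, mem_ofPred_eq] at * <;> omega
  have hlo' : cnt Z₂ o = cnt Z₂ l := by
    refine hlo.induct (p := fun w => cnt Z₂ w = cnt Z₂ l) rfl fun w w' h1 h2 ih => ?_
    have hwk := (Conn.cls h1 _).1 hl0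
    have hwk' := (h2.cls _).1 hwk
    have hne : ∀ {x}, cls (k + 1) x → ∀ s ∈ Z₂, s.1 ≠ x ∧ s.2 ≠ x := by
      intro x hx s hs
      have := hcls s hs
      constructor <;> rintro rfl <;> simp only [cls] at * <;> omega
    have hfm := h2.face_mem
    rw [← ih]
    refine (cnt_eq_of_step hdiag h2 (fun s hs hfs => ?_) (hne hwk) (hne hwk')
      fun p _ hp => hchi p ?_ ?_).symm
    · rcases hcases s hs with rfl | ⟨s', h3, rfl | rfl⟩
      · have := (hface _ hs)
        rw [← hfs] at hfm
        simp only [face, hτ, ht₀, RF, mem_ofPred_eq] at hfm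
        omega
      · have h4 := hZcls _ h3
        have := (hZ _ h3).1.eq_of_face h2 hfs
        simp only [cls] at *
        rcases this with h | h <;> rw [h.1] at hwk <;> omega
      · have h4 := hn0 (hZ _ h3).1.face_mem
        have h5 := (hZ _ h3).1.coord
        rw [← hfs] at hfm
        simp only [face, hτ, RF, mem_ofPred_eq] at hfm h4
        omega
    · have := hfm.2.2.1
      omega
    · have := hfm.2.2.2
      omega
  have hl : cnt Z₂ l = 1 := by
    rw [bdy_row hdiag, hbdy, b2_pos, b2_neg, add_zero]
    · simp only [ht₀]
      omega
    · omega
    · intro s hs hsl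
      rcases hface s hs with h | h | h
      · have := (hn0 h).1
        omega
      · have := (hn0 h).1
        dsimp only at this
        omega
      · rw [h] at hsl
        dsimp only at hsl
        omega
  have : (1 : ZMod 2) = 0 := by rw [← hl, ← hlo', ← heo, ← hre, hr]
  exact one_ne_zero this

theorem loc_explored_eq (n k : ℤ) (d : Set (ℤ × ℤ)) : Loc (fun ω => explored n k ω = d) :=
  ⟨nbhd n d, (RF_finite ..).subset inter_subset_left, dependsOn_explored_eq n k d⟩

theorem incE_join {n m k : ℤ} : IncE (ori k) (Join n m k) := by
  rintro ω ω' h ⟨u, v, r, h0, h1, h2, h3, h4, h5, h6, h7⟩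
  exact ⟨u, v, r, h0, h1, h2, h3, h4, Conn.inc h5 h0 h, h6, Conn.inc h7 h0 h⟩

theorem loc_join {n m k : ℤ} (hn : 0 < n) (hnm : n ≤ m) : Loc (Join n m k) := by
  refine ⟨RF 0 m 0 (2 * n), RF_finite .., ?_⟩
  apply dependsOn_of_imp
  rintro ω ω' h ⟨u, v, r, h0, h1, h2, h3, h4, h5, h6, h7⟩
  exact ⟨u, v, r, h0, h1, h2, h3, h4,
    h5.congr fun f hf => h f (RF_subset le_rfl hnm le_rfl (by omega) hf), h6, h7.congr h⟩

theorem Pr_join_ge {n m : ℤ} (hn : n % 2 = 1) (hn0 : 0 < n) (hnm : n ≤ m) (k : ℤ) :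
    1 / 4 * Pr half (HC k 0 m 0 (2 * n)) ≤ Pr half (Join n m k) := by
  classical
  set R : Set (ℤ × ℤ) := Icc 0 n ×ˢ Icc 0 n with hR
  have hRf : R.Finite := (finite_Icc 0 n).prod (finite_Icc 0 n)
  have hXR : ∀ ω, explored n k ω ⊆ R := by
    rintro ω v ⟨u, h1, h2, h3, h4, h5⟩
    obtain ⟨g1, g2, g3, g4⟩ := h5.mem_rect ⟨by omega, by omega, h3, h4⟩
    exact ⟨⟨g1, g2⟩, g3, g4⟩
  set S : Finset (Set (ℤ × ℤ)) := hRf.finite_subsets.toFinset.filter fun d => ∀ v ∈ d, v.1 ≠ n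
    with hS
  have hXS : ∀ ω, (∀ v ∈ explored n k ω, v.1 ≠ n) → explored n k ω ∈ S := by
    intro ω h
    simp only [hS, Finset.mem_filter, Finite.mem_toFinset, mem_ofPred_eq]
    exact ⟨hXR ω, h⟩
  have hX : Loc (explored n k) := ⟨_, RF_finite .., dependsOn_explored n k⟩
  have hA : Loc (fun ω => ∀ v ∈ explored n k ω, v.1 ≠ n) := hX.comp fun d => ∀ v ∈ d, v.1 ≠ n
  have hJ := loc_join (k := k) hn0 hnm
  have hH := loc_HC k 0 m 0 (2 * n)
  have hA2 : 1 / 2 ≤ Pr half fun ω => ∀ v ∈ explored n k ω, v.1 ≠ n := by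
    have h1 := Pr_half_square hn hn0 (k + 1)
    have h2 := Pr_not half (loc_HC (k + 1) 0 n 0 n)
    have h3 : Pr half (fun ω => ¬ HC (k + 1) 0 n 0 n ω) ≤
        Pr half fun ω => ∀ v ∈ explored n k ω, v.1 ≠ n := by
      refine Pr_mono isProb_half (loc_HC ..).not hA fun ω h v hv hvn => h ?_
      have hv' := hXR ω hv
      obtain ⟨u, g1, g2, g3, g4, g5⟩ := hv
      exact ⟨u, v, g1, g2, hvn, g3, g4, hv'.2.1, hv'.2.2, g5⟩
    linarith
  have hsum : Pr half (fun ω => ∀ v ∈ explored n k ω, v.1 ≠ n) ≤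
      ∑ d ∈ S, Pr half (fun ω => explored n k ω = d) := by
    rw [Pr_partition half hX hA S hXS]
    exact Finset.sum_le_sum fun d hd => Pr_mono isProb_half ((loc_explored_eq n k d).and hA)
      (loc_explored_eq n k d) fun ω h => h.1
  have hterm : ∀ d ∈ S, Pr half (fun ω => explored n k ω = d) * (1 / 2 * Pr half (HC k 0 m 0 (2 * n)))
      ≤ Pr half fun ω => explored n k ω = d ∧ (∀ v ∈ explored n k ω, v.1 ≠ n) ∧ Join n m k ω := by
    intro d hd
    have hd' : ∀ v ∈ d, v.1 ≠ n := by
      simp only [hS, Finset.mem_filter] at hd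
      exact hd.2
    by_cases hl : ∀ y, 0 ≤ y → y ≤ n → cls (k + 1) (0, y) → (0, y) ∈ d
    · have h1 : Pr half (HC k 0 m 0 (2 * n)) ≤
          Pr half (HitsLow n m k d) + Pr half (HitsHigh n m k d) :=
        (Pr_mono isProb_half hH ((loc_hitsLow d).or (loc_hitsHigh d))
          fun ω h => h.hits hn0 hl).trans (Pr_or_le isProb_half (loc_hitsLow d) (loc_hitsHigh d))
      have h2 : Pr half (HitsHigh n m k d) ≤ Pr half (HitsLow n m k d) :=
        (symY (2 * n)).Pr_half_le (loc_hitsHigh d) (loc_hitsLow d) fun ω h => h.act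
      calc _ ≤ Pr half (fun ω => explored n k ω = d) * Pr half (HitsLow n m k d) :=
            mul_le_mul_of_nonneg_left (by linarith) (Pr_nonneg isProb_half (loc_explored_eq n k d))
        _ = Pr half (fun ω => explored n k ω = d ∧ HitsLow n m k d ω) :=
            (Pr_indep half ((RF_finite ..).subset inter_subset_left)
              ((RF_finite ..).subset sdiff_subset) (dependsOn_explored_eq n k d)
              (dependsOn_hits d) disjoint_sdiff_right).symm
        _ ≤ _ := by
            refine Pr_mono isProb_half ((loc_explored_eq n k d).and (loc_hitsLow d))
              ((loc_explored_eq n k d).and (hA.and hJ)) ?_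
            rintro ω ⟨rfl, h⟩
            exact ⟨rfl, hd', h.join hn0 hnm hd'⟩
    · have h0 : Pr half (fun ω => explored n k ω = d) = 0 := by
        refine Pr_false half ?_
        rintro ω rfl
        exact hl fun y h1 h2 h3 => ⟨(0, y), h3, rfl, h1, h2, .refl⟩
      rw [h0, zero_mul]
      exact Pr_nonneg isProb_half ((loc_explored_eq n k d).and (hA.and hJ))
  have hfin : Pr half (fun ω => (∀ v ∈ explored n k ω, v.1 ≠ n) ∧ Join n m k ω) ≤
      Pr half (Join n m k) := Pr_mono isProb_half (hA.and hJ) hJ fun ω h => h.2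
  rw [Pr_partition half hX (hA.and hJ) S fun ω h => hXS ω h.1] at hfin
  have h1 := Finset.sum_le_sum hterm
  rw [← Finset.sum_mul] at h1
  have h2 := Pr_nonneg isProb_half hH
  nlinarith [mul_le_mul_of_nonneg_right (hA2.trans hsum) (mul_nonneg one_half_pos.le h2)]

/-- The reflection of `Join`. -/
def JoinLeft (n m k : ℤ) (ω : ℤ × ℤ → Bool) : Prop :=
  ∃ u v r, cls k u ∧ u.2 = 0 ∧ v.2 = n ∧ 0 ≤ u.1 ∧ u.1 ≤ n ∧ Conn (RF 0 n 0 n) ω u v ∧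
    r.1 = n - m ∧ Conn (RF (n - m) n 0 (2 * n)) ω u r

theorem incE_joinLeft {n m k : ℤ} : IncE (ori k) (JoinLeft n m k) := by
  rintro ω ω' h ⟨u, v, r, h0, h1, h2, h3, h4, h5, h6, h7⟩
  exact ⟨u, v, r, h0, h1, h2, h3, h4, Conn.inc h5 h0 h, h6, Conn.inc h7 h0 h⟩

theorem loc_joinLeft {n m k : ℤ} (hn : 0 < n) (hnm : n ≤ m) : Loc (JoinLeft n m k) := by
  refine ⟨RF (n - m) n 0 (2 * n), RF_finite .., ?_⟩
  apply dependsOn_of_imp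
  rintro ω ω' h ⟨u, v, r, h0, h1, h2, h3, h4, h5, h6, h7⟩
  exact ⟨u, v, r, h0, h1, h2, h3, h4,
    h5.congr fun f hf => h f (RF_subset (by omega) le_rfl le_rfl (by omega) hf), h6, h7.congr h⟩

theorem Join.act {n m k : ℤ} (hn : n % 2 = 1) {ω : ℤ × ℤ → Bool} (h : Join n m (k + 1) ω) :
    JoinLeft n m k ((symX n).act ω) := by
  obtain ⟨u, v, r, h0, h1, h2, h3, h4, h5, h6, h7⟩ := h
  refine ⟨(n - u.1, u.2), (n - v.1, v.2), (n - r.1, r.2), ?_, h1, h2, by dsimp only; omega,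
    by dsimp only; omega, (symX n).conn_of_subset h5 fun f hf => ?_, by dsimp only; omega,
    (symX n).conn_of_subset h7 fun f hf => ?_⟩
  · simp only [cls] at *
    omega
  · simp only [symX, RF, mem_ofPred_eq, Equiv.coe_fn_mk] at *
    omega
  · simp only [symX, RF, mem_ofPred_eq, Equiv.coe_fn_mk] at *
    omega

theorem HC.of_joins {n m k : ℤ} (hn : 0 < n) (hnm : n ≤ m) {ω : ℤ × ℤ → Bool}
    (h : HC k 0 n 0 n ω) (hr : Join n m k ω) (hl : JoinLeft n m k ω) :
    HC k (n - m) m 0 (2 * n) ω := by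
  obtain ⟨l, r, a1, a2, a3, a4, a5, a6, a7, a8⟩ := h
  obtain ⟨u, v, t, b1, b2, b3, b4, b5, b6, b7, b8⟩ := hr
  obtain ⟨u', v', t', c1, c2, c3, c4, c5, c6, c7, c8⟩ := hl
  obtain ⟨w, d1, d2⟩ := exists_common (a := 0) (b := n) (y₀ := 0) (y₁ := n)
    (fun f hf => ⟨hf.1, hf.2.1⟩) (fun f hf => hf.2.2) b6 a8 b2.le b3.ge
    (b6.mem_rect (by omega)).1 (b6.mem_rect (by omega)).2.1 a4 a5 a2.le a3.ge
  obtain ⟨w', e1, e2⟩ := exists_common (a := 0) (b := n) (y₀ := 0) (y₁ := n)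
    (fun f hf => ⟨hf.1, hf.2.1⟩) (fun f hf => hf.2.2) c6 a8 c2.le c3.ge
    (c6.mem_rect (by omega)).1 (c6.mem_rect (by omega)).2.1 a4 a5 a2.le a3.ge
  have s1 : RF 0 n 0 n ⊆ RF (n - m) m 0 (2 * n) := RF_subset (by omega) hnm le_rfl (by omega)
  have s2 : RF 0 m 0 (2 * n) ⊆ RF (n - m) m 0 (2 * n) :=
    RF_subset (by omega) le_rfl le_rfl le_rfl
  have s3 : RF (n - m) n 0 (2 * n) ⊆ RF (n - m) m 0 (2 * n) := RF_subset le_rfl hnm le_rfl le_rfl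
  have ht := b8.mem_rect (by omega)
  have ht' := c8.mem_rect (by omega)
  refine ⟨t', t, (Conn.cls c8 k).1 c1, c7, b7, by omega, by omega, by omega, by omega, ?_⟩
  exact (Conn.mono s3 c8).symm.trans <| (Conn.mono s1 e1).trans <| (Conn.mono s1 e2).symm.trans <|
    (Conn.mono s1 d2).trans <| (Conn.mono s1 d1).symm.trans (Conn.mono s2 b8)

/-- Russo–Seymour–Welsh, one step. -/
theorem rsw_step {n L : ℤ} (hn : n % 2 = 1) (hn0 : 0 < n) (hL : n ≤ L) {δ : ℝ} (hδ : 0 ≤ δ)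
    (h : ∀ c, δ ≤ Pr half (HC c 0 L 0 (2 * n))) (c : ℤ) :
    δ ^ 2 / 32 ≤ Pr half (HC c 0 (2 * L - n) 0 (2 * n)) := by
  obtain ⟨k, rfl⟩ : ∃ k, c = k + (L - n) + 0 := ⟨c - (L - n), by ring⟩
  have hJ := loc_join (k := k) hn0 hL
  have hJ' := loc_joinLeft (k := k) hn0 hL
  have hH := loc_HC k 0 n 0 n
  have h1 := Pr_join_ge hn hn0 hL k
  have h2 := Pr_join_ge hn hn0 hL (k + 1)
  have h3 : Pr half (Join n L (k + 1)) ≤ Pr half (JoinLeft n L k) :=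
    (symX n).Pr_half_le (loc_join hn0 hL) hJ' fun ω h => h.act hn
  have h4 := Pr_half_square hn hn0 k
  have h5 := Pr_harris isProb_half incE_join incE_joinLeft hJ hJ'
  have h6 := Pr_harris isProb_half (incE_HC k 0 n 0 n) (B := fun ω => Join n L k ω ∧ JoinLeft n L k ω)
    (fun ω ω' h hω => ⟨incE_join ω ω' h hω.1, incE_joinLeft ω ω' h hω.2⟩) hH (hJ.and hJ')
  have h7 : Pr half (fun ω => HC k 0 n 0 n ω ∧ Join n L k ω ∧ JoinLeft n L k ω) ≤
      Pr half (HC (k + (L - n) + 0) 0 (2 * L - n) 0 (2 * n)) := by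
    refine (symS (L - n) 0).Pr_half_le (hH.and (hJ.and hJ')) (loc_HC ..) fun ω h => ?_
    have := (h.1.of_joins hn0 hL h.2.1 h.2.2).act_symS (L - n) 0
    rwa [show n - L + (L - n) = 0 by ring, show L + (L - n) = 2 * L - n by ring, zero_add,
      add_zero (2 * n)] at this
  have h8 := h k
  have h9 := h (k + 1)
  have h10 : 1 / 4 * δ * (1 / 4 * δ) ≤ Pr half (Join n L k) * Pr half (JoinLeft n L k) :=
    mul_le_mul (by linarith) (by linarith) (by positivity) (Pr_nonneg isProb_half hJ)
  rw [h4] at h6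
  nlinarith

theorem rsw_pow (j : ℕ) : ∃ δ : ℝ, 0 < δ ∧ ∀ n : ℤ, n % 2 = 1 → 0 < n → ∀ c,
    δ ≤ Pr half (HC c 0 (n + 2 ^ j * (n - 1)) 0 (2 * n)) := by
  induction j with
  | zero =>
    refine ⟨1 / 2, by norm_num, fun n hn hn0 c => ?_⟩
    rw [← Pr_half_square (n := 2 * n - 1) (by omega) (by omega) c]
    refine Pr_mono isProb_half (loc_HC ..) (loc_HC ..) ?_
    rintro ω ⟨u, v, h1, h2, h3, h4, h5, h6, h7, h8⟩
    exact ⟨u, v, h1, h2, by rw [h3]; ring, h4, by omega, h6, by omega,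
      h8.mono (RF_subset le_rfl (by linarith) le_rfl (by omega))⟩
  | succ j ih =>
    obtain ⟨δ, hδ, h⟩ := ih
    refine ⟨δ ^ 2 / 32, by positivity, fun n hn hn0 c => ?_⟩
    have h2 : (0 : ℤ) ≤ 2 ^ j * (n - 1) := mul_nonneg (by positivity) (by omega)
    have := rsw_step hn hn0 (by omega) hδ.le (h n hn hn0) c
    rwa [show 2 * (n + 2 ^ j * (n - 1)) - n = n + 2 ^ (j + 1) * (n - 1) by ring] at this

theorem VC.trunc {k a b c d d' : ℤ} {ω : ℤ × ℤ → Bool} (h : VC k a b c d ω) (h1 : c ≤ d')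
    (h2 : d' ≤ d) : VC k a b c d' ω := by
  obtain ⟨u, v, g1, g2, g3, g4, g5, g6, g7, g8⟩ := h
  obtain ⟨w, hw, hc⟩ := g8.first_level (h := d') (by omega) (by omega)
  have hc' : Conn (RF a b c d') ω u w :=
    Conn.mono (show RF a b c d ∩ {f | f.2 < d'} ⊆ RF a b c d' from
      fun f hf => ⟨hf.1.1, hf.1.2.1, hf.1.2.2.1, hf.2⟩) hc
  have := hc'.mem_rect (by omega)
  exact ⟨u, w, g1, g2, hw, g4, g5, this.1, this.2.1, hc'⟩

/-- Russo–Seymour–Welsh for the fair configuration. -/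
theorem rsw (K : ℕ) : ∃ δ : ℝ, 0 < δ ∧ ∀ N : ℤ, 8 ≤ N → ∀ c, δ ≤ Pr half (HC c 0 (K * N) 0 N) := by
  obtain ⟨δ, hδ, h⟩ := rsw_pow (8 * K)
  refine ⟨δ, hδ, fun N hN c => ?_⟩
  obtain ⟨n, hn, hn1, hn2⟩ : ∃ n : ℤ, n % 2 = 1 ∧ 2 * n ≤ N ∧ N ≤ 8 * (n - 1) := by
    rcases Int.emod_two_eq_zero_or_one (N / 2) with h | h
    · exact ⟨N / 2 - 1, by omega, by omega, by omega⟩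
    · exact ⟨N / 2, by omega, by omega, by omega⟩
  have hKN : (K : ℤ) * N ≤ n + 2 ^ (8 * K) * (n - 1) := by
    have h1 : ((8 * K : ℕ) : ℤ) ≤ 2 ^ (8 * K) := by exact_mod_cast (Nat.lt_two_pow_self).le
    push_cast at h1
    nlinarith
  have h1 : Pr half (HC c 0 (n + 2 ^ (8 * K) * (n - 1)) 0 (2 * n)) ≤ Pr half (VC c 0 N 0 (K * N)) := by
    refine symT.Pr_half_le (loc_HC ..) (loc_VC ..) fun ω h => ?_
    obtain ⟨u, v, g1, g2, g3, g4, g5, g6, g7, g8⟩ := h.act_symT.trunc (by positivity) hKN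
    exact ⟨u, v, g1, g2, g3, g4, by omega, g6, by omega,
      Conn.mono (RF_subset le_rfl hn1 le_rfl le_rfl) g8⟩
  exact ((h n hn (by omega) c).trans h1).trans
    (symT.Pr_half_le (loc_VC ..) (loc_HC ..) fun ω h => h.act_symT)

theorem Pr_shift (q : ℤ → ℝ) (s t : ℤ) {A : (ℤ × ℤ → Bool) → Prop} (hA : Loc A) :
    Pr (rows q) (fun ω => A ((symS s t).act ω)) = Pr (rows fun j => q (j - t)) A :=
  (symS s t).Pr_act (rows q) hA

theorem SV.toVC {A h : ℤ} (hh : 0 < h) {ω : ℤ × ℤ → Bool} (hs : SV 0 0 h (Trap A h) ω) :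
    VC 0 (-A) A 0 h ω := by
  obtain ⟨u, v, h1, h2, h3, h4⟩ := hs
  have hu : -A ≤ u.1 ∧ u.1 ≤ A := by
    rcases Relation.ReflTransGen.cases_head h4 with g1 | ⟨c, g1, g2⟩
    · rw [g1] at h2
      omega
    · have g3 := Trap_subset_RF A h g1.face_mem
      have g4 := (isCorner_face g1).1.1
      obtain ⟨g5, g6, -⟩ := g3
      omega
  have hc : Conn (RF (-A) A 0 h) ω u v := Conn.mono (Trap_subset_RF A h) h4
  have hv := hc.mem_rect (by omega)
  exact ⟨u, v, h1, h2, h3, hu.1, hu.2, hv.1, hv.2.1, hc⟩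

theorem VC.wider {k a b a' b' c d : ℤ} (ha : a' ≤ a) (hb : b ≤ b') {ω : ℤ × ℤ → Bool}
    (h : VC k a b c d ω) : VC k a' b' c d ω := by
  obtain ⟨u, v, h1, h2, h3, h4, h5, h6, h7, h8⟩ := h
  exact ⟨u, v, h1, h2, h3, by omega, by omega, by omega, by omega,
    h8.mono (RF_subset ha hb le_rfl le_rfl)⟩

theorem VC_congr_cls {k k' : ℤ} (hk : (k - k') % 2 = 0) (a b c d : ℤ) :
    VC k a b c d = VC k' a b c d := by
  funext ω
  refine propext (exists₂_congr fun u v => and_congr_left fun _ => ?_)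
  simp only [cls]
  omega

/-- Vertical crossings of wide rectangles. -/
theorem Pr_VC_ge {q : ℤ → ℝ} (hq : ∀ j, 0 < q j ∧ q j < 1) {n : ℤ} (hn : 2 ≤ n) (c x y : ℤ) :
    1 / 2 ≤ Pr (rows q) (VC c x (x + 14 * n) y (y + n)) := by
  obtain ⟨s, hs1, hs2, hs3⟩ : ∃ s, x + 6 * n + 1 ≤ s ∧ s ≤ x + 8 * n - 1 ∧ (s + y - c) % 2 = 0 := by
    rcases Int.emod_two_eq_zero_or_one (x + 6 * n + 1 + y - c) with h | h
    · exact ⟨x + 6 * n + 1, by omega, by omega, h⟩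
    · exact ⟨x + 6 * n + 2, by omega, by omega, by omega⟩
  obtain ⟨m, hm, hm1, hm2⟩ : ∃ m, m % 2 = 1 ∧ n ≤ m ∧ m ≤ n + 1 := by
    rcases Int.emod_two_eq_zero_or_one n with h | h
    · exact ⟨n + 1, by omega, by omega, by omega⟩
    · exact ⟨n, by omega, by omega, by omega⟩
  have hq' : ∀ j, 0 < q (j + y) ∧ q (j + y) < 1 := fun j => hq _
  have h1 : 1 / 2 ≤ trapPr (2 * n + 1) n fun _ => 1 / 2 := by
    have g1 := Pr_half_square hm (by omega) 1
    have g2 := Pr_VC_add_HC (p := half) (a := 0) (b := m) (c := 0) (d := m) (by omega) (by omega) 0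
    rw [zero_add, g1] at g2
    have g3 : Pr half (VC 0 0 m 0 m) ≤ trapPr (2 * n + 1) n fun _ => 1 / 2 := by
      refine Pr_mono isProb_half (loc_VC ..) (loc_SV (Trap_finite ..)) fun ω h => ?_
      obtain ⟨u, v, e1, e2, e3, e4, e5, e6, e7, e8⟩ := h.trunc (d' := n) (by omega) hm1
      refine ⟨u, v, e1, e2, e3, Conn.mono (fun f hf => ?_) e8⟩
      simp only [RF, Trap, mem_ofPred_eq] at *
      omega
    linarith
  have h2 : trapPr (2 * n + 1) n (fun _ => 1 / 2) ≤ trapPr (6 * n + 1) n fun j => q (j + y) := by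
    have := trapPr_compare (C := 1) one_pos (z := 1 / 4) le_rfl (fun q h1 h2 x h => ?_)
      (q := fun _ => 1 / 2) (t := fun j => q (j + y)) (by norm_num) hq' (by norm_num)
      (A := 2 * n + 1) (by omega) n.toNat
    · rw [Nat.cast_one, one_mul, Int.toNat_of_nonneg (by omega)] at this
      rwa [show 6 * n + 1 = 2 * n + 1 + 4 * n by ring]
    · have := Pr_arch h1 h2 1 x h
      norm_num at this ⊢
      linarith
  have h3 : trapPr (6 * n + 1) n (fun j => q (j + y)) ≤
      Pr (rows q) (VC c x (x + 14 * n) y (y + n)) := by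
    have e1 : (fun j => q (j - y + y)) = q := by simp
    have e2 := Pr_shift (fun j => q (j + y)) s y (loc_VC c x (x + 14 * n) y (y + n))
    rw [e1] at e2
    rw [← e2]
    refine Pr_mono (fun f => ⟨(hq' _).1.le, (hq' _).2.le⟩) (loc_SV (Trap_finite ..))
      ((symS s y).loc (loc_VC ..)) fun ω h => ?_
    have := (h.toVC (by omega)).act_symS s y
    rw [VC_congr_cls (k' := c) (by omega), zero_add, add_comm n y] at this
    exact this.wider (by omega) (by omega)
  linarith

/-- Horizontal crossings of long rectangles. -/
theorem Pr_HC_ge {z : ℝ} (hz : 0 < z) {K : ℕ} (hK : 0 < K) : ∃ δ : ℝ, 0 < δ ∧ ∃ n₀ : ℤ, ∀ q : ℤ → ℝ,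
    (∀ j, 0 < q j ∧ q j < 1) → (∀ j, z ≤ q j * (1 - q j)) → ∀ n, n₀ ≤ n → ∀ c x y,
      δ ≤ Pr (rows q) (HC c x (x + K * n) y (y + n)) := by
  obtain ⟨C, hC, harch⟩ := exists_arch hz
  obtain ⟨δ, hδ, hrsw⟩ := rsw (4 * C * (K + 1) + 12)
  refine ⟨δ, hδ, 8 * C, fun q hq hzq n hn c x y => ?_⟩
  have hz4 : z ≤ 1 / 4 := (hzq 0).trans (by nlinarith [sq_nonneg (q 0 - 1 / 2)])
  have hC' : (0 : ℤ) < C := by exact_mod_cast hC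
  have hn0 : 0 < n := by omega
  set m := n / C with hm
  have hm8 : 8 ≤ m := by rw [hm, Int.le_ediv_iff_mul_le hC']; exact hn
  have hm1 : C * m ≤ n := Int.mul_ediv_self_le hC'.ne'
  have hm2 : n < C * m + C := by
    have := Int.lt_ediv_add_one_mul_self n hC'
    rw [← hm] at this
    linarith
  have hKn : 0 < (K : ℤ) * n := by positivity
  obtain ⟨i, hi, hi1, hi2⟩ : ∃ i : ℤ, (c + 1 + (-x + i) + -y) % 2 = 0 ∧ 0 ≤ i ∧ i ≤ 1 := by
    rcases Int.emod_two_eq_zero_or_one (c + 1 - x - y) with h | h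
    · exact ⟨0, by omega, by omega, by omega⟩
    · exact ⟨1, by omega, by omega, by omega⟩
  obtain ⟨A, hA, hA1, hA2⟩ : ∃ A, A % 2 = 1 ∧ K * n + n + 1 ≤ A ∧ A ≤ K * n + n + 2 := by
    rcases Int.emod_two_eq_zero_or_one (K * n + n + 1) with h | h
    · exact ⟨K * n + n + 2, by omega, by omega, by omega⟩
    · exact ⟨K * n + n + 1, by omega, by omega, by omega⟩
  set q' : ℤ → ℝ := fun j => q (j - -y) with hq'
  have h1 : Pr (rows q) (VC (c + 1) x (x + K * n) y (y + n)) ≤ trapPr A n q' := by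
    rw [trapPr, ← Pr_shift q (-x + i) (-y) (loc_SV (Trap_finite ..))]
    refine Pr_mono (fun f => ⟨(hq _).1.le, (hq _).2.le⟩) (loc_VC ..)
      ((symS _ _).loc (loc_SV (Trap_finite ..))) fun ω h => ?_
    have := h.act_symS (-x + i) (-y)
    rw [VC_congr_cls (k' := 0) (by omega)] at this
    obtain ⟨u, v, e1, e2, e3, e4, e5, e6, e7, e8⟩ := this
    refine ⟨u, v, e1, by omega, by omega, Conn.mono (fun f hf => ?_) e8⟩
    simp only [RF, Trap, mem_ofPred_eq] at *
    omega
  have h2 : trapPr A n q' ≤ trapPr A (C * m) q' :=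
    trapPr_anti (by positivity) hm1 fun j => ⟨(hq _).1.le, (hq _).2.le⟩
  have h3 : trapPr A (C * m) q' ≤ trapPr (A + 4 * m) m fun _ => 1 / 2 := by
    have := trapPr_compare hC hz4 harch (q := q') (t := fun _ => 1 / 2) (fun j => hq _)
      (by norm_num) (fun j => hzq _) hA m.toNat
    rwa [Int.toNat_of_nonneg (by omega)] at this
  have hwide : 2 * (A + 4 * m) ≤ ((4 * C * (K + 1) + 12 : ℕ) : ℤ) * m := by
    have g1 : n ≤ 2 * C * m := by nlinarith
    have g2 : (K + 1 : ℤ) * n ≤ (K + 1) * (2 * C * m) := mul_le_mul_of_nonneg_left g1 (by positivity)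
    push_cast
    nlinarith
  have h4 : (trapPr (A + 4 * m) m fun _ => 1 / 2) ≤
      Pr half (VC (A + 4 * m) 0 (((4 * C * (K + 1) + 12 : ℕ) : ℤ) * m) 0 m) := by
    refine (symS (A + 4 * m) 0).Pr_half_le (loc_SV (Trap_finite ..)) (loc_VC ..) fun ω h => ?_
    have := (h.toVC (by omega)).act_symS (A + 4 * m) 0
    rw [zero_add, add_zero, add_zero, add_zero] at this
    exact this.wider (by omega) (by omega)
  have h5 := Pr_VC_add_HC (p := half) (a := 0) (b := ((4 * C * (K + 1) + 12 : ℕ) : ℤ) * m)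
    (c := 0) (d := m) (by omega) (by omega) (A + 4 * m)
  have h6 := hrsw m hm8 (A + 4 * m + 1)
  have h7 := Pr_VC_add_HC (p := rows q) (a := x) (b := x + K * n) (c := y) (d := y + n) (by omega)
    (by omega) (c + 1)
  rw [HC_congr_cls (k' := c) (by omega)] at h7
  linarith

/-! ### Chains of cells -/

/-- Two cells differing by at most one in each index. -/
def NearCell (k k' : ℤ × ℤ) : Prop :=
  k'.1 ≤ k.1 + 1 ∧ k.1 ≤ k'.1 + 1 ∧ k'.2 ≤ k.2 + 1 ∧ k.2 ≤ k'.2 + 1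

/-- Horizontal crossing of two neighbouring cells. -/
def CellH (n : ℤ) (k : ℤ × ℤ) : (ℤ × ℤ → Bool) → Prop :=
  HC 0 (k.1 * (28 * n)) (k.1 * (28 * n) + 56 * n) (k.2 * n) (k.2 * n + n)

/-- Vertical crossing of two neighbouring cells. -/
def CellV (n : ℤ) (k : ℤ × ℤ) : (ℤ × ℤ → Bool) → Prop :=
  VC 0 (k.1 * (28 * n)) (k.1 * (28 * n) + 28 * n) (k.2 * n) (k.2 * n + 2 * n)

/-- The faces around a cell. -/
def cellFaces (n : ℤ) (k : ℤ × ℤ) : Set (ℤ × ℤ) :=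
  RF (k.1 * (28 * n)) (k.1 * (28 * n) + 56 * n) (k.2 * n - n) (k.2 * n + 2 * n)

theorem conn_of_crossings {n x x' a y y' b : ℤ} (hn : 0 < n) (p1 : x ≤ a) (p2 : a ≤ x + 28 * n)
    (p3 : x' ≤ a) (p4 : a ≤ x' + 28 * n) (p5 : b ≤ y) (p6 : y ≤ b + n) (p7 : b ≤ y')
    (p8 : y' ≤ b + n) {D : Set (ℤ × ℤ)} (hD : RF x (x + 56 * n) (y - n) (y + 2 * n) ⊆ D)
    (hD' : RF x' (x' + 56 * n) (y' - n) (y' + 2 * n) ⊆ D) {ω : ℤ × ℤ → Bool}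
    {l r l' r' u v : ℤ × ℤ} (a1 : l.1 = x) (a2 : r.1 = x + 56 * n) (a3 : y ≤ l.2)
    (a4 : l.2 ≤ y + n) (hlr : Conn (RF x (x + 56 * n) y (y + n)) ω l r)
    (b1 : l'.1 = x') (b2 : r'.1 = x' + 56 * n) (b3 : y' ≤ l'.2)
    (b4 : l'.2 ≤ y' + n) (hlr' : Conn (RF x' (x' + 56 * n) y' (y' + n)) ω l' r')
    (c1 : u.2 = b) (c2 : v.2 = b + 2 * n) (c5 : a ≤ v.1) (c6 : v.1 ≤ a + 28 * n)
    (huv : Conn (RF a (a + 28 * n) b (b + 2 * n)) ω u v) : Conn D ω l l' := by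
  have hVD : RF a (a + 28 * n) b (b + 2 * n) ⊆ D :=
    (RF_subset (by omega) (by omega) (by omega) (by omega)).trans hD
  have hHD : RF x (x + 56 * n) y (y + n) ⊆ D :=
    (RF_subset (by omega) (by omega) (by omega) (by omega)).trans hD
  have hHD' : RF x' (x' + 56 * n) y' (y' + n) ⊆ D :=
    (RF_subset (by omega) (by omega) (by omega) (by omega)).trans hD'
  obtain ⟨w, w1, w2⟩ := exists_common (fun f hf => ⟨hf.1, hf.2.1⟩) (fun f hf => hf.2.2)
    huv hlr (by omega) (by omega) c5 c6 a3 a4 (by omega) (by omega)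
  obtain ⟨w', w1', w2'⟩ := exists_common (fun f hf => ⟨hf.1, hf.2.1⟩) (fun f hf => hf.2.2)
    huv hlr' (by omega) (by omega) c5 c6 b3 b4 (by omega) (by omega)
  exact (((w2.mono hHD).trans (w1.mono hVD).symm).trans (w1'.mono hVD)).trans
    (w2'.mono hHD').symm

theorem exists_conn_of_cells {n : ℤ} (hn : 0 < n) {k : ℕ → ℤ × ℤ} {M : ℕ}
    (hk : ∀ t < M, NearCell (k t) (k (t + 1))) {D : Set (ℤ × ℤ)}
    (hD : ∀ t ≤ M, cellFaces n (k t) ⊆ D) {ω : ℤ × ℤ → Bool}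
    (hω : ∀ t ≤ M, CellH n (k t) ω ∧
      CellV n (max (k t).1 (k (t + 1)).1, min (k t).2 (k (t + 1)).2) ω) :
    ∃ u v, cls 0 u ∧ u.1 = (k 0).1 * (28 * n) ∧ (k 0).2 * n ≤ u.2 ∧ u.2 ≤ (k 0).2 * n + n ∧
      v.1 = (k M).1 * (28 * n) ∧ (k M).2 * n ≤ v.2 ∧ v.2 ≤ (k M).2 * n + n ∧ Conn D ω u v := by
  have hH : ∀ t, ∃ u, t ≤ M → ∃ v, cls 0 u ∧ u.1 = (k t).1 * (28 * n) ∧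
      v.1 = (k t).1 * (28 * n) + 56 * n ∧ (k t).2 * n ≤ u.2 ∧ u.2 ≤ (k t).2 * n + n ∧
      (k t).2 * n ≤ v.2 ∧ v.2 ≤ (k t).2 * n + n ∧
      Conn (RF ((k t).1 * (28 * n)) ((k t).1 * (28 * n) + 56 * n) ((k t).2 * n)
        ((k t).2 * n + n)) ω u v := by
    intro t
    by_cases ht : t ≤ M
    · obtain ⟨u, v, h⟩ := (hω t ht).1
      exact ⟨u, fun _ => ⟨v, h⟩⟩
    · exact ⟨0, fun h => absurd h ht⟩
  choose l hl using hH
  have key : ∀ t ≤ M, Conn D ω (l 0) (l t) := by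
    intro t
    induction t with
    | zero => exact fun _ => .refl
    | succ t ih =>
      intro ht
      refine (ih (by omega)).trans ?_
      obtain ⟨r, -, a1, a2, a3, a4, a5, a6, a7⟩ := hl t (by omega)
      obtain ⟨r', -, b1, b2, b3, b4, b5, b6, b7⟩ := hl (t + 1) ht
      obtain ⟨u, v, -, c1, c2, c3, c4, c5, c6, c7⟩ := (hω t (by omega)).2
      obtain ⟨n1, n2, n3, n4⟩ := hk t (by omega)
      have hD1 := hD t (by omega)
      have hD2 := hD (t + 1) ht
      have q : ∀ x y : ℤ, x ≤ y → y ≤ x + 1 → ∀ w : ℤ, 0 ≤ w → x * w ≤ y * w ∧ y * w ≤ x * w + w :=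
        fun x y h1 h2 w hw => ⟨mul_le_mul_of_nonneg_right h1 hw,
          (mul_le_mul_of_nonneg_right h2 hw).trans_eq (by ring)⟩
      obtain ⟨p1, p2⟩ := q (k t).1 (max (k t).1 (k (t + 1)).1) (by omega) (by omega) (28 * n)
        (by omega)
      obtain ⟨p3, p4⟩ := q (k (t + 1)).1 (max (k t).1 (k (t + 1)).1) (by omega) (by omega) (28 * n)
        (by omega)
      obtain ⟨p5, p6⟩ := q (min (k t).2 (k (t + 1)).2) (k t).2 (by omega) (by omega) n hn.le
      obtain ⟨p7, p8⟩ := q (min (k t).2 (k (t + 1)).2) (k (t + 1)).2 (by omega) (by omega) n hn.le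
      exact conn_of_crossings hn p1 p2 p3 p4 p5 p6 p7 p8 hD1 hD2 a1 a2 a3 a4 a7 b1 b2 b3 b4 b7
        c1 c2 c5 c6 c7
  obtain ⟨-, h1, h2, -, h3, h4, -⟩ := hl 0 (Nat.zero_le _)
  obtain ⟨-, -, h5, -, h6, h7, -⟩ := hl M le_rfl
  exact ⟨l 0, l M, h1, h2, h3, h4, h5, h6, h7, key M le_rfl⟩

/-- Probability of a chain of cells being crossed. -/
theorem Pr_cells_ge {z : ℝ} (hz : 0 < z) : ∃ δ : ℝ, 0 < δ ∧ ∃ n₀ : ℤ, ∀ q : ℤ → ℝ,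
    (∀ j, 0 < q j ∧ q j < 1) → (∀ j, z ≤ q j * (1 - q j)) → ∀ n, n₀ ≤ n →
    ∀ (k m : ℕ → ℤ × ℤ) (M : ℕ),
      δ ^ M ≤ Pr (rows q) fun ω => ∀ t ∈ Finset.range M, CellH n (k t) ω ∧ CellV n (m t) ω := by
  obtain ⟨δ, hδ, n₀, h⟩ := Pr_HC_ge hz (K := 56) (by norm_num)
  refine ⟨δ * (1 / 2), by positivity, max n₀ 1, fun q hq hzq n hn k m M => ?_⟩
  have hp : IsProb (rows q) := fun f => ⟨(hq _).1.le, (hq _).2.le⟩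
  have := Pr_forall_ge (S := Finset.range M) (c := δ * (1 / 2)) hp (o := ori 0)
    (A := fun t ω => CellH n (k t) ω ∧ CellV n (m t) ω)
    (fun t => (loc_HC ..).and (loc_VC ..)) (fun t _ ω ω' hh hA =>
      ⟨incE_HC _ _ _ _ _ _ _ hh hA.1, incE_VC _ _ _ _ _ _ _ hh hA.2⟩) (by positivity)
    fun t _ => ?_
  · rwa [Finset.card_range] at this
  · refine le_trans ?_ (Pr_harris hp (o := ori 0)
      (fun _ _ hh => incE_HC _ _ _ _ _ _ _ hh) (fun _ _ hh => incE_VC _ _ _ _ _ _ _ hh)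
      (loc_HC ..) (loc_VC ..))
    have h1 := h q hq hzq n (by omega) 0 ((k t).1 * (28 * n)) ((k t).2 * n)
    have h2 := Pr_VC_ge hq (n := 2 * n) (by omega) 0 ((m t).1 * (28 * n)) ((m t).2 * n)
    rw [show 14 * (2 * n) = 28 * n by ring] at h2
    push_cast at h1
    exact mul_le_mul h1 h2 (by norm_num) (hδ.le.trans h1)

/-! ### Faces and edges -/

/-- The edge lying in a face. -/
def faceEdge : ℤ × ℤ ≃ SqE where
  toFun f := if (f.1 + f.2) % 2 = 0 then ((f.1 + f.2) / 2, (f.2 - f.1) / 2, true)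
    else ((f.1 + f.2 + 1) / 2, (f.2 - f.1 - 1) / 2, false)
  invFun e := if e.2.2 then (e.1 - e.2.1, e.1 + e.2.1) else (e.1 - e.2.1 - 1, e.1 + e.2.1)
  left_inv f := by
    obtain ⟨i, j⟩ := f
    by_cases h : (i + j) % 2 = 0
    · simp only [h, if_true, Prod.mk.injEq]
      omega
    · simp only [h, if_false, Prod.mk.injEq, Bool.false_eq_true]
      omega
  right_inv e := by
    obtain ⟨a, b, c⟩ := e
    cases c
    · have h : ¬ (a - b - 1 + (a + b)) % 2 = 0 := by omega
      simp only [if_false, Bool.false_eq_true, h, Prod.mk.injEq, and_true]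
      omega
    · have h : (a - b + (a + b)) % 2 = 0 := by omega
      simp only [if_true, h, Prod.mk.injEq, and_true]
      omega

theorem faceEdge_even {i j : ℤ} (h : (i + j) % 2 = 0) :
    faceEdge (i, j) = ((i + j) / 2, (j - i) / 2, true) := if_pos h

theorem faceEdge_odd {i j : ℤ} (h : ¬ (i + j) % 2 = 0) :
    faceEdge (i, j) = ((i + j + 1) / 2, (j - i - 1) / 2, false) := if_neg h

theorem ori_even {i j : ℤ} (h : (i + j) % 2 = 0) : ori 0 (i, j) = true :=
  decide_eq_true (by simpa using h)

theorem ori_odd {i j : ℤ} (h : ¬ (i + j) % 2 = 0) : ori 0 (i, j) = false :=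
  decide_eq_false (by simpa using h)

/-- The states of the faces given by an edge configuration. -/
def faceConfig (η : Config SqE) (f : ℤ × ℤ) : Bool := xor (η (faceEdge f)) (!ori 0 f)

theorem Pr_faceConfig {q q' : ℤ → ℝ} (h : ∀ j, q' j = 1 - q j) {A : (ℤ × ℤ → Bool) → Prop}
    (hA : Loc A) : Pr (rsqHI q q') (fun η => A (faceConfig η)) = Pr (rows q) A := by
  unfold faceConfig
  rw [Pr_reindex (rsqHI q q') faceEdge (fun f => !ori 0 f) hA]
  congr 1
  funext ⟨i, j⟩
  by_cases hp : (i + j) % 2 = 0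
  · have : (i + j) / 2 + (j - i) / 2 = j := by omega
    simp [rsqHI, faceEdge_even hp, ori_even hp, rows, this]
  · have : (i + j + 1) / 2 + (j - i - 1) / 2 = j := by omega
    simp [rsqHI, faceEdge_odd hp, ori_odd hp, rows, this, h]

theorem loc_faceConfig {A : (ℤ × ℤ → Bool) → Prop} (hA : Loc A) :
    Loc fun η : Config SqE => A (faceConfig η) := by
  obtain ⟨S, hS, hA⟩ := hA
  refine ⟨faceEdge '' S, hS.image _, fun η η' hh => hA fun f hf => ?_⟩
  rw [faceConfig, faceConfig, hh _ (mem_image_of_mem _ hf)]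

/-- The position of a site in the plane. -/
noncomputable def site (u : ℤ × ℤ) : Pt := ((u.1 : ℝ) / Real.sqrt 2, (u.2 : ℝ) / Real.sqrt 2)

theorem rv_eq_site {a b : ℤ} {u : ℤ × ℤ} (h1 : u.1 = a - b) (h2 : u.2 = a + b) :
    rv a b = site u := by
  simp [rv, site, h1, h2]

theorem Step.segment_subset {D : Set (ℤ × ℤ)} {η : Config SqE} {u v : ℤ × ℤ}
    (h : Step D (faceConfig η) u v) (hu : Perc.cls 0 u) :
    segment ℝ (site u) (site v) ⊆ openEdgeSet rsqLattice η := by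
  have main : ∀ f : ℤ × ℤ, η (faceEdge f) = true →
      segment ℝ (rsqLattice.ends (faceEdge f)).1 (rsqLattice.ends (faceEdge f)).2 ⊆
        openEdgeSet rsqLattice η := fun f hf =>
    subset_biUnion_of_mem (u := fun e => segment ℝ (rsqLattice.ends e).1 (rsqLattice.ends e).2)
      (show faceEdge f ∈ {e | η e = true} from hf)
  have even : ∀ i j : ℤ, (i + j) % 2 = 0 → faceConfig η (i, j) = true →
      segment ℝ (site (i, j)) (site (i + 1, j + 1)) ⊆ openEdgeSet rsqLattice η := by
    intro i j hp hω
    have h1 : η (faceEdge (i, j)) = true := by simpa [faceConfig, ori_even hp] using hω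
    have := main _ h1
    simp only [faceEdge_even hp, rsqLattice, if_true] at this
    rwa [rv_eq_site (u := (i, j)) (by simp only; omega) (by simp only; omega),
      rv_eq_site (u := (i + 1, j + 1)) (by simp only; omega) (by simp only; omega)] at this
  have odd : ∀ i j : ℤ, ¬ (i + j) % 2 = 0 → faceConfig η (i, j) = false →
      segment ℝ (site (i + 1, j)) (site (i, j + 1)) ⊆ openEdgeSet rsqLattice η := by
    intro i j hp hω
    have h1 : η (faceEdge (i, j)) = true := by simpa [faceConfig, ori_odd hp] using hω
    have := main _ h1
    simp only [faceEdge_odd hp, rsqLattice, if_false, Bool.false_eq_true] at this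
    rwa [rv_eq_site (u := (i + 1, j)) (by simp only; omega) (by simp only; omega),
      rv_eq_site (u := (i, j + 1)) (by simp only; omega) (by simp only; omega)] at this
  simp only [Perc.cls] at hu
  cases h with
  | ur i j _ h2 => exact even i j (by omega) h2
  | dl i j _ h2 => rw [segment_symm]; exact even i j (by omega) h2
  | ul i j _ h2 => exact odd i j (by omega) h2
  | dr i j _ h2 => rw [segment_symm]; exact odd i j (by omega) h2

theorem Conn.joinedIn {D : Set (ℤ × ℤ)} {η : Config SqE} {u v : ℤ × ℤ}
    (h : Conn D (faceConfig η) u v) (hu : Perc.cls 0 u) {T : Set Pt} (hT : Convex ℝ T)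
    (hD : ∀ f ∈ D, ∀ w : ℤ × ℤ, f.1 ≤ w.1 → w.1 ≤ f.1 + 1 → f.2 ≤ w.2 → w.2 ≤ f.2 + 1 →
      site w ∈ T) :
    u = v ∨ JoinedIn (openEdgeSet rsqLattice η ∩ T) (site u) (site v) := by
  induction h with
  | refl => exact Or.inl rfl
  | @tail b c h1 h2 ih =>
    have hf := hD _ h2.face_mem
    have hc := h2.coord
    have : JoinedIn (openEdgeSet rsqLattice η ∩ T) (site b) (site c) := by
      refine JoinedIn.of_segment_subset (subset_inter
        (h2.segment_subset ((Conn.cls h1 0).1 hu)) (hT.segment_subset ?_ ?_)) <;>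
      · refine hf _ ?_ ?_ ?_ ?_ <;> simp only [face] <;> omega
    rcases ih with rfl | ih
    · exact Or.inr this
    · exact Or.inr (ih.trans this)

/-! ### Boxes of arbitrary orientation -/

/-- A continuous function going from below `0` to above `h` does so within `[0, h]` on some
interval. -/
theorem exists_interval_crossing {φ : ℝ → ℝ} (hφ : Continuous φ) {h : ℝ} (hh : 0 ≤ h)
    (h0 : φ 0 ≤ 0) (h1 : h ≤ φ 1) : ∃ s t, 0 ≤ s ∧ s ≤ t ∧ t ≤ 1 ∧ φ s = 0 ∧ φ t = h ∧
      ∀ r ∈ Icc s t, 0 ≤ φ r ∧ φ r ≤ h := by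
  obtain ⟨t, ⟨⟨ht0, ht1⟩, ht⟩, htl⟩ :=
    (isCompact_Icc.inter_right (isClosed_le continuous_const hφ) :
      IsCompact (Icc (0 : ℝ) 1 ∩ {r | h ≤ φ r})).exists_isLeast ⟨1, ⟨zero_le_one, le_rfl⟩, h1⟩
  have ht' : φ t = h := by
    obtain ⟨r, ⟨hr0, hr1⟩, hr⟩ := intermediate_value_Icc ht0 hφ.continuousOn ⟨h0.trans hh, ht⟩
    have := htl ⟨⟨hr0, hr1.trans ht1⟩, hr.ge⟩
    rwa [le_antisymm hr1 this] at hr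
  obtain ⟨s, ⟨⟨hs0, hs1⟩, hs⟩, hsg⟩ :=
    (isCompact_Icc.inter_right (isClosed_le hφ continuous_const) :
      IsCompact (Icc (0 : ℝ) t ∩ {r | φ r ≤ 0})).exists_isGreatest ⟨0, ⟨le_rfl, ht0⟩, h0⟩
  have hs' : φ s = 0 := by
    obtain ⟨r, ⟨hr0, hr1⟩, hr⟩ := intermediate_value_Icc hs1 hφ.continuousOn
      (show (0 : ℝ) ∈ Icc (φ s) (φ t) from ⟨hs, by rw [ht']; exact hh⟩)
    have := hsg ⟨⟨hs0.trans hr0, hr1⟩, hr.le⟩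
    rwa [le_antisymm this hr0] at hr
  refine ⟨s, t, hs0, hs1, ht1, hs', ht', fun r hr => ⟨?_, ?_⟩⟩
  · by_contra hc
    push Not at hc
    have := hsg ⟨⟨hs0.trans hr.1, hr.2⟩, hc.le⟩
    rw [le_antisymm this hr.1, hs'] at hc
    exact hc.false
  · by_contra hc
    push Not at hc
    have := htl ⟨⟨hs0.trans hr.1, hr.2.trans ht1⟩, hc.le⟩
    rw [le_antisymm hr.2 this, ht'] at hc
    exact hc.false

/-- The coordinates relative to a rotated frame. -/
noncomputable def frame (θ : ℝ) (t w : Pt) : Pt := rot (-θ) (w - t)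

theorem rot_frame (θ : ℝ) (t w : Pt) : rot θ (frame θ t w) + t = w := by
  have := Real.cos_sq_add_sin_sq θ
  ext
  · simp only [rot, frame, Real.cos_neg, Real.sin_neg, Prod.fst_add, Prod.fst_sub, Prod.snd_sub]
    linear_combination (w.1 - t.1) * this
  · simp only [rot, frame, Real.cos_neg, Real.sin_neg, Prod.snd_add, Prod.fst_sub, Prod.snd_sub]
    linear_combination (w.2 - t.2) * this

theorem frame_rot (θ : ℝ) (t w : Pt) : frame θ t (rot θ w + t) = w := by
  have := Real.cos_sq_add_sin_sq θ
  ext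
  · simp only [rot, frame, Real.cos_neg, Real.sin_neg, Prod.fst_add, Prod.fst_sub, Prod.snd_sub,
      Prod.snd_add]
    linear_combination w.1 * this
  · simp only [rot, frame, Real.cos_neg, Real.sin_neg, Prod.fst_add, Prod.fst_sub, Prod.snd_sub,
      Prod.snd_add]
    linear_combination w.2 * this

theorem continuous_frame (θ : ℝ) (t : Pt) : Continuous (frame θ t) := by
  unfold frame rot
  fun_prop

theorem abs_combination_le {c s a b A B : ℝ} (hc : |c| ≤ 1) (hs : |s| ≤ 1) (ha : |a| ≤ A)
    (hb : |b| ≤ B) : |c * a + s * b| ≤ A + B := by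
  refine (abs_add_le _ _).trans (add_le_add ?_ ?_) <;> rw [abs_mul]
  · nlinarith [abs_nonneg c, abs_nonneg a]
  · nlinarith [abs_nonneg s, abs_nonneg b]

theorem abs_frame_sub_le (θ : ℝ) (t w w' : Pt) {A B : ℝ} (h1 : |w.1 - w'.1| ≤ A)
    (h2 : |w.2 - w'.2| ≤ B) : |(frame θ t w).1 - (frame θ t w').1| ≤ A + B ∧
      |(frame θ t w).2 - (frame θ t w').2| ≤ A + B := by
  have hc := Real.abs_cos_le_one θ
  have hs := Real.abs_sin_le_one θ
  constructor
  · have := abs_combination_le hc hs h1 h2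
    refine le_of_eq_of_le (congrArg _ ?_) this
    simp only [frame, rot, Real.cos_neg, Real.sin_neg, Prod.fst_sub, Prod.snd_sub]
    ring
  · have := abs_combination_le (c := -Real.sin θ) (by rwa [abs_neg]) hc h1 h2
    refine le_of_eq_of_le (congrArg _ ?_) this
    simp only [frame, rot, Real.cos_neg, Real.sin_neg, Prod.fst_sub, Prod.snd_sub]
    ring

theorem convex_strip (θ : ℝ) (t : Pt) (c ρ : ℝ) :
    Convex ℝ {w : Pt | |(frame θ t w).2 - c| ≤ ρ} := by
  have : ∀ w : Pt, (frame θ t w).2 = -Real.sin θ * (w.1 - t.1) + Real.cos θ * (w.2 - t.2) := by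
    intro w
    simp [frame, rot]
  intro x hx y hy a b ha hb hab
  simp only [mem_ofPred_eq, this, abs_le, Prod.fst_add, Prod.snd_add, Prod.smul_fst,
    Prod.smul_snd, smul_eq_mul] at *
  obtain rfl : b = 1 - a := by linarith
  constructor <;> nlinarith

/-- A path of open edges in a strip, joining the two sides of a box, crosses the box. -/
theorem crossingIn_of_joinedIn {η : Config SqE} {θ : ℝ} {t : Pt} {h l ρ : ℝ} (hh : 0 ≤ h)
    (hl : 2 * ρ ≤ l) {w w' : Pt} (hw : (frame θ t w).1 ≤ 0) (hw' : h ≤ (frame θ t w').1)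
    (hj : JoinedIn (openEdgeSet rsqLattice η ∩ {w : Pt | |(frame θ t w).2 - l / 2| ≤ ρ}) w w') :
    CrossingIn rsqLattice η ((fun z => rot θ z + t) '' stdRect h l)
      ((fun z => rot θ z + t) '' leftSide h l) ((fun z => rot θ z + t) '' rightSide h l) := by
  obtain ⟨γ, hγ⟩ := hj
  have hmem : ∀ r : ℝ, γ.extend r ∈
      openEdgeSet rsqLattice η ∩ {w : Pt | |(frame θ t w).2 - l / 2| ≤ ρ} := by
    intro r
    obtain ⟨s, hs⟩ : γ.extend r ∈ range γ := by rw [← γ.extend_range]; exact mem_range_self r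
    rw [← hs]
    exact hγ s
  have hy : ∀ r : ℝ, 0 ≤ (frame θ t (γ.extend r)).2 ∧ (frame θ t (γ.extend r)).2 ≤ l := by
    intro r
    have := abs_le.1 (show |(frame θ t (γ.extend r)).2 - l / 2| ≤ ρ from (hmem r).2)
    constructor <;> linarith
  obtain ⟨a, b, ha, hab, hb, h1, h2, h3⟩ := exists_interval_crossing
    (φ := fun r => (frame θ t (γ.extend r)).1)
    (continuous_fst.comp ((continuous_frame θ t).comp γ.continuous_extend)) hh
    (by simpa using hw) (by simpa using hw')
  refine ⟨fun r => γ.extend (a + r * (b - a)), ?_, ⟨_, ⟨?_, hy _⟩, rot_frame θ t _⟩,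
    ⟨_, ⟨?_, hy _⟩, rot_frame θ t _⟩, fun r hr => ⟨⟨_, ?_, rot_frame θ t _⟩, (hmem _).1⟩⟩
  · exact (γ.continuous_extend.comp (by fun_prop)).continuousOn
  · simpa using h1
  · simpa using h2
  · have := h3 (a + r * (b - a)) ⟨by nlinarith [hr.1], by nlinarith [hr.2]⟩
    exact ⟨this.1, this.2, hy _⟩

/-- The cell containing a point. -/
noncomputable def cellOf (n : ℤ) (w : Pt) : ℤ × ℤ :=
  (⌊Real.sqrt 2 * w.1 / (28 * n)⌋, ⌊Real.sqrt 2 * w.2 / n⌋)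

theorem floor_le_floor_add_one {x y : ℝ} (h : |x - y| ≤ 1) : ⌊x⌋ ≤ ⌊y⌋ + 1 := by
  rw [← Int.floor_add_one]
  exact Int.floor_le_floor (by linarith [(abs_le.1 h).2])

theorem nearCell_cellOf {n : ℤ} (hn : 0 < n) {w w' : Pt} (h1 : Real.sqrt 2 * |w.1 - w'.1| ≤ n)
    (h2 : Real.sqrt 2 * |w.2 - w'.2| ≤ n) : NearCell (cellOf n w) (cellOf n w') := by
  have hn' : (0 : ℝ) < n := by exact_mod_cast hn
  have e1 : |Real.sqrt 2 * w.1 / (28 * n) - Real.sqrt 2 * w'.1 / (28 * n)| ≤ 1 := by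
    rw [← sub_div, ← mul_sub, abs_div, abs_mul, abs_of_nonneg (Real.sqrt_nonneg 2),
      abs_of_pos (show (0 : ℝ) < 28 * n by positivity), div_le_one (by positivity)]
    linarith
  have e2 : |Real.sqrt 2 * w.2 / n - Real.sqrt 2 * w'.2 / n| ≤ 1 := by
    rw [← sub_div, ← mul_sub, abs_div, abs_mul, abs_of_nonneg (Real.sqrt_nonneg 2),
      abs_of_pos hn', div_le_one (by positivity)]
    linarith
  exact ⟨floor_le_floor_add_one (by rwa [abs_sub_comm]), floor_le_floor_add_one e1,
    floor_le_floor_add_one (by rwa [abs_sub_comm]), floor_le_floor_add_one e2⟩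

/-- Sites of the cell of a point are close to that point. -/
theorem abs_frame_site_sub_le (θ : ℝ) (t : Pt) {n : ℤ} (hn : 0 < n) {w : Pt} {u : ℤ × ℤ}
    (h1 : (cellOf n w).1 * (28 * n) ≤ u.1) (h2 : u.1 ≤ (cellOf n w).1 * (28 * n) + 56 * n)
    (h3 : (cellOf n w).2 * n - n ≤ u.2) (h4 : u.2 ≤ (cellOf n w).2 * n + 2 * n) :
    |(frame θ t (site u)).1 - (frame θ t w).1| ≤ 58 * n ∧
      |(frame θ t (site u)).2 - (frame θ t w).2| ≤ 58 * n := by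
  have hn' : (0 : ℝ) < n := by exact_mod_cast hn
  have hs : (1 : ℝ) ≤ Real.sqrt 2 := Real.one_le_sqrt.2 one_le_two
  have f1 := Int.floor_le (Real.sqrt 2 * w.1 / (28 * n))
  have f2 := (Int.lt_floor_add_one (Real.sqrt 2 * w.1 / (28 * n))).le
  have f3 := Int.floor_le (Real.sqrt 2 * w.2 / n)
  have f4 := (Int.lt_floor_add_one (Real.sqrt 2 * w.2 / n)).le
  rw [le_div_iff₀ (by positivity)] at f1 f3
  rw [div_le_iff₀ (by positivity)] at f2 f4
  have g1 : ((cellOf n w).1 * (28 * n) : ℝ) ≤ u.1 := by exact_mod_cast h1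
  have g2 : (u.1 : ℝ) ≤ (cellOf n w).1 * (28 * n) + 56 * n := by exact_mod_cast h2
  have g3 : ((cellOf n w).2 * n - n : ℝ) ≤ u.2 := by exact_mod_cast h3
  have g4 : (u.2 : ℝ) ≤ (cellOf n w).2 * n + 2 * n := by exact_mod_cast h4
  simp only [cellOf] at g1 g2 g3 g4
  have key : ∀ a b c : ℝ, 0 ≤ c → |a - Real.sqrt 2 * b| ≤ c → |a / Real.sqrt 2 - b| ≤ c := by
    intro a b c hc h
    rw [show a / Real.sqrt 2 - b = (a - Real.sqrt 2 * b) / Real.sqrt 2 by field_simp, abs_div,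
      abs_of_pos (zero_lt_one.trans_le hs), div_le_iff₀ (by positivity)]
    nlinarith
  have := abs_frame_sub_le θ t (site u) w (A := 56 * n) (B := 2 * n)
    (key _ _ _ (by positivity) (abs_le.2 ⟨by linarith, by linarith⟩))
    (key _ _ _ (by positivity) (abs_le.2 ⟨by linarith, by linarith⟩))
  rwa [show (56 * n + 2 * n : ℝ) = 58 * n by ring] at this

/-- Equally spaced points along the midline of a box. -/
noncomputable def midPoint (θ : ℝ) (t : Pt) (n : ℤ) (h l : ℝ) (M s : ℕ) : Pt :=
  rot θ (-(58 * n) + s / M * (h + 116 * n), l / 2) + t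

theorem crossingIn_of_cells {η : Config SqE} {θ : ℝ} {t : Pt} {n : ℤ} {h l : ℝ} (hn : 0 < n)
    (hh : 0 < h) (hl : 116 * n ≤ l) {M : ℕ} (hM : 0 < M)
    (hMn : Real.sqrt 2 * (h + 116 * n) ≤ n * M)
    (hω : ∀ s ≤ M, CellH n (cellOf n (midPoint θ t n h l M s)) (faceConfig η) ∧
      CellV n (max (cellOf n (midPoint θ t n h l M s)).1 (cellOf n (midPoint θ t n h l M (s + 1))).1,
        min (cellOf n (midPoint θ t n h l M s)).2 (cellOf n (midPoint θ t n h l M (s + 1))).2)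
        (faceConfig η)) :
    CrossingIn rsqLattice η ((fun z => rot θ z + t) '' stdRect h l)
      ((fun z => rot θ z + t) '' leftSide h l) ((fun z => rot θ z + t) '' rightSide h l) := by
  have hn' : (0 : ℝ) < n := by exact_mod_cast hn
  have hM' : (0 : ℝ) < M := by exact_mod_cast hM
  have hstep : Real.sqrt 2 * ((h + 116 * n) / M) ≤ n := by
    rwa [← mul_div_assoc, div_le_iff₀ hM']
  have hnear : ∀ s, NearCell (cellOf n (midPoint θ t n h l M s))
      (cellOf n (midPoint θ t n h l M (s + 1))) := by
    intro s
    have e : (0 : ℝ) ≤ (h + 116 * n) / M := by positivity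
    have e1 : (midPoint θ t n h l M s).1 - (midPoint θ t n h l M (s + 1)).1 =
        -(Real.cos θ * ((h + 116 * n) / M)) := by
      simp only [midPoint, rot, Prod.fst_add]
      push_cast
      ring
    have e2 : (midPoint θ t n h l M s).2 - (midPoint θ t n h l M (s + 1)).2 =
        -(Real.sin θ * ((h + 116 * n) / M)) := by
      simp only [midPoint, rot, Prod.snd_add]
      push_cast
      ring
    refine nearCell_cellOf hn ?_ ?_
    · rw [e1, abs_neg, abs_mul, abs_of_nonneg e]
      exact (mul_le_mul_of_nonneg_left (mul_le_of_le_one_left e (Real.abs_cos_le_one θ))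
        (Real.sqrt_nonneg 2)).trans hstep
    · rw [e2, abs_neg, abs_mul, abs_of_nonneg e]
      exact (mul_le_mul_of_nonneg_left (mul_le_of_le_one_left e (Real.abs_sin_le_one θ))
        (Real.sqrt_nonneg 2)).trans hstep
  obtain ⟨u, v, hu, u1, u2, u3, v1, v2, v3, huv⟩ := exists_conn_of_cells hn
    (fun s _ => hnear s) (D := ⋃ s ≤ M, cellFaces n (cellOf n (midPoint θ t n h l M s)))
    (fun s hs => subset_biUnion_of_mem
      (u := fun s => cellFaces n (cellOf n (midPoint θ t n h l M s))) hs) hω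
  have hj := huv.joinedIn hu (convex_strip θ t (l / 2) (58 * n)) fun f hf w w1 w2 w3 w4 => by
    simp only [mem_iUnion, cellFaces, RF, mem_ofPred_eq] at hf
    obtain ⟨s, hs, f1, f2, f3, f4⟩ := hf
    have := (abs_frame_site_sub_le θ t hn (w := midPoint θ t n h l M s) (u := w) (by omega)
      (by omega) (by omega) (by omega)).2
    rw [midPoint, frame_rot] at this
    exact this
  have d1 := abs_le.1 (abs_frame_site_sub_le θ t hn (w := midPoint θ t n h l M 0) (u := u)
    (by omega) (by omega) (by omega) (by omega)).1
  have d2 := abs_le.1 (abs_frame_site_sub_le θ t hn (w := midPoint θ t n h l M M) (u := v)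
    (by omega) (by omega) (by omega) (by omega)).1
  rw [midPoint, frame_rot] at d1 d2
  rw [div_self hM'.ne'] at d2
  simp only [Nat.cast_zero, zero_div, zero_mul, add_zero] at d1
  have x1 : (frame θ t (site u)).1 ≤ 0 := by linarith [d1.2]
  have x2 : h ≤ (frame θ t (site v)).1 := by linarith [d2.1]
  rcases hj with rfl | hj
  · linarith
  · exact crossingIn_of_joinedIn hh.le (by linarith) x1 x2 hj

/-- Crossing a box in the second direction is crossing the box turned by a right angle. -/
theorem crossingIn_turn {η : Config SqE} {θ : ℝ} {t : Pt} {h l : ℝ}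
    (hc : CrossingIn rsqLattice η
      ((fun z => rot (θ + Real.pi / 2) z + (rot θ (h, 0) + t)) '' stdRect l h)
      ((fun z => rot (θ + Real.pi / 2) z + (rot θ (h, 0) + t)) '' leftSide l h)
      ((fun z => rot (θ + Real.pi / 2) z + (rot θ (h, 0) + t)) '' rightSide l h)) :
    CrossingIn rsqLattice η ((fun z => rot θ z + t) '' stdRect h l)
      ((fun z => rot θ z + t) '' bottomSide h l) ((fun z => rot θ z + t) '' topSide h l) := by
  have e : ∀ z : Pt, rot (θ + Real.pi / 2) z + (rot θ (h, 0) + t) = rot θ (h - z.2, z.1) + t := by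
    intro z
    ext <;> simp only [rot, Real.cos_add_pi_div_two, Real.sin_add_pi_div_two, Prod.fst_add,
      Prod.snd_add] <;> ring
  obtain ⟨γ, h1, ⟨z, ⟨a1, a2, a3⟩, a4⟩, ⟨z', ⟨b1, b2, b3⟩, b4⟩, h2⟩ := hc
  refine ⟨γ, h1, ⟨(h - z.2, z.1), ⟨a1, by linarith, by linarith⟩, (e z).symm.trans a4⟩,
    ⟨(h - z'.2, z'.1), ⟨b1, by linarith, by linarith⟩, (e z').symm.trans b4⟩, fun r hr => ?_⟩
  obtain ⟨⟨z, ⟨c1, c2, c3, c4⟩, c5⟩, c6⟩ := h2 r hr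
  exact ⟨⟨(h - z.2, z.1), ⟨by linarith, by linarith, c1, c2⟩, (e z).symm.trans c5⟩, c6⟩

/-- The cell size and number of cells used for boxes with a given aspect ratio. -/
theorem exists_cell_size {α : ℝ} (hα : 0 < α) (n₀ : ℤ) : ∃ M : ℕ, 0 < M ∧ ∃ N₀ : ℕ, ∀ N : ℕ,
    N₀ ≤ N → ∃ n : ℤ, n₀ ≤ n ∧ 0 < n ∧ 116 * (n : ℝ) ≤ N ∧ 116 * (n : ℝ) ≤ α * N ∧
      Real.sqrt 2 * (α * N + 116 * n) ≤ n * M ∧ Real.sqrt 2 * (N + 116 * n) ≤ n * M := by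
  obtain ⟨κ, hκ, hκ1, hκ2⟩ : ∃ κ : ℝ, 0 < κ ∧ 116 * κ ≤ 1 ∧ 116 * κ ≤ α :=
    ⟨min 1 α / 116, by positivity, by linarith [min_le_left 1 α], by linarith [min_le_right 1 α]⟩
  obtain ⟨M, hM⟩ := exists_nat_ge (4 * (α + 2) / κ)
  obtain ⟨N₀, hN₀⟩ := exists_nat_ge ((|(n₀ : ℝ)| + 2) / κ)
  have hM0 : (0 : ℝ) < M := lt_of_lt_of_le (by positivity) hM
  refine ⟨M, by exact_mod_cast hM0, N₀, fun N hN => ⟨⌊κ * N⌋, ?_⟩⟩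
  have hN' : |(n₀ : ℝ)| + 2 ≤ κ * N := by
    rw [div_le_iff₀ hκ] at hN₀
    have : (N₀ : ℝ) ≤ N := by exact_mod_cast hN
    nlinarith
  rw [div_le_iff₀ hκ] at hM
  have f1 := Int.floor_le (κ * N)
  have f2 := Int.lt_floor_add_one (κ * N)
  have hN0 : (0 : ℝ) ≤ N := N.cast_nonneg
  have hs : Real.sqrt 2 ≤ 2 := by
    rw [Real.sqrt_le_left (by norm_num)]; norm_num
  have hs0 := Real.sqrt_nonneg 2
  have a0 := abs_nonneg (n₀ : ℝ)
  have a1 := le_abs_self (n₀ : ℝ)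
  have g1 : κ * N / 2 ≤ ⌊κ * N⌋ := by linarith
  have g2 : 2 * ((α + 2) * N) ≤ ⌊κ * N⌋ * M := by
    calc 2 * ((α + 2) * N) = (4 * (α + 2)) * (N / 2) := by ring
      _ ≤ (M * κ) * (N / 2) := by gcongr
      _ = κ * N / 2 * M := by ring
      _ ≤ _ := by gcongr
  have g3 : 116 * (⌊κ * N⌋ : ℝ) ≤ N := by nlinarith
  have g4 : 116 * (⌊κ * N⌋ : ℝ) ≤ α * N := by nlinarith
  have g5 : (0 : ℝ) < ⌊κ * N⌋ := by linarith
  have g6 : 0 ≤ α * N := by positivity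
  refine ⟨?_, by exact_mod_cast g5, g3, g4, ?_, ?_⟩
  · rw [Int.le_floor]; linarith
  · nlinarith
  · nlinarith

theorem boxCrossing_of_product {q q' : ℤ → ℝ} (hq : ∀ j, 0 < q j ∧ q j < 1)
    (hqq : ∀ j, q' j = 1 - q j) {z : ℝ} (hz : 0 < z) (hzq : ∀ j, z ≤ q j * (1 - q j))
    {P : Measure (Config SqE)} (hP : IsBernoulliProduct (rsqHI q q') P) :
    BoxCrossingProperty rsqLattice P := by
  intro α hα
  obtain ⟨δ, hδ, n₀, hcells⟩ := Pr_cells_ge hz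
  obtain ⟨M, hM, N₀, hsize⟩ := exists_cell_size hα n₀
  refine ⟨δ ^ ((M + 1) + (M + 1)), by positivity, max N₀ 1, fun N hN f hf => ?_⟩
  obtain ⟨θ, t, rfl⟩ := hf
  obtain ⟨n, hn₀, hn, hn1, hn2, hM1, hM2⟩ := hsize N ((le_max_left _ _).trans hN)
  have hN0 : (0 : ℝ) < N := by exact_mod_cast (le_max_right _ _).trans hN
  set w₁ : ℕ → Pt := midPoint θ t n (α * N) N M
  set w₂ : ℕ → Pt := midPoint (θ + Real.pi / 2) (rot θ (α * N, 0) + t) n N (α * N) M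
  set k : ℕ → ℤ × ℤ := fun s => cellOf n (if s < M + 1 then w₁ s else w₂ (s - (M + 1)))
  set k' : ℕ → ℤ × ℤ := fun s => cellOf n (if s < M + 1 then w₁ (s + 1) else w₂ (s - (M + 1) + 1))
  set m : ℕ → ℤ × ℤ := fun s => (max (k s).1 (k' s).1, min (k s).2 (k' s).2)
  have hA : Loc fun ω => ∀ s ∈ Finset.range ((M + 1) + (M + 1)),
      CellH n (k s) ω ∧ CellV n (m s) ω :=
    Loc.forall_finset (A := fun s ω => CellH n (k s) ω ∧ CellV n (m s) ω)
      (fun s => (loc_HC ..).and (loc_VC ..)) _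
  have h1 := hcells q hq hzq n hn₀ k m ((M + 1) + (M + 1))
  rw [← Pr_faceConfig hqq hA] at h1
  have hp : IsProb (rsqHI q q') := by
    intro e
    unfold rsqHI
    split
    · exact ⟨(hq _).1.le, (hq _).2.le⟩
    · rw [hqq]
      constructor <;> linarith [hq (e.1 + e.2.1)]
  refine (ENNReal.ofReal_le_ofReal h1).trans ((measure_ge_Pr hp hP (loc_faceConfig hA)).trans
    (measure_mono fun η hη => ?_))
  constructor
  · refine crossingIn_of_cells hn (by positivity) hn1 hM hM1 fun s hs => ?_
    have := hη s (Finset.mem_range.2 (by omega))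
    simpa only [m, k, k', if_pos (Nat.lt_succ_of_le hs)] using this
  · refine crossingIn_turn (crossingIn_of_cells hn hN0 hn2 hM hM2 fun s hs => ?_)
    have := hη (M + 1 + s) (Finset.mem_range.2 (by omega))
    simpa only [m, k, k', if_neg (show ¬ M + 1 + s < M + 1 by omega), Nat.add_sub_cancel_left]
      using this

/-- If `q, q' ∈ (0,1)^ℤ` and there exists `ε > 0` with
`κ_□(q_n, q'_n) = 0` and `q_n, q'_n ≥ ε` for all `n`, then the highly inhomogeneous
measure `P^□_{q,q'}` on the diagonally oriented square lattice has the box-crossing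
property. -/
theorem highly_inhomogeneous_square_box_crossing (q q' : ℤ → ℝ)
    (hq : ∀ n, q n ∈ Set.Ioo (0 : ℝ) 1) (hq' : ∀ n, q' n ∈ Set.Ioo (0 : ℝ) 1)
    (hε : ∃ ε : ℝ, 0 < ε ∧ ∀ n : ℤ, kappaS (q n) (q' n) = 0 ∧ ε ≤ q n ∧ ε ≤ q' n)
    (P : Measure (Config SqE)) (hP : IsBernoulliProduct (rsqHI q q') P) :
    BoxCrossingProperty rsqLattice P := by
  obtain ⟨ε, hε, h⟩ := hε
  have hqq : ∀ j, q' j = 1 - q j := fun j => by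
    have := (h j).1
    unfold kappaS at this
    linarith
  refine boxCrossing_of_product hq hqq (mul_pos hε hε) (fun j => ?_) hP
  rw [← hqq]
  exact mul_le_mul (h j).2.1 (h j).2.2 hε.le (hε.le.trans (h j).2.1)

end Perc
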